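/- (Rhin–Viola) The irrationality exponent of ζ(3) is at most 5.5139; that is, there exist only finitely many rational numbers p/q (with p ∈ ℤ and q a positive integer) such that |ζ(3) − p/q| < 1/q^{5.5139}. -/

import Mathlib

/-- The values of the Riemann zeta function at integers `s ≥ 2`,
as a real number: `ζ(s) = ∑_{n ≥ 1} n^{-s}`. -/
noncomputable def zetaR (s : ℕ) : ℝ := ∑' n : ℕ, 1 / (n + 1 : ℝ) ^ s

section

open Real Set Filter Topology MeasureTheory

/-- The normalised error `ψ(eˣ) e⁻ˣ - 1` in the prime number theorem. -/
noncomputable def psiErr (x : ℝ) : ℝ := Chebyshev.psi (exp x) * exp (-x) - 1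

theorem measurable_psiErr : Measurable psiErr := by
  unfold psiErr
  exact ((Chebyshev.psi_mono.measurable.comp measurable_exp).mul
    (measurable_exp.comp measurable_neg)).sub_const 1

theorem abs_psiErr_le (x : ℝ) : |psiErr x| ≤ 10 := by
  unfold psiErr
  have h1 := Chebyshev.psi_le_const_mul_self (exp_pos x).le
  have h0 := Chebyshev.psi_nonneg (exp x)
  have h2 : Chebyshev.psi (exp x) * exp (-x) ≤ log 4 + 4 := by
    rw [exp_neg, ← div_eq_mul_inv, div_le_iff₀ (exp_pos x)]; exact h1
  have h3 : 0 ≤ Chebyshev.psi (exp x) * exp (-x) := by positivity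
  have h4 : log 4 ≤ 4 - 1 := log_le_sub_one_of_pos (by norm_num)
  rw [abs_le]; constructor <;> linarith

theorem integrableOn_cexp_neg_mul {w : ℂ} (hw : 0 < w.re) :
    IntegrableOn (fun x : ℝ => Complex.exp (-w * x)) (Ioi 0) :=
  integrableOn_exp_mul_complex_Ioi (by simpa using hw) 0

theorem integrableOn_psiErr_mul_cexp {w : ℂ} (hw : 0 < w.re) :
    IntegrableOn (fun x : ℝ => (psiErr x : ℂ) * Complex.exp (-w * x)) (Ioi 0) := by
  refine (integrableOn_cexp_neg_mul hw).bdd_mul (c := 10)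
    (Complex.measurable_ofReal.comp measurable_psiErr).aestronglyMeasurable ?_
  exact Eventually.of_forall fun x => by simpa using abs_psiErr_le x

open ArithmeticFunction in
theorem LSeries_vonMangoldt_eq_integral {w : ℂ} (hw : 0 < w.re) :
    LSeries (fun n => (vonMangoldt n : ℂ)) (1 + w) =
      (1 + w) * ∫ x in Ioi (0 : ℝ), ((psiErr x + 1 : ℝ) : ℂ) * Complex.exp (-w * x) := by
  have hO : (fun n : ℕ ↦ ∑ k ∈ Finset.Icc 1 n, vonMangoldt k) =O[atTop] fun n ↦ (n : ℝ) ^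
      (1 : ℝ) := by
    refine Asymptotics.IsBigO.of_bound (Real.log 4 + 4) (Eventually.of_forall fun n => ?_)
    have h := Chebyshev.psi_le_const_mul_self (x := n) (by positivity)
    have h0 := Chebyshev.psi_nonneg n
    have e : ∑ k ∈ Finset.Icc 1 n, vonMangoldt k = Chebyshev.psi n := by
      rw [Chebyshev.psi, Nat.floor_natCast]; rfl
    rw [e, rpow_one, norm_of_nonneg h0, norm_of_nonneg (by positivity)]
    exact h
  rw [LSeries_eq_mul_integral_of_nonneg (fun n => vonMangoldt n) zero_le_one (by simpa using hw) hO
    (fun n => vonMangoldt_nonneg)]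
  congr 1
  have him : Real.exp '' (Ioi 0) = Ioi 1 := by
    ext t; constructor
    · rintro ⟨x, hx, rfl⟩; exact one_lt_exp_iff.2 hx
    · intro ht
      exact ⟨Real.log t, Real.log_pos ht, exp_log (by linarith [mem_Ioi.1 ht])⟩
  rw [← him, integral_image_eq_integral_abs_deriv_smul measurableSet_Ioi
    (fun x _ => (Real.hasDerivAt_exp x).hasDerivWithinAt) (Real.exp_injective.injOn)]
  refine setIntegral_congr_fun measurableSet_Ioi fun x _ => ?_
  have e : (∑ k ∈ Finset.Icc 1 ⌊rexp x⌋₊, ((vonMangoldt k : ℝ) : ℂ)) =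
      ((Chebyshev.psi (exp x) : ℝ) : ℂ) := by
    rw [Chebyshev.psi]; push_cast; rfl
  simp only [e]
  rw [abs_of_pos (exp_pos x), Complex.real_smul]
  have : (rexp x : ℂ) ^ (-(1 + w + 1)) = Complex.exp (-(2 + w) * x) := by
    rw [Complex.cpow_def_of_ne_zero (by exact_mod_cast (exp_pos x).ne'),
      ← Complex.ofReal_log (exp_pos x).le, log_exp]
    congr 1; ring
  rw [this]
  unfold psiErr
  push_cast
  rw [mul_left_comm, ← Complex.exp_add, sub_add_cancel, mul_assoc, ← Complex.exp_add]
  congr 2; ring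

/-- The continuous extension to `1 ≤ re s` of the Laplace transform of `psiErr`. -/
noncomputable def psiErrTransform (s : ℂ) : ℂ :=
  (ArithmeticFunction.vonMangoldt.LFunctionResidueClassAux (q := 1) 1 s - 1) / s

theorem continuousOn_psiErrTransform : ContinuousOn psiErrTransform {s | 1 ≤ s.re} := by
  refine ((ArithmeticFunction.vonMangoldt.continuousOn_LFunctionResidueClassAux (q := 1) 1).sub
    continuousOn_const).div continuousOn_id ?_
  rintro s hs rfl
  simp at hs
  exact absurd hs (by norm_num)

theorem integral_psiErr_mul_cexp {w : ℂ} (hw : 0 < w.re) :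
    ∫ x in Ioi (0 : ℝ), (psiErr x : ℂ) * Complex.exp (-w * x) = psiErrTransform (1 + w) := by
  have hL := LSeries_vonMangoldt_eq_integral hw
  have hA := ArithmeticFunction.vonMangoldt.eqOn_LFunctionResidueClassAux (q := 1) (a := 1)
      isUnit_one
    (x := 1 + w) (by simpa using hw)
  have hw0 : w ≠ 0 := by rintro rfl; simp at hw
  have hs0 : 1 + w ≠ 0 := by
    intro h; have := congrArg Complex.re h; simp at this; linarith
  have hres : (ArithmeticFunction.vonMangoldt.residueClass (1 : ZMod 1)) =
      fun n => ArithmeticFunction.vonMangoldt n := by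
    funext n
    simp [ArithmeticFunction.vonMangoldt.residueClass, Subsingleton.elim ((n : ZMod 1)) 1]
  simp only [hres] at hA
  unfold psiErrTransform
  rw [hA]
  have e2 : ∫ x in Ioi (0 : ℝ), ((psiErr x + 1 : ℝ) : ℂ) * Complex.exp (-w * x) =
      (∫ x in Ioi (0 : ℝ), (psiErr x : ℂ) * Complex.exp (-w * x)) + 1 / w := by
    have : ∫ x in Ioi (0 : ℝ), Complex.exp (-w * x) = 1 / w := by
      rw [integral_exp_mul_complex_Ioi (by simpa using hw)]
      simp
    rw [← this, ← integral_add (integrableOn_psiErr_mul_cexp hw) (integrableOn_cexp_neg_mul hw)]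
    refine integral_congr_ae (Eventually.of_forall fun x => ?_)
    push_cast; ring
  rw [e2] at hL
  rw [hL]
  simp
  field_simp
  ring

/-- The Fejér kernel, as a cosine transform of the triangle function. -/
noncomputable def fejerKernel (l v : ℝ) : ℝ := ∫ t in Ioc 0 l, (1 - t / l) * cos (t * v)

theorem fejerKernel_eq {l v : ℝ} (hl : 0 < l) (hv : v ≠ 0) :
    fejerKernel l v = (1 - cos (l * v)) / (l * v ^ 2) := by
  unfold fejerKernel
  rw [← intervalIntegral.integral_of_le hl.le]
  have : ∀ t ∈ uIcc 0 l, HasDerivAt (fun t => (1 - t / l) * (sin (t * v) / v) -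
      cos (t * v) / (l * v ^ 2))
      ((1 - t / l) * cos (t * v)) t := by
    intro t _
    have h1 : HasDerivAt (fun t : ℝ => t * v) v t := by simpa using (hasDerivAt_id t).mul_const v
    have h2 : HasDerivAt (fun t : ℝ => 1 - t / l) (-(1 / l)) t := by
      simpa using ((hasDerivAt_id t).div_const l).const_sub 1
    refine ((h2.mul (h1.sin.div_const v)).sub (h1.cos.div_const (l * v ^ 2))).congr_deriv ?_
    field_simp
    ring
  rw [intervalIntegral.integral_eq_sub_of_hasDerivAt this (by
    apply Continuous.intervalIntegrable; fun_prop)]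
  field_simp
  simp
  ring

theorem abs_fejerKernel_le {l : ℝ} (hl : 0 < l) (v : ℝ) : |fejerKernel l v| ≤ l := by
  unfold fejerKernel
  have := norm_setIntegral_le_of_norm_le_const (μ := volume) (s := Ioc 0 l) (C := 1)
    (f := fun t => (1 - t / l) * cos (t * v)) (by simp) (fun t ht => by
      rw [norm_mul, norm_eq_abs, norm_eq_abs]
      have h1 : |1 - t / l| ≤ 1 := by
        have := div_le_one_of_le₀ ht.2 hl.le
        have := div_nonneg ht.1.le hl.le
        rw [abs_le]; constructor <;> linarith
      have := abs_cos_le_one (t * v)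
      calc _ ≤ (1 : ℝ) * 1 := by gcongr
        _ = 1 := by ring)
  simpa [hl.le] using this

theorem fejerKernel_nonneg {l : ℝ} (hl : 0 < l) {v : ℝ} (hv : v ≠ 0) : 0 ≤ fejerKernel l v := by
  rw [fejerKernel_eq hl hv]
  have := cos_le_one (l * v)
  have := sub_nonneg.2 this
  positivity

theorem fejerKernel_le_div {l v : ℝ} (hl : 0 < l) (hv : v ≠ 0) :
    fejerKernel l v ≤ 2 / (l * v ^ 2) := by
  rw [fejerKernel_eq hl hv]
  have := neg_one_le_cos (l * v)
  gcongr
  linarith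

theorem abs_fejerKernel_le' {l : ℝ} (hl : 0 < l) (v : ℝ) :
    |fejerKernel l v| ≤ (l + 2 / l) * (1 + v ^ 2)⁻¹ := by
  rcases eq_or_ne v 0 with rfl | hv
  · have := abs_fejerKernel_le hl 0
    have : 0 < 2 / l := by positivity
    simp; linarith
  · rw [← div_eq_mul_inv, le_div_iff₀ (by positivity)]
    have h1 := abs_fejerKernel_le hl v
    have h2 := fejerKernel_le_div hl hv
    rw [← abs_of_nonneg (fejerKernel_nonneg hl hv), le_div_iff₀ (by positivity)] at h2
    have : |fejerKernel l v| * v ^ 2 ≤ 2 / l := by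
      rw [le_div_iff₀ hl]; linarith
    linarith

theorem continuous_fejerKernel (l : ℝ) (hl : 0 < l) : Continuous (fejerKernel l) := by
  unfold fejerKernel
  simp_rw [← intervalIntegral.integral_of_le hl.le]
  apply intervalIntegral.continuous_parametric_intervalIntegral_of_continuous' (by fun_prop)

theorem integrable_fejerKernel {l : ℝ} (hl : 0 < l) : Integrable (fejerKernel l) := by
  refine Integrable.mono' (integrable_inv_one_add_sq.const_mul (l + 2 / l))
    (continuous_fejerKernel l hl).aestronglyMeasurable (Eventually.of_forall fun v => ?_)
  exact abs_fejerKernel_le' hl v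

theorem integral_psiErr_mul_exp_mul_fejerKernel {l ε : ℝ} (hε : 0 < ε) (y : ℝ) :
    ∫ x in Ioi (0 : ℝ), psiErr x * exp (-ε * x) * fejerKernel l (x - y) =
      (∫ t in Ioc 0 l, ((1 - t / l : ℝ) : ℂ) * Complex.exp (t * y * Complex.I) *
        psiErrTransform (1 + (ε + t * Complex.I))).re := by
  have hre : ∀ t : ℝ, ((ε : ℂ) + t * Complex.I).re = ε := by intro t; simp
  have hG : ∀ t : ℝ, psiErrTransform (1 + (ε + t * Complex.I)) =
      ∫ x in Ioi (0 : ℝ), (psiErr x : ℂ) * Complex.exp (-(ε + t * Complex.I) * x) := by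
    intro t; rw [integral_psiErr_mul_cexp (by rw [hre]; exact hε)]
  simp_rw [hG, ← integral_const_mul]
  set F : ℝ → ℝ → ℂ := fun t x => ((1 - t / l : ℝ) : ℂ) * Complex.exp (t * y * Complex.I) *
    ((psiErr x : ℂ) * Complex.exp (-(ε + t * Complex.I) * x)) with hF
  have hFe : ∀ t x, F t x = (((1 - t / l : ℝ) : ℂ)) * ((psiErr x : ℂ) * Complex.exp (-ε * x)) *
      Complex.exp (-(t * (x - y) : ℝ) * Complex.I) := by
    intro t x
    simp only [hF]
    have : Complex.exp (t * y * Complex.I) * Complex.exp (-(ε + t * Complex.I) * x) =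
      Complex.exp (-ε * x) * Complex.exp (-(t * (x - y) : ℝ) * Complex.I) := by
      rw [← Complex.exp_add, ← Complex.exp_add]; congr 1; push_cast; ring
    linear_combination ((1 - t / l : ℝ) : ℂ) * (psiErr x : ℂ) * this
  have hintg : Integrable (Function.uncurry F)
      ((volume.restrict (Ioc 0 l)).prod (volume.restrict (Ioi 0))) := by
    have h1 : Integrable (fun t : ℝ => ((1 - t / l : ℝ) : ℂ)) (volume.restrict (Ioc 0 l)) :=
      (Continuous.integrableOn_Ioc (by fun_prop))
    have h2 := integrableOn_psiErr_mul_cexp (w := (ε : ℂ)) (by simpa using hε)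
    have h3 := h1.mul_prod h2
    have : Function.uncurry F = fun z : ℝ × ℝ => Complex.exp (-(z.1 * (z.2 - y) : ℝ) * Complex.I) *
        (((1 - z.1 / l : ℝ) : ℂ) * ((psiErr z.2 : ℂ) * Complex.exp (-ε * z.2))) := by
      funext z
      simp only [Function.uncurry, hFe]
      ring
    rw [this]
    refine h3.bdd_mul (c := 1) (Continuous.aestronglyMeasurable (by fun_prop)) ?_
    refine Eventually.of_forall fun z => ?_
    rw [← Complex.ofReal_neg, Complex.norm_exp_ofReal_mul_I]
  rw [show (∫ t in Ioc 0 l, ∫ x in Ioi (0 : ℝ), F t x) = ∫ x in Ioi (0 : ℝ), ∫ t in Ioc 0 l,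
    F t x from
    integral_integral_swap hintg]
  have hr : Integrable (fun x => ∫ t in Ioc 0 l, F t x) (volume.restrict (Ioi 0)) :=
    hintg.integral_prod_right
  have := integral_re hr
  rw [← RCLike.re_eq_complex_re, ← this]
  refine setIntegral_congr_fun measurableSet_Ioi fun x _ => ?_
  simp only [fejerKernel]
  rw [← integral_const_mul]
  have hi : Integrable (fun t => F t x) (volume.restrict (Ioc 0 l)) := by
    simp only [hFe]
    exact Continuous.integrableOn_Ioc (by fun_prop)
  rw [← integral_re hi]
  refine integral_congr_ae (Eventually.of_forall fun t => ?_)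
  simp only [hFe, RCLike.re_eq_complex_re]
  have e1 : (((1 - t / l : ℝ) : ℂ)) * ((psiErr x : ℂ) * Complex.exp (-ε * x)) *
      Complex.exp (-(t * (x - y) : ℝ) * Complex.I) =
      (((1 - t / l) * (psiErr x * exp (-ε * x)) : ℝ) : ℂ) *
        Complex.exp ((-(t * (x - y)) : ℝ) * Complex.I) := by push_cast; ring
  rw [e1, Complex.re_ofReal_mul, Complex.exp_ofReal_mul_I_re, cos_neg]
  ring

theorem integral_psiErr_mul_fejerKernel {l : ℝ} (hl : 0 < l) (y : ℝ) :
    ∫ x in Ioi (0 : ℝ), psiErr x * fejerKernel l (x - y) =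
      (∫ t in Ioc 0 l, ((1 - t / l : ℝ) : ℂ) * Complex.exp (t * y * Complex.I) *
        psiErrTransform (1 + t * Complex.I)).re := by
  set e : ℕ → ℝ := fun n => 1 / ((n : ℝ) + 1) with he
  have he0 : ∀ n, 0 < e n := fun n => by positivity
  have he1 : ∀ n, e n ≤ 1 := fun n => by
    simp only [he]; rw [div_le_one (by positivity)]; linarith [n.cast_nonneg (α := ℝ)]
  have het : Tendsto e atTop (𝓝 0) := tendsto_one_div_add_atTop_nhds_zero_nat
  have hL : Tendsto (fun n => ∫ x in Ioi (0 : ℝ), psiErr x * exp (-(e n) * x) *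
      fejerKernel l (x - y))
      atTop (𝓝 (∫ x in Ioi (0 : ℝ), psiErr x * fejerKernel l (x - y))) := by
    refine tendsto_integral_of_dominated_convergence (fun x => 10 * |fejerKernel l (x - y)|)
        ?_ ?_ ?_ ?_
    · intro n
      exact ((measurable_psiErr.mul (by fun_prop)).mul
        ((continuous_fejerKernel l hl).measurable.comp (by fun_prop))).aestronglyMeasurable
    · exact (((integrable_fejerKernel hl).comp_sub_right y).abs.const_mul 10).integrableOn
    · intro n
      refine (ae_restrict_iff' measurableSet_Ioi).2 (Eventually.of_forall fun x hx => ?_)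
      rw [norm_mul, norm_mul, norm_eq_abs, norm_eq_abs, norm_eq_abs, abs_of_pos (exp_pos _)]
      have h1 : exp (-(e n) * x) ≤ 1 := exp_le_one_iff.2 (by
        have := mul_pos (he0 n) hx; linarith)
      have h2 := abs_psiErr_le x
      have : |psiErr x| * exp (-(e n) * x) ≤ 10 * 1 := by gcongr
      rw [mul_one] at this
      gcongr
    · refine Eventually.of_forall fun x => ?_
      have : Tendsto (fun n => exp (-(e n) * x)) atTop (𝓝 (exp (-0 * x))) :=
        (continuous_exp.tendsto _).comp ((het.neg).mul_const x)
      simpa using (this.const_mul (psiErr x)).mul_const (fejerKernel l (x - y))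
  have hcont : ContinuousOn (fun p : ℝ × ℝ => psiErrTransform (1 + (p.1 + p.2 * Complex.I)))
      (Icc 0 1 ×ˢ Icc 0 l) := by
    refine continuousOn_psiErrTransform.comp (Continuous.continuousOn (by fun_prop)) ?_
    rintro ⟨p, q⟩ ⟨hp, _⟩
    simpa using hp.1
  obtain ⟨C, hC⟩ := (isCompact_Icc.prod isCompact_Icc).exists_bound_of_continuousOn hcont
  have hR : Tendsto (fun n => (∫ t in Ioc 0 l, ((1 - t / l : ℝ) : ℂ) *
      Complex.exp (t * y * Complex.I) *
        psiErrTransform (1 + (e n + t * Complex.I))).re) atTop (𝓝 (∫ t in Ioc 0 l,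
        ((1 - t / l : ℝ) : ℂ) * Complex.exp (t * y * Complex.I) *
        psiErrTransform (1 + t * Complex.I)).re) := by
    refine (Complex.continuous_re.tendsto _).comp ?_
    refine tendsto_integral_of_dominated_convergence (fun t => 1 * 1 * C) ?_ ?_ ?_ ?_
    · intro n
      refine ContinuousOn.aestronglyMeasurable ?_ measurableSet_Ioc
      refine ContinuousOn.mul (Continuous.continuousOn (by fun_prop)) ?_
      refine hcont.comp (f := fun t : ℝ => (e n, t)) (Continuous.continuousOn (by fun_prop)) ?_
      intro t ht
      exact ⟨⟨(he0 n).le, he1 n⟩, ht.1.le, ht.2⟩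
    · exact integrable_const _
    · intro n
      refine (ae_restrict_iff' measurableSet_Ioc).2 (Eventually.of_forall fun t ht => ?_)
      rw [norm_mul, norm_mul]
      have h3 := hC (e n, t) ⟨⟨(he0 n).le, he1 n⟩, ht.1.le, ht.2⟩
      have h1 : ‖((1 - t / l : ℝ) : ℂ)‖ ≤ 1 := by
        rw [Complex.norm_real, norm_eq_abs]
        have := div_le_one_of_le₀ ht.2 hl.le
        have := div_nonneg ht.1.le hl.le
        rw [abs_le]; constructor <;> linarith
      have h2 : ‖Complex.exp (t * y * Complex.I)‖ ≤ 1 := by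
        rw [← Complex.ofReal_mul, Complex.norm_exp_ofReal_mul_I]
      gcongr
    · refine (ae_restrict_iff' measurableSet_Ioc).2 (Eventually.of_forall fun t ht => ?_)
      refine Tendsto.const_mul _ ?_
      have h1 : ContinuousWithinAt psiErrTransform {s | 1 ≤ s.re} (1 + t * Complex.I) :=
        continuousOn_psiErrTransform _ (by simp)
      refine h1.tendsto.comp ?_
      refine tendsto_nhdsWithin_iff.2 ⟨?_, Eventually.of_forall fun n => by simpa using (he0 n).le⟩
      have : Tendsto (fun n => (1 : ℂ) + (((e n : ℝ) : ℂ) + t * Complex.I)) atTop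
          (𝓝 (1 + (((0 : ℝ) : ℂ) + t * Complex.I))) :=
        (((Complex.continuous_ofReal.tendsto 0).comp het).add_const _).const_add 1
      simpa using this
  refine tendsto_nhds_unique hL (hR.congr fun n => ?_)
  exact (integral_psiErr_mul_exp_mul_fejerKernel (he0 n) y).symm

theorem tendsto_integral_psiErr_mul_fejerKernel {l : ℝ} (hl : 0 < l) :
    Tendsto (fun y => ∫ x in Ioi (0 : ℝ), psiErr x * fejerKernel l (x - y)) atTop (𝓝 0) := by
  simp_rw [integral_psiErr_mul_fejerKernel hl]
  suffices hs : Tendsto (fun y : ℝ => ∫ t in Ioc 0 l, ((1 - t / l : ℝ) : ℂ) *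
      Complex.exp (t * y * Complex.I) * psiErrTransform (1 + t * Complex.I)) atTop (𝓝 0) by
    rw [← Complex.zero_re]
    exact (Complex.continuous_re.tendsto 0).comp hs
  have h := Real.tendsto_integral_exp_smul_cocompact
    (fun t : ℝ => (Ioc 0 l).indicator (fun t : ℝ => ((1 - t / l : ℝ) : ℂ) *
      psiErrTransform (1 + t * Complex.I)) t)
  have hc : Tendsto (fun y : ℝ => -(y / (2 * π))) atTop (cocompact ℝ) := by
    rw [cocompact_eq_atBot_atTop]
    exact (tendsto_neg_atTop_atBot.comp (tendsto_id.atTop_div_const (by positivity))).mono_right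
        le_sup_left
  refine (h.comp hc).congr fun y => ?_
  simp only [Function.comp]
  rw [← integral_indicator measurableSet_Ioc]
  refine integral_congr_ae (Eventually.of_forall fun t => ?_)
  simp only [indicator]
  split_ifs
  · rw [Circle.smul_def, Real.fourierChar_apply]
    have : ((2 * π * -(t * -(y / (2 * π))) : ℝ) : ℂ) * Complex.I = t * y * Complex.I := by
      have : (2 * π * -(t * -(y / (2 * π))) : ℝ) = t * y := by field_simp
      rw [this]; push_cast; ring
    rw [this, smul_eq_mul]; ring
  · simp

theorem le_integral_mul_fejerKernel {H : ℝ → ℝ} (hm : Measurable H) (hb : ∀ x, |H x| ≤ 10)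
    {a η : ℝ} (ha : 0 < a) (hη : 0 < η) (hη1 : η ≤ 1) (h : ∀ v ∈ Icc (-a) a, η / 2 ≤ H v) :
    3 / 10 * η ≤ ∫ v, H v * fejerKernel (400 / (a * η)) v := by
  set l := 400 / (a * η) with hl
  have hl0 : 0 < l := by positivity
  have hal : a * l = 400 / η := by rw [hl]; field_simp
  have hla : 1 / l ≤ a := by
    rw [div_le_iff₀ hl0, hal, le_div_iff₀ hη]; linarith
  have hK := integrable_fejerKernel hl0
  have hHK : Integrable (fun v => H v * fejerKernel l v) :=
    hK.bdd_mul (c := 10) hm.aestronglyMeasurable (Eventually.of_forall hb)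
  have hpos : ∀ v, 0 ≤ fejerKernel l v := by
    intro v
    rcases eq_or_ne v 0 with rfl | hv
    · have hd : Dense ({0}ᶜ : Set ℝ) := dense_compl_singleton 0
      have : {0}ᶜ ⊆ {v | 0 ≤ fejerKernel l v} := fun v hv => fejerKernel_nonneg hl0 hv
      have hcl : IsClosed {v | 0 ≤ fejerKernel l v} :=
        isClosed_le continuous_const (continuous_fejerKernel l hl0)
      have := hcl.closure_subset_iff.2 this
      rw [hd.closure_eq] at this
      exact this (mem_univ 0)
    · exact fejerKernel_nonneg hl0 hv
  have hlow : ∀ v, -10 * fejerKernel l v ≤ H v * fejerKernel l v := fun v =>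
    mul_le_mul_of_nonneg_right (by linarith [(abs_le.1 (hb v)).1]) (hpos v)
  have hsplit : ∫ v, H v * fejerKernel l v = (∫ v in Iic (-a), H v * fejerKernel l v) +
      ((∫ v in Ioc (-a) a, H v * fejerKernel l v) + ∫ v in Ioi a, H v * fejerKernel l v) := by
    rw [← setIntegral_union (Ioc_disjoint_Ioi le_rfl) measurableSet_Ioi hHK.integrableOn
      hHK.integrableOn,
      Ioc_union_Ioi_eq_Ioi (by linarith), ← compl_Iic, integral_add_compl measurableSet_Iic hHK]
  have hintg : ∫ v in Ioi a, 2 / (l * v ^ 2) = 2 / (l * a) := by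
    have := integral_Ioi_rpow_of_lt (a := -2) (by norm_num) ha
    have e : ∀ v ∈ Ioi a, 2 / (l * v ^ 2) = (2 / l) * v ^ (-2 : ℝ) := by
      intro v hv
      have : 0 < v := ha.trans hv
      rw [rpow_neg this.le]; norm_cast; field_simp
    rw [setIntegral_congr_fun measurableSet_Ioi e, integral_const_mul, this]
    rw [show (-2 + 1 : ℝ) = -1 by norm_num, rpow_neg ha.le, rpow_one]
    field_simp
  have hintb : IntegrableOn (fun v => 2 / (l * v ^ 2)) (Ioi a) := by
    have := (integrableOn_Ioi_rpow_of_lt (a := -2) (by norm_num) ha).const_mul (2 / l)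
    refine IntegrableOn.congr_fun this (fun v hv => ?_) measurableSet_Ioi
    have : 0 < v := ha.trans hv
    rw [rpow_neg this.le]; norm_cast; field_simp
  have hout : ∫ v in Ioi a, fejerKernel l v ≤ 2 / (l * a) := by
    rw [← hintg]
    refine setIntegral_mono_on hK.integrableOn hintb measurableSet_Ioi fun v hv => ?_
    exact fejerKernel_le_div hl0 (ha.trans hv).ne'
  have hout' : ∫ v in Iic (-a), fejerKernel l v ≤ 2 / (l * a) := by
    have : ∫ v in Iic (-a), fejerKernel l v = ∫ v in Ioi a, fejerKernel l v := by
      have h1 := integral_comp_neg_Iic (-a) (fejerKernel l)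
      rw [neg_neg] at h1
      rw [← h1]
      congr 1; funext v; unfold fejerKernel
      simp
    rw [this]; exact hout
  have hin : 4 / 5 ≤ ∫ v in Ioc (-a) a, fejerKernel l v := by
    have h1 : ∫ v in Ioc (-(1 / l)) (1 / l), fejerKernel l v ≤ ∫ v in Ioc (-a) a, fejerKernel l v :=
      setIntegral_mono_set hK.integrableOn (Eventually.of_forall hpos)
        (Ioc_subset_Ioc (by linarith) hla).eventuallyLE
    have h2 : ∫ v in Ioc (-(1 / l)) (1 / l), (2 / 5 * l) ≤ ∫ v in Ioc (-(1 / l)) (1 / l),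
        fejerKernel l v := by
      refine integral_mono_ae (integrable_const _) hK.integrableOn ?_
      have hne : ∀ᵐ v : ℝ ∂(volume.restrict (Ioc (-(1 / l)) (1 / l))), v ≠ 0 :=
        ae_restrict_of_ae (by
          have : (volume : Measure ℝ) {0} = 0 := Real.volume_singleton
          exact compl_mem_ae_iff.2 this)
      have hmem := ae_restrict_mem (μ := (volume : Measure ℝ))
          (measurableSet_Ioc (a := -(1 / l)) (b := 1 / l))
      filter_upwards [hne, hmem] with v hv hv2
      rw [fejerKernel_eq hl0 hv, le_div_iff₀ (by positivity)]
      have hx : |l * v| ≤ 1 := by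
        rw [abs_mul, abs_of_pos hl0]
        have : |v| ≤ 1 / l := abs_le.2 ⟨hv2.1.le, hv2.2⟩
        rw [le_div_iff₀ hl0] at this; linarith
      have hc := (abs_le.1 (Real.cos_bound hx)).2
      have h4 : |l * v| ^ 4 ≤ (l * v) ^ 2 := by
        have h5 : |l * v| ^ 4 = (l * v) ^ 2 * (l * v) ^ 2 := by
          rw [← sq_abs (l * v)]; ring
        rw [h5]
        have h6 : (l * v) ^ 2 ≤ 1 := by rw [← sq_abs]; exact pow_le_one₀ (abs_nonneg _) hx
        nlinarith [sq_nonneg (l * v)]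
      nlinarith [sq_nonneg (l * v)]
    have h3 : ∫ v in Ioc (-(1 / l)) (1 / l), (2 / 5 * l) = 4 / 5 := by
      have : (0:ℝ) ≤ 1 / l + 1 / l := by positivity
      simp
      rw [max_eq_left (by positivity)]
      field_simp; norm_num
    linarith
  have g1 : -10 * (2 / (l * a)) ≤ ∫ v in Ioi a, H v * fejerKernel l v := by
    have := setIntegral_mono (hK.integrableOn (s := Ioi a) |>.const_mul (-10)) (hHK.integrableOn)
        hlow
    rw [integral_const_mul] at this
    linarith
  have g2 : -10 * (2 / (l * a)) ≤ ∫ v in Iic (-a), H v * fejerKernel l v := by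
    have := setIntegral_mono (hK.integrableOn (s := Iic (-a)) |>.const_mul (-10)) (hHK.integrableOn)
        hlow
    rw [integral_const_mul] at this
    linarith
  have g3 : η / 2 * (4 / 5) ≤ ∫ v in Ioc (-a) a, H v * fejerKernel l v := by
    have := setIntegral_mono_on (hK.integrableOn (s := Ioc (-a) a) |>.const_mul (η / 2))
        (hHK.integrableOn)
      measurableSet_Ioc (fun v hv => mul_le_mul_of_nonneg_right (h v ⟨hv.1.le, hv.2⟩) (hpos v))
    rw [integral_const_mul] at this
    nlinarith
  have g4 : 2 / (l * a) = η / 200 := by rw [mul_comm, hal]; field_simp; norm_num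
  rw [hsplit]
  rw [g4] at g1 g2
  linarith

theorem psiErr_add_one_mul_exp_mono {x y : ℝ} (h : x ≤ y) :
    (psiErr x + 1) * exp x ≤ (psiErr y + 1) * exp y := by
  have e : ∀ x, (psiErr x + 1) * exp x = Chebyshev.psi (exp x) := by
    intro x; unfold psiErr
    rw [sub_add_cancel, mul_assoc, ← exp_add]; simp
  rw [e, e]
  exact Chebyshev.psi_mono (exp_le_exp.2 h)

theorem le_integral_Ioi_mul_fejerKernel {H : ℝ → ℝ} (hm : Measurable H) (hb : ∀ x, |H x| ≤ 10)
    {a η y : ℝ} (ha : 0 < a) (hη : 0 < η) (hη1 : η ≤ 1) (hy : a < y)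
    (h : ∀ x ∈ Icc (y - a) (y + a), η / 2 ≤ H x) :
    3 / 10 * η ≤ ∫ x in Ioi (0 : ℝ), H x * fejerKernel (400 / (a * η)) (x - y) := by
  obtain ⟨F, hF⟩ : ∃ F : ℝ → ℝ, F = (Ioi (0 : ℝ)).indicator H := ⟨_, rfl⟩
  have h1 : ∫ x in Ioi (0 : ℝ), H x * fejerKernel (400 / (a * η)) (x - y) =
      ∫ v, F (v + y) * fejerKernel (400 / (a * η)) v := by
    rw [← integral_indicator measurableSet_Ioi, ← integral_add_right_eq_self _ y]
    refine integral_congr_ae (Eventually.of_forall fun v => ?_)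
    simp only [hF, indicator]
    split_ifs <;> simp
  rw [h1, hF]
  refine le_integral_mul_fejerKernel ((hm.indicator measurableSet_Ioi).comp
      (measurable_add_const y))
    (fun x => ?_) ha hη hη1 fun v hv => ?_
  · simp only [Function.comp, indicator]
    split_ifs
    · exact hb _
    · simp
  · have : v + y ∈ Ioi (0 : ℝ) := by simp; linarith [hv.1]
    simp only [Function.comp, indicator_of_mem this]
    exact h _ ⟨by linarith [hv.1], by linarith [hv.2]⟩

theorem tendsto_psiErr : Tendsto psiErr atTop (𝓝 0) := by
  suffices ∀ η : ℝ, 0 < η → η ≤ 1 → ∀ᶠ y in atTop, |psiErr y| < η by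
    rw [Metric.tendsto_nhds]
    intro e he
    filter_upwards [this (min e 1) (by positivity) (min_le_right _ _)] with y hy
    rw [Real.dist_eq, sub_zero]
    exact hy.trans_le (min_le_left _ _)
  intro η hη hη1
  set a := η / 8 with ha
  have ha0 : 0 < a := by positivity
  have ht := tendsto_integral_psiErr_mul_fejerKernel (l := 400 / (a * η)) (by positivity)
  have hev : ∀ᶠ y in atTop, |∫ x in Ioi (0 : ℝ), psiErr x * fejerKernel (400 / (a * η)) (x - y)| <
      3 / 10 * η := by
    have := (Metric.tendsto_nhds.1 ht) (3 / 10 * η) (by positivity)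
    simpa [Real.dist_eq] using this
  have hp : Tendsto (fun y : ℝ => y + a) atTop atTop := tendsto_atTop_add_const_right _ _ tendsto_id
  have hn : Tendsto (fun y : ℝ => y - a) atTop atTop := tendsto_atTop_add_const_right _ _ tendsto_id
  have hexp : exp (2 * a) ≤ (1 - 2 * a)⁻¹ := by
    rw [le_inv_comm₀ (exp_pos _) (by linarith), ← exp_neg]
    linarith [add_one_le_exp (-(2 * a))]
  have hexp' : 1 - 2 * a ≤ exp (-(2 * a)) := by linarith [add_one_le_exp (-(2 * a))]
  filter_upwards [hp.eventually hev, hn.eventually hev, eventually_gt_atTop (2 * a)] with y h1 h2 hy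
  by_contra! hc
  rcases le_abs'.1 hc with hc | hc
  · have := le_integral_Ioi_mul_fejerKernel measurable_psiErr.neg (fun x => by
      simpa using abs_psiErr_le x) ha0 hη hη1 (y := y - a) (by linarith) (fun x hx => by
      have hm := psiErr_add_one_mul_exp_mono (x := x) (y := y) (by linarith [hx.2])
      have hx1 : psiErr x + 1 ≤ (psiErr y + 1) * exp (y - x) := by
        rw [exp_sub, mul_div_assoc', le_div_iff₀ (exp_pos x)]; exact hm
      have hp1 : 0 ≤ psiErr y + 1 := by
        unfold psiErr; rw [sub_add_cancel]
        exact mul_nonneg (Chebyshev.psi_nonneg _) (exp_pos _).le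
      have : exp (y - x) ≤ (1 - 2 * a)⁻¹ := le_trans (exp_le_exp.2 (by linarith [hx.1])) hexp
      have hx2 : psiErr x + 1 ≤ (1 - η) * (1 - 2 * a)⁻¹ := hx1.trans (by
        apply mul_le_mul (by linarith) this (exp_pos _).le (by linarith))
      rw [← div_eq_mul_inv, le_div_iff₀ (by linarith)] at hx2
      have : psiErr x + 1 ≤ 1 - η / 2 := by
        by_contra! hcon
        have : (1 - η / 2) * (1 - 2 * a) ≤ (psiErr x + 1) * (1 - 2 * a) :=
          mul_le_mul_of_nonneg_right hcon.le (by linarith)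
        nlinarith
      simp only [Pi.neg_apply]; linarith)
    simp only [Pi.neg_apply, neg_mul, integral_neg] at this
    have := (abs_lt.1 h2).1
    linarith
  · have := le_integral_Ioi_mul_fejerKernel measurable_psiErr abs_psiErr_le ha0 hη hη1 (y := y + a)
      (by linarith) (fun x hx => by
      have hm := psiErr_add_one_mul_exp_mono (x := y) (y := x) (by linarith [hx.1])
      have hx1 : (psiErr y + 1) * exp (-(x - y)) ≤ psiErr x + 1 := by
        rw [neg_sub, exp_sub, mul_div_assoc', div_le_iff₀ (exp_pos x)]; exact hm
      have : 1 - 2 * a ≤ exp (-(x - y)) := hexp'.trans (exp_le_exp.2 (by linarith [hx.2]))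
      have hx2 : (1 + η) * (1 - 2 * a) ≤ psiErr x + 1 := le_trans (by
        apply mul_le_mul (by linarith) this (by linarith) (by linarith)) hx1
      nlinarith)
    have := (abs_lt.1 h1).2
    linarith

/-- The prime number theorem for `ψ`. -/
theorem tendsto_psi_div : Tendsto (fun x : ℝ => Chebyshev.psi x / x) atTop (𝓝 1) := by
  have h := (tendsto_psiErr.comp tendsto_log_atTop).add_const 1
  rw [zero_add] at h
  refine h.congr' ?_
  filter_upwards [eventually_gt_atTop 0] with x hx
  simp only [Function.comp, psiErr]
  rw [exp_log hx, exp_neg, exp_log hx]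
  ring

/-- The prime number theorem for `θ`. -/
theorem tendsto_theta_div : Tendsto (fun x : ℝ => Chebyshev.theta x / x) atTop (𝓝 1) := by
  have h1 : Tendsto (fun x : ℝ => (Chebyshev.psi x - Chebyshev.theta x) / x) atTop (𝓝 0) := by
    have h2 := Chebyshev.isBigO_psi_sub_theta_sqrt
    have h3 : (fun x : ℝ => √x) =o[atTop] (fun x : ℝ => x) := by
      rw [Asymptotics.isLittleO_iff_tendsto' (by
        filter_upwards [eventually_gt_atTop 0] with x hx h0 using absurd h0 hx.ne')]
      refine (tendsto_sqrt_atTop.inv_tendsto_atTop).congr' ?_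
      filter_upwards [eventually_gt_atTop 0] with x hx
      rw [sqrt_div_self, Pi.inv_apply]
    exact (h2.trans_isLittleO h3).tendsto_div_nhds_zero
  have := tendsto_psi_div.sub h1
  rw [sub_zero] at this
  refine this.congr fun x => ?_
  ring

end

section

open Real Set Filter Topology MeasureTheory Polynomial

/-- The polynomial `(X + 1) ⋯ (X + n)`. -/
noncomputable def risePoly (n : ℕ) : ℝ[X] := ∏ i ∈ Finset.range n, (X + C ((i : ℝ) + 1))

/-- The polynomial `X (X - 1) ⋯ (X - n + 1)`. -/
noncomputable def fallPoly (n : ℕ) : ℝ[X] := ∏ i ∈ Finset.range n, (X - C (i : ℝ))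

theorem risePoly_succ (n : ℕ) : risePoly (n + 1) = risePoly n * (X + C ((n : ℝ) + 1)) :=
  Finset.prod_range_succ _ _

theorem fallPoly_succ (n : ℕ) : fallPoly (n + 1) = fallPoly n * (X - C (n : ℝ)) :=
  Finset.prod_range_succ _ _

theorem risePoly_zero : risePoly 0 = 1 := Finset.prod_range_zero _

theorem fallPoly_zero : fallPoly 0 = 1 := Finset.prod_range_zero _

theorem risePoly_comp_succ (n : ℕ) : (risePoly (n + 1)).comp (X - C 1) = X * risePoly n := by
  unfold risePoly
  rw [prod_comp, Finset.prod_range_succ', mul_comm]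
  congr 1
  · simp
  · refine Finset.prod_congr rfl fun i _ => ?_
    simp

theorem fallPoly_succ' (n : ℕ) : fallPoly (n + 1) = X * (fallPoly n).comp (X - C 1) := by
  unfold fallPoly
  rw [prod_comp, Finset.prod_range_succ', mul_comm]
  congr 1
  · simp
  · refine Finset.prod_congr rfl fun i _ => ?_
    simp; ring

/-- The Laplace-type sum `∑ d/dt (P(t) uᵗ)` over `t ∈ ℕ`. -/
noncomputable def derivSum (P : ℝ[X]) (u : ℝ) : ℝ :=
  ∑' t : ℕ, (P.derivative.eval (t : ℝ) + P.eval (t : ℝ) * log u) * u ^ t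

theorem summable_eval_mul_pow (P : ℝ[X]) {u : ℝ} (h0 : 0 < u) (h1 : u < 1) :
    Summable fun t : ℕ => P.eval (t : ℝ) * u ^ t := by
  induction P using Polynomial.induction_on' with
  | add p q hp hq => simpa [add_mul] using hp.add hq
  | monomial n a =>
    simp only [eval_monomial, mul_assoc]
    exact (summable_pow_mul_geometric_of_norm_lt_one n (by rwa [norm_of_nonneg h0.le])).mul_left a

theorem summable_derivSum (P : ℝ[X]) {u : ℝ} (h0 : 0 < u) (h1 : u < 1) :
    Summable fun t : ℕ => (P.derivative.eval (t : ℝ) + P.eval (t : ℝ) * log u) * u ^ t := by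
  refine ((summable_eval_mul_pow P.derivative h0 h1).add
    ((summable_eval_mul_pow P h0 h1).mul_left (log u))).congr fun t => ?_
  ring

theorem derivSum_add (P Q : ℝ[X]) {u : ℝ} (h0 : 0 < u) (h1 : u < 1) :
    derivSum (P + Q) u = derivSum P u + derivSum Q u := by
  unfold derivSum
  rw [← (summable_derivSum P h0 h1).tsum_add (summable_derivSum Q h0 h1)]
  refine tsum_congr fun t => ?_
  simp; ring

theorem derivSum_C_mul (c : ℝ) (P : ℝ[X]) (u : ℝ) :
    derivSum (C c * P) u = c * derivSum P u := by
  unfold derivSum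
  rw [← tsum_mul_left]
  refine tsum_congr fun t => ?_
  simp; ring

theorem one_sub_mul_derivSum (P : ℝ[X]) {u : ℝ} (h0 : 0 < u) (h1 : u < 1) :
    (1 - u) * derivSum P u = derivSum (P - P.comp (X - C 1)) u +
      (P.derivative.eval (-1) + P.eval (-1) * log u) := by
  have h2 : derivSum (P.comp (X - C 1)) u =
      (P.derivative.eval (-1) + P.eval (-1) * log u) + u * derivSum P u := by
    unfold derivSum
    rw [(summable_derivSum (P.comp (X - C 1)) h0 h1).tsum_eq_zero_add, ← tsum_mul_left]
    congr 1
    · simp [derivative_comp]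
    · refine tsum_congr fun t => ?_
      simp [derivative_comp]; ring
  have h3 := derivSum_add (P - P.comp (X - C 1)) (P.comp (X - C 1)) h0 h1
  rw [sub_add_cancel, h2] at h3
  linarith

/-- The inner integral `∫₀¹ zʲ (1-z)^q / (1-(1-u)z)^(e+1) dz`. -/
noncomputable def innerInt (j q e : ℕ) (u : ℝ) : ℝ :=
  ∫ z in (0 : ℝ)..1, z ^ j * (1 - z) ^ q / (1 - (1 - u) * z) ^ (e + 1)

theorem innerInt_denom_pos {u z : ℝ} (h0 : 0 < u) (h1 : u < 1) (hz : z ∈ Icc (0 : ℝ) 1) :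
    0 < 1 - (1 - u) * z := by nlinarith [hz.1, hz.2]

theorem innerInt_intervalIntegrable (j q e : ℕ) {u : ℝ} (h0 : 0 < u) (h1 : u < 1) :
    IntervalIntegrable (fun z : ℝ => z ^ j * (1 - z) ^ q / (1 - (1 - u) * z) ^ (e + 1))
        volume 0 1 := by
  apply ContinuousOn.intervalIntegrable
  rw [uIcc_of_le zero_le_one]
  refine ContinuousOn.div (by fun_prop) (by fun_prop) fun z hz => ?_
  exact (pow_pos (innerInt_denom_pos h0 h1 hz) _).ne'

theorem innerInt_succ_zero (j : ℕ) {u : ℝ} (h0 : 0 < u) (h1 : u < 1) :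
    (1 - u) * innerInt (j + 1) 0 0 u = innerInt j 0 0 u - 1 / (j + 1) := by
  unfold innerInt
  have : (1 : ℝ) / (j + 1) = ∫ z in (0 : ℝ)..1, z ^ j := by simp [integral_pow]
  rw [this, ← intervalIntegral.integral_sub (innerInt_intervalIntegrable j 0 0 h0 h1) (by simp),
    ← intervalIntegral.integral_const_mul]
  refine intervalIntegral.integral_congr fun z hz => ?_
  rw [uIcc_of_le zero_le_one] at hz
  have := (innerInt_denom_pos h0 h1 hz).ne'
  simp
  field_simp
  ring

theorem innerInt_succ_q (j q e : ℕ) {u : ℝ} (h0 : 0 < u) (h1 : u < 1) :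
    innerInt j (q + 1) e u = innerInt j q e u - innerInt (j + 1) q e u := by
  unfold innerInt
  rw [← intervalIntegral.integral_sub (innerInt_intervalIntegrable j q e h0 h1)
    (innerInt_intervalIntegrable (j + 1) q e h0 h1)]
  refine intervalIntegral.integral_congr fun z hz => ?_
  ring

theorem innerInt_hasDerivAt (j q e : ℕ) {u z : ℝ} (h0 : 0 < u) (h1 : u < 1)
    (hz : z ∈ Icc (0 : ℝ) 1) :
    HasDerivAt (fun z : ℝ => z ^ j * (1 - z) ^ (q + 1) / (1 - (1 - u) * z) ^ (e + 1))
      ((j : ℝ) * (z ^ (j - 1) * (1 - z) ^ (q + 1) / (1 - (1 - u) * z) ^ (e + 1)) -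
        (q + 1) * (z ^ j * (1 - z) ^ q / (1 - (1 - u) * z) ^ (e + 1)) +
        (e + 1) * (1 - u) * (z ^ j * (1 - z) ^ (q + 1) / (1 - (1 - u) * z) ^ (e + 1 + 1))) z := by
  have hD := innerInt_denom_pos h0 h1 hz
  have a1 : HasDerivAt (fun z : ℝ => z ^ j) ((j : ℝ) * z ^ (j - 1)) z := hasDerivAt_pow j z
  have a2 : HasDerivAt (fun z : ℝ => (1 - z) ^ (q + 1)) (((q + 1 : ℕ) : ℝ) * (1 - z) ^ q * (-1))
      z := by
    simpa using ((hasDerivAt_id z).const_sub 1).fun_pow (q + 1)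
  have a3 : HasDerivAt (fun z : ℝ => (1 - (1 - u) * z) ^ (e + 1))
      (((e + 1 : ℕ) : ℝ) * (1 - (1 - u) * z) ^ e * (-((1 - u) * 1))) z := by
    simpa using (((hasDerivAt_id z).const_mul (1 - u)).const_sub 1).fun_pow (e + 1)
  refine ((a1.mul a2).div a3 (pow_pos hD _).ne').congr_deriv ?_
  simp only [Pi.mul_apply]
  generalize 1 - (1 - u) * z = D at hD
  have := hD.ne'
  field_simp
  push_cast
  ring

theorem innerInt_succ_e (j q e : ℕ) {u : ℝ} (h0 : 0 < u) (h1 : u < 1) :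
    (e + 1) * (1 - u) * innerInt j (q + 1) (e + 1) u =
      (q + 1) * innerInt j q e u - j * innerInt (j - 1) (q + 1) e u - (if j = 0 then 1 else 0) := by
  have i1 := (innerInt_intervalIntegrable (j - 1) (q + 1) e h0 h1).const_mul (j : ℝ)
  have i2 := (innerInt_intervalIntegrable j q e h0 h1).const_mul ((q : ℝ) + 1)
  have i3 := (innerInt_intervalIntegrable j (q + 1) (e + 1) h0 h1).const_mul
      (((e : ℝ) + 1) * (1 - u))
  have h := intervalIntegral.integral_eq_sub_of_hasDerivAt (fun z hz =>
      innerInt_hasDerivAt j q e h0 h1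
    (by rwa [uIcc_of_le zero_le_one] at hz)) ((i1.sub i2).add i3)
  rw [intervalIntegral.integral_add (i1.sub i2) i3, intervalIntegral.integral_sub i1 i2,
    intervalIntegral.integral_const_mul, intervalIntegral.integral_const_mul,
    intervalIntegral.integral_const_mul] at h
  unfold innerInt
  rcases eq_or_ne j 0 with rfl | hj
  · simp at h ⊢; linarith
  · simp [hj] at h ⊢; linarith

theorem innerInt_zero {u : ℝ} (h0 : 0 < u) (h1 : u < 1) :
    (1 - u) * innerInt 0 0 0 u = - log u := by
  have h : ∀ z ∈ uIcc (0 : ℝ) 1, HasDerivAt (fun z => - log (1 - (1 - u) * z))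
      ((1 - u) * (z ^ 0 * (1 - z) ^ 0 / (1 - (1 - u) * z) ^ (0 + 1))) z := by
    intro z hz
    rw [uIcc_of_le zero_le_one] at hz
    have hD := innerInt_denom_pos h0 h1 hz
    have := ((((hasDerivAt_id z).const_mul (1 - u)).const_sub 1).log hD.ne').neg
    refine this.congr_deriv ?_
    simp; field_simp; ring
  have := intervalIntegral.integral_eq_sub_of_hasDerivAt h
    ((innerInt_intervalIntegrable 0 0 0 h0 h1).const_mul _)
  rw [intervalIntegral.integral_const_mul] at this
  unfold innerInt
  rw [this]; simp

/-- The polynomial whose twisted derivative sums give `innerInt`. -/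
noncomputable def innerPoly (j d e : ℕ) : ℝ[X] :=
  C (1 / ((e.factorial : ℝ) * (j + d).factorial)) * (risePoly e * risePoly j * fallPoly d)

theorem eval_risePoly_succ_neg_one (n : ℕ) : (risePoly (n + 1)).eval (-1) = 0 := by
  unfold risePoly
  rw [eval_prod]
  exact Finset.prod_eq_zero (Finset.mem_range.2 n.succ_pos) (by simp)

theorem derivative_risePoly_succ_neg_one (n : ℕ) :
    (risePoly (n + 1)).derivative.eval (-1) = n.factorial := by
  have h : risePoly (n + 1) = (X + C 1) * ∏ i ∈ Finset.range n, (X + C ((i : ℝ) + 2)) := by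
    unfold risePoly
    rw [Finset.prod_range_succ', mul_comm]
    congr 1
    · simp
    · refine Finset.prod_congr rfl fun i _ => ?_
      push_cast; ring_nf
  rw [h]
  simp only [derivative_mul, derivative_add, derivative_X, derivative_C, eval_add, eval_mul, eval_X,
    eval_C,
    eval_prod]
  simp
  rw [← Finset.prod_range_add_one_eq_factorial]
  push_cast
  refine Finset.prod_congr rfl fun i _ => ?_
  ring

theorem eval_fallPoly_neg_one (n : ℕ) : (fallPoly n).eval (-1) = (-1) ^ n * n.factorial := by
  unfold fallPoly
  rw [eval_prod, ← Finset.prod_range_add_one_eq_factorial]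
  push_cast
  rw [← Finset.card_range n, ← Finset.prod_const, Finset.card_range, ← Finset.prod_mul_distrib]
  refine Finset.prod_congr rfl fun i _ => ?_
  simp; ring

theorem innerInt_zero_q_zero (j : ℕ) {u : ℝ} (h0 : 0 < u) (h1 : u < 1) :
    innerInt j 0 0 u = - derivSum (innerPoly j 0 0) u := by
  have hu : 1 - u ≠ 0 := by linarith
  apply mul_left_cancel₀ hu
  rw [mul_neg, one_sub_mul_derivSum _ h0 h1]
  induction j with
  | zero =>
    rw [innerInt_zero h0 h1]
    simp [innerPoly, risePoly_zero, fallPoly_zero, derivSum]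
  | succ j ih =>
    rw [innerInt_succ_zero j h0 h1]
    rw [← one_sub_mul_derivSum _ h0 h1, ← mul_neg] at ih
    rw [mul_left_cancel₀ hu ih]
    have hj : (j.factorial : ℝ) ≠ 0 := by positivity
    have hj1 : (j : ℝ) + 1 ≠ 0 := by positivity
    have e1 : innerPoly (j + 1) 0 0 - (innerPoly (j + 1) 0 0).comp (X - C 1) = innerPoly j 0 0 := by
      simp only [innerPoly, risePoly_zero, fallPoly_zero, mul_comp, C_comp, risePoly_comp_succ]
      rw [risePoly_succ]
      simp only [one_comp, Nat.factorial_succ, add_zero, Nat.factorial_zero]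
      have : (1 / (((1 : ℕ) : ℝ) * j.factorial)) = (1 / (((1 : ℕ) : ℝ) *
          (((j + 1) * j.factorial : ℕ)))) * (j + 1) := by
        push_cast; field_simp
      rw [this, C_mul]
      ring
    have e2 : (innerPoly (j + 1) 0 0).eval (-1) = 0 := by
      simp [innerPoly, eval_risePoly_succ_neg_one]
    have e3 : (innerPoly (j + 1) 0 0).derivative.eval (-1) = 1 / (j + 1) := by
      simp [innerPoly, derivative_risePoly_succ_neg_one, risePoly_zero, fallPoly_zero,
        Nat.factorial_succ]
      field_simp
    rw [e1, e2, e3]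
    ring

theorem innerInt_e_zero (j q : ℕ) {u : ℝ} (h0 : 0 < u) (h1 : u < 1) :
    innerInt j q 0 u = (-1) ^ (q + 1) * derivSum (innerPoly j q 0) u := by
  induction q generalizing j with
  | zero => rw [innerInt_zero_q_zero j h0 h1]; ring
  | succ q ih =>
    rw [innerInt_succ_q j q 0 h0 h1, ih, ih]
    have e : innerPoly j q 0 = innerPoly (j + 1) q 0 + C (-1) * innerPoly j (q + 1) 0 := by
      simp only [innerPoly, risePoly_zero, risePoly_succ, fallPoly_succ]
      rw [show j + 1 + q = j + q + 1 by ring, show j + (q + 1) = j + q + 1 by ring]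
      have hj : ((j + q).factorial : ℝ) ≠ 0 := by positivity
      have : (1 / (((0 : ℕ).factorial : ℝ) * (j + q).factorial)) =
          (1 / (((0 : ℕ).factorial : ℝ) * (j + q + 1).factorial)) * (j + q + 1) := by
        rw [Nat.factorial_succ (j + q)]
        push_cast; field_simp
      rw [this]
      simp only [C_mul, C_add, C_neg, C_1]
      ring
    have h2 := derivSum_add (innerPoly (j + 1) q 0) (C (-1) * innerPoly j (q + 1) 0) h0 h1
    rw [← e, derivSum_C_mul] at h2
    rw [h2]; ring

theorem innerPoly_sub_comp (j d e : ℕ) (hj : j ≠ 0) :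
    innerPoly j d (e + 1) - (innerPoly j d (e + 1)).comp (X - C 1) =
      C (1 / ((e : ℝ) + 1)) * (C ((e : ℝ) + d + 1) * innerPoly j d e + C (j : ℝ) *
          innerPoly (j - 1) (d + 1) e) := by
  obtain ⟨j, rfl⟩ := Nat.exists_eq_succ_of_ne_zero hj
  simp only [Nat.succ_eq_add_one, Nat.add_sub_cancel]
  simp only [innerPoly, mul_comp, C_comp, risePoly_comp_succ]
  rw [show j + 1 + d = j + d + 1 by ring, show j + (d + 1) = j + d + 1 by ring]
  have he : (1 : ℝ) / (((e + 1).factorial : ℝ) * (j + d + 1).factorial) =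
      1 / ((e : ℝ) + 1) * (1 / ((e.factorial : ℝ) * (j + d + 1).factorial)) := by
    rw [Nat.factorial_succ e]; push_cast; field_simp
  rw [he]
  have hf : X * (fallPoly d).comp (X - C 1) = fallPoly d * (X - C (d : ℝ)) := by
    rw [← fallPoly_succ', fallPoly_succ]
  rw [risePoly_succ e, risePoly_succ j, fallPoly_succ d]
  have : C (1 / ((e : ℝ) + 1) * (1 / ((e.factorial : ℝ) * (j + d + 1).factorial))) = 
    C (1 / ((e : ℝ) + 1)) * C (1 / ((e.factorial : ℝ) * (j + d + 1).factorial)) := C_mul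
  rw [this]
  rw [C_1] at hf ⊢
  simp only [C_add, Nat.cast_add, Nat.cast_one, C_1]
  linear_combination (-C (1 / ((e : ℝ) + 1)) * C (1 / ((e.factorial : ℝ) * (j + d + 1).factorial)) *
      risePoly e *
    X * risePoly j) * hf

theorem innerPoly_zero_sub_comp (d e : ℕ) :
    innerPoly 0 d (e + 1) - (innerPoly 0 d (e + 1)).comp (X - C 1) =
      C (1 / ((e : ℝ) + 1)) * (C ((e : ℝ) + d + 1) * innerPoly 0 d e) := by
  simp only [innerPoly, mul_comp, C_comp, risePoly_comp_succ]
  have he : (1 : ℝ) / (((e + 1).factorial : ℝ) * (0 + d).factorial) =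
      1 / ((e : ℝ) + 1) * (1 / ((e.factorial : ℝ) * (0 + d).factorial)) := by
    rw [Nat.factorial_succ e]; push_cast; field_simp
  rw [he]
  have hf : X * (fallPoly d).comp (X - C 1) = fallPoly d * (X - C (d : ℝ)) := by
    rw [← fallPoly_succ', fallPoly_succ]
  have : C (1 / ((e : ℝ) + 1) * (1 / ((e.factorial : ℝ) * (0 + d).factorial))) = 
    C (1 / ((e : ℝ) + 1)) * C (1 / ((e.factorial : ℝ) * (0 + d).factorial)) := C_mul
  rw [this, risePoly_succ e]
  rw [C_1] at hf ⊢
  simp only [C_add, C_1, risePoly_zero, one_comp]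
  linear_combination (-C (1 / ((e : ℝ) + 1)) * C (1 / ((e.factorial : ℝ) * (0 + d).factorial)) *
      risePoly e) * hf

theorem innerInt_eq_derivSum (j d e : ℕ) {u : ℝ} (h0 : 0 < u) (h1 : u < 1) :
    innerInt j (e + d) e u = (-1) ^ (d + 1) * derivSum (innerPoly j d e) u := by
  induction e generalizing j d with
  | zero => rw [zero_add, innerInt_e_zero j d h0 h1]
  | succ e ih =>
    have hu : ((e : ℝ) + 1) * (1 - u) ≠ 0 := mul_ne_zero (by positivity) (by linarith)
    apply mul_left_cancel₀ hu
    have he : (e : ℝ) + 1 ≠ 0 := by positivity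
    rw [show e + 1 + d = e + d + 1 by ring, innerInt_succ_e j (e + d) e h0 h1, ih j d,
      show e + d + 1 = e + (d + 1) by ring, ih (j - 1) (d + 1)]
    have h2 := one_sub_mul_derivSum (innerPoly j d (e + 1)) h0 h1
    have h3 : ((e : ℝ) + 1) * (1 - u) * ((-1) ^ (d + 1) * derivSum (innerPoly j d (e + 1)) u) =
      ((e : ℝ) + 1) * (-1) ^ (d + 1) * ((1 - u) * derivSum (innerPoly j d (e + 1)) u) := by ring
    rw [h3, h2]
    have ev : (innerPoly j d (e + 1)).eval (-1) = 0 := by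
      simp [innerPoly, eval_risePoly_succ_neg_one]
    have dv : (innerPoly j d (e + 1)).derivative.eval (-1) = if j =
        0 then (-1) ^ d / ((e : ℝ) + 1) else 0 := by
      split_ifs with hj
      · subst hj
        simp [innerPoly, derivative_risePoly_succ_neg_one, eval_risePoly_succ_neg_one,
          risePoly_zero,
          eval_fallPoly_neg_one, Nat.factorial_succ]
        field_simp
      · obtain ⟨j, rfl⟩ := Nat.exists_eq_succ_of_ne_zero hj
        simp [innerPoly, eval_risePoly_succ_neg_one]
    have hs : ((-1 : ℝ) ^ d) * (-1) ^ d = 1 := by rw [← mul_pow]; simp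
    rw [ev, dv]
    rcases eq_or_ne j 0 with rfl | hj
    · rw [innerPoly_zero_sub_comp, derivSum_C_mul, derivSum_C_mul]
      simp only [if_true]
      push_cast
      field_simp
      linear_combination hs
    · rw [innerPoly_sub_comp j d e hj, derivSum_C_mul, derivSum_add _ _ h0 h1, derivSum_C_mul,
        derivSum_C_mul]
      simp only [hj, if_false]
      push_cast
      field_simp
      ring

/-- `betaFun h l t = ∫₀¹ x^(h+t) (1-x)^l dx`, by its recursion in `l`. -/
noncomputable def betaFun : ℕ → ℕ → ℝ → ℝ
  | h, 0, t => 1 / (t + h + 1)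
  | h, l + 1, t => betaFun h l t - betaFun (h + 1) l t

theorem intervalIntegrable_pow_mul_log (n l : ℕ) :
    IntervalIntegrable (fun x : ℝ => x ^ n * (1 - x) ^ l * log x) volume 0 1 :=
  intervalIntegral.intervalIntegrable_log'.continuousOn_mul
    (by fun_prop : Continuous fun x : ℝ => x ^ n * (1 - x) ^ l).continuousOn

theorem intervalIntegrable_pow_mul (n l : ℕ) :
    IntervalIntegrable (fun x : ℝ => x ^ n * (1 - x) ^ l) volume 0 1 :=
  (by fun_prop : Continuous fun x : ℝ => x ^ n * (1 - x) ^ l).intervalIntegrable _ _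

theorem integral_beta (h l t : ℕ) :
    ∫ x in (0 : ℝ)..1, x ^ (h + t) * (1 - x) ^ l = betaFun h l t := by
  induction l generalizing h with
  | zero =>
    simp only [pow_zero, mul_one, integral_pow, betaFun]
    push_cast; simp; ring
  | succ l ih =>
    rw [betaFun, ← ih h, ← ih (h + 1), ← intervalIntegral.integral_sub
      (intervalIntegrable_pow_mul _ _) (intervalIntegrable_pow_mul _ _)]
    refine intervalIntegral.integral_congr fun x _ => ?_
    ring

theorem integral_pow_mul_log (n : ℕ) :
    ∫ x in (0 : ℝ)..1, x ^ n * log x = -1 / ((n : ℝ) + 1) ^ 2 := by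
  have hc : Continuous fun x : ℝ => x ^ n * (x * log x) / (n + 1) -
      x ^ (n + 1) / ((n : ℝ) + 1) ^ 2 := by
    have := Real.continuous_mul_log
    fun_prop
  have := intervalIntegral.integral_eq_sub_of_hasDerivAt_of_le (a := 0) (b := 1)
    (f := fun x : ℝ => x ^ n * (x * log x) / (n + 1) - x ^ (n + 1) / ((n : ℝ) + 1) ^ 2)
    (f' := fun x : ℝ => x ^ n * log x) zero_le_one hc.continuousOn ?_ ?_
  · rw [this]; simp; ring
  · intro x hx
    have hx0 : x ≠ 0 := hx.1.ne'
    have h1 := (((hasDerivAt_pow (n + 1) x).mul (Real.hasDerivAt_log hx0)).div_const ((n : ℝ) +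
        1)).sub
      ((hasDerivAt_pow (n + 1) x).div_const (((n : ℝ) + 1) ^ 2))
    have h2 : (fun x : ℝ => x ^ n * (x * log x) / (n + 1) - x ^ (n + 1) / ((n : ℝ) + 1) ^ 2)
        = fun x : ℝ => x ^ (n + 1) * log x / (n + 1) - x ^ (n + 1) / ((n : ℝ) + 1) ^ 2 := by
      funext x; ring
    rw [h2]
    refine HasDerivAt.congr_deriv h1 ?_
    have : (n : ℝ) + 1 ≠ 0 := by positivity
    push_cast
    field_simp
    ring
  · simpa using intervalIntegrable_pow_mul_log n 0

theorem betaFun_hasDerivAt (h l : ℕ) {t : ℝ} (ht : -1 < t) :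
    HasDerivAt (betaFun h l) (deriv (betaFun h l) t) t := by
  refine DifferentiableAt.hasDerivAt ?_
  induction l generalizing h with
  | zero =>
    have : t + h + 1 ≠ 0 := by have : (0 : ℝ) ≤ h := by positivity
                               linarith
    have h2 : betaFun h 0 = fun t : ℝ => 1 / (t + h + 1) := by funext t; rw [betaFun]
    rw [h2]
    fun_prop (disch := assumption)
  | succ l ih =>
    have : betaFun h (l + 1) = fun t => betaFun h l t - betaFun (h + 1) l t := by
      funext t; rw [betaFun]
    rw [this]
    exact (ih h).sub (ih (h + 1))

theorem integral_beta_log (h l t : ℕ) :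
    ∫ x in (0 : ℝ)..1, x ^ (h + t) * (1 - x) ^ l * log x = deriv (betaFun h l) t := by
  have ht : (-1 : ℝ) < t := by have : (0 : ℝ) ≤ t := by positivity
                               linarith
  induction l generalizing h with
  | zero =>
    simp only [pow_zero, mul_one, integral_pow_mul_log]
    have h0 : (t : ℝ) + h + 1 ≠ 0 := by positivity
    have : betaFun h 0 = fun t : ℝ => (t + h + 1)⁻¹ := by funext t; rw [betaFun, one_div]
    rw [this]
    have := ((((hasDerivAt_id (t : ℝ)).add_const (h : ℝ)).add_const (1 : ℝ)).inv h0).deriv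
    simp only [id] at this
    symm
    refine Eq.trans this ?_
    push_cast
    ring
  | succ l ih =>
    have : betaFun h (l + 1) = fun t => betaFun h l t - betaFun (h + 1) l t := by
      funext t; rw [betaFun]
    rw [this, deriv_fun_sub (betaFun_hasDerivAt h l ht).differentiableAt
      (betaFun_hasDerivAt (h + 1) l ht).differentiableAt, ← ih h, ← ih (h + 1),
      ← intervalIntegral.integral_sub
      (intervalIntegrable_pow_mul_log _ _) (intervalIntegrable_pow_mul_log _ _)]
    refine intervalIntegral.integral_congr fun x _ => ?_
    ring

theorem eval_risePoly_pos (n : ℕ) {t : ℝ} (ht : -1 < t) : 0 < (risePoly n).eval t := by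
  rw [risePoly, eval_prod]
  refine Finset.prod_pos fun i _ => ?_
  have : (0 : ℝ) ≤ i := by positivity
  simp; linarith

theorem betaFun_eq (h l : ℕ) {t : ℝ} (ht : -1 < t) :
    betaFun h l t = l.factorial * (risePoly h).eval t / (risePoly (h + l + 1)).eval t := by
  induction l generalizing h with
  | zero =>
    have h1 := (eval_risePoly_pos h ht).ne'
    have h2 : t + (h + 1) ≠ 0 := by have : (0 : ℝ) ≤ h := by positivity
                                    linarith
    rw [betaFun, add_zero, risePoly_succ, show t + h + 1 = t + (h + 1) by ring]
    simp
    field_simp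
  | succ l ih =>
    rw [betaFun, ih, ih, show h + 1 + l + 1 = h + l + 1 + 1 by ring,
      show h + (l + 1) + 1 = h + l + 1 + 1 by ring, risePoly_succ (h + l + 1), risePoly_succ h,
      Nat.factorial_succ]
    have h1 := (eval_risePoly_pos (h + l + 1) ht).ne'
    have h2 : t + ((h : ℝ) + l + 1 + 1) ≠ 0 := by
      have : (0 : ℝ) ≤ h + l := by positivity
      linarith
    simp
    field_simp
    ring

theorem betaFun_nonneg (h l : ℕ) {t : ℝ} (ht : -1 < t) : 0 ≤ betaFun h l t := by
  rw [betaFun_eq h l ht]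
  have h1 := eval_risePoly_pos h ht
  have h2 := eval_risePoly_pos (h + l + 1) ht
  positivity

theorem betaFun_le (h l : ℕ) {t : ℝ} (ht : -1 < t) :
    betaFun h l t ≤ l.factorial / (t + 1) ^ (l + 1) := by
  rw [betaFun_eq h l ht, mul_div_assoc, div_eq_mul_one_div (l.factorial : ℝ)]
  refine mul_le_mul_of_nonneg_left ?_ (by positivity)
  have h2 := eval_risePoly_pos (h + l + 1) ht
  have ht' : 0 < t + 1 := by linarith
  rw [div_le_div_iff₀ h2 (by positivity), one_mul]
  induction l with
  | zero =>
    rw [add_zero, risePoly_succ, eval_mul]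
    have := eval_risePoly_pos h ht
    have hh : (0 : ℝ) ≤ h := by positivity
    gcongr
    simp
  | succ l ih =>
    rw [← add_assoc h, risePoly_succ (h + l + 1), eval_mul, pow_succ, ← mul_assoc]
    have hh : (0 : ℝ) ≤ h + l + 1 := by positivity
    gcongr
    · exact (eval_risePoly_pos _ ht).le
    · exact ih (eval_risePoly_pos _ ht)
    · simp; linarith

theorem abs_deriv_betaFun_le (h l t : ℕ) :
    |deriv (betaFun h l) ((t + 1 : ℕ) : ℝ)| ≤ (l + 1).factorial / ((t : ℝ) + 1) ^ (l + 2) := by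
  have ht : (-1 : ℝ) < t := by have : (0 : ℝ) ≤ t := by positivity
                               linarith
  rw [← integral_beta_log]
  refine le_trans ?_ (betaFun_le h (l + 1) ht)
  rw [← integral_beta]
  rw [← Real.norm_eq_abs]
  refine intervalIntegral.norm_integral_le_of_norm_le zero_le_one ?_
      (intervalIntegrable_pow_mul _ _)
  refine Eventually.of_forall fun x hx => ?_
  have hx0 := hx.1
  have hx1 : 0 ≤ 1 - x := by linarith [hx.2]
  have h1 : |log x| ≤ (1 - x) / x := by
    rw [abs_of_nonpos (Real.log_nonpos hx0.le hx.2), ← Real.log_inv]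
    refine (Real.log_le_sub_one_of_pos (inv_pos.2 hx0)).trans (le_of_eq ?_)
    field_simp
  rw [norm_mul, Real.norm_eq_abs (log x), Real.norm_of_nonneg (by positivity)]
  calc _ ≤ x ^ (h + (t + 1)) * (1 - x) ^ l * ((1 - x) / x) := by gcongr
    _ = _ := by field_simp; ring

end

section

open Real Set Filter Topology MeasureTheory Polynomial
open scoped ENNReal

theorem exists_eval_bound (P : ℝ[X]) (N : ℕ) (hP : P.natDegree ≤ N) :
    ∃ C : ℝ, 0 ≤ C ∧ ∀ v : ℝ, 1 ≤ v → |P.eval v| ≤ C * v ^ N := by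
  refine ⟨∑ i ∈ Finset.range (N + 1), |P.coeff i|, Finset.sum_nonneg fun _ _ => abs_nonneg _,
    fun v hv => ?_⟩
  rw [eval_eq_sum_range' (Nat.lt_succ_of_le hP), Finset.sum_mul]
  refine (Finset.abs_sum_le_sum_abs _ _).trans (Finset.sum_le_sum fun i hi => ?_)
  rw [abs_mul, abs_of_nonneg (by positivity : (0 : ℝ) ≤ v ^ i)]
  have := Finset.mem_range_succ_iff.1 hi
  gcongr

theorem exists_eval_derivative_bound (P : ℝ[X]) (N : ℕ) (hP : P.natDegree ≤ N) :
    ∃ C : ℝ, 0 ≤ C ∧ ∀ v : ℝ, 1 ≤ v → |P.eval v| ≤ C * v ^ N ∧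
      |P.derivative.eval v| ≤ C * v ^ N / v := by
  obtain ⟨C1, h1, hC1⟩ := exists_eval_bound P N hP
  have hQ : (X * P.derivative).natDegree ≤ N := by
    by_cases h0 : P.natDegree = 0
    · rw [derivative_of_natDegree_zero h0]; simp
    · have h2 := natDegree_mul_le (p := (X : ℝ[X])) (q := P.derivative)
      have h3 := natDegree_derivative_lt h0
      have h4 := natDegree_X_le (R := ℝ)
      omega
  obtain ⟨C2, h2, hC2⟩ := exists_eval_bound _ N hQ
  refine ⟨C1 + C2, by positivity, fun v hv => ⟨(hC1 v hv).trans ?_, ?_⟩⟩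
  · gcongr; linarith
  · have hv0 : 0 < v := by linarith
    rw [le_div_iff₀ hv0]
    have := hC2 v hv
    rw [eval_mul, eval_X, abs_mul, abs_of_pos hv0, mul_comm] at this
    refine this.trans ?_
    gcongr; linarith

theorem natDegree_risePoly_le (n : ℕ) : (risePoly n).natDegree ≤ n := by
  refine (natDegree_prod_le _ _).trans ?_
  simp only [natDegree_X_add_C]
  simp

theorem natDegree_fallPoly_le (n : ℕ) : (fallPoly n).natDegree ≤ n := by
  refine (natDegree_prod_le _ _).trans ?_
  simp only [natDegree_X_sub_C]
  simp

theorem natDegree_innerPoly_le (j d e : ℕ) : (innerPoly j d e).natDegree ≤ e + j + d := by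
  unfold innerPoly
  refine (natDegree_C_mul_le _ _).trans (natDegree_mul_le.trans ?_)
  have h1 := natDegree_mul_le (p := risePoly e) (q := risePoly j)
  have h2 := natDegree_risePoly_le e
  have h3 := natDegree_risePoly_le j
  have h4 := natDegree_fallPoly_le d
  omega

/-- The term `R_t` of the series expansion of the triple integral. -/
noncomputable def rvTerm (h l k s j d e : ℕ) (t : ℝ) : ℝ :=
  (innerPoly j d e).eval t * betaFun h l t * betaFun k s t

theorem deriv_rvTerm (h l k s j d e : ℕ) {t : ℝ} (ht : -1 < t) :
    deriv (rvTerm h l k s j d e) t =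
      (innerPoly j d e).derivative.eval t * betaFun h l t * betaFun k s t +
      (innerPoly j d e).eval t * deriv (betaFun h l) t * betaFun k s t +
      (innerPoly j d e).eval t * betaFun h l t * deriv (betaFun k s) t := by
  have := ((((innerPoly j d e).hasDerivAt t).mul (betaFun_hasDerivAt h l ht)).mul
    (betaFun_hasDerivAt k s ht)).deriv
  refine Eq.trans this ?_
  simp only [Pi.mul_apply]
  ring

/-- The absolute majorant of `rvTerm'`. -/
theorem summable_rvTerm_bound (h l k s j d e : ℕ) (hd : l + s = j + e + d) :
    Summable fun t : ℕ =>
      |(innerPoly j d e).derivative.eval (t : ℝ)| * (betaFun k s t * betaFun h l t) +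
      |(innerPoly j d e).eval (t : ℝ)| * (|deriv (betaFun k s) t| * betaFun h l t) +
      |(innerPoly j d e).eval (t : ℝ)| * (betaFun k s t * |deriv (betaFun h l) t|) := by
  rw [← summable_nat_add_iff 1]
  obtain ⟨C, hC, hb⟩ := exists_eval_derivative_bound (innerPoly j d e) (l + s)
    ((natDegree_innerPoly_le j d e).trans (by omega))
  have hs : Summable fun t : ℕ => (C * s.factorial * l.factorial +
      C * (s + 1).factorial * l.factorial + C * s.factorial * (l + 1).factorial) *
      (1 / ((t + 1 : ℕ) : ℝ) ^ 3) := by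
    refine Summable.mul_left _ ?_
    exact (summable_nat_add_iff 1).2 (Real.summable_one_div_nat_pow.2 (by norm_num))
  refine Summable.of_nonneg_of_le (fun t => ?_) (fun t => ?_) hs
  · have ht : (-1 : ℝ) < ((t + 1 : ℕ) : ℝ) := by
      have : (0 : ℝ) ≤ ((t + 1 : ℕ) : ℝ) := by positivity
      linarith
    have h1 := betaFun_nonneg h l ht
    have h2 := betaFun_nonneg k s ht
    positivity
  · have hv : (1 : ℝ) ≤ ((t + 1 : ℕ) : ℝ) := by
      push_cast; have : (0 : ℝ) ≤ t := by positivity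
      linarith
    obtain ⟨hb1, hb2⟩ := hb _ hv
    have ht : (-1 : ℝ) < ((t + 1 : ℕ) : ℝ) := by linarith
    have d1 := abs_deriv_betaFun_le h l t
    have d2 := abs_deriv_betaFun_le k s t
    rw [← Nat.cast_succ, Nat.succ_eq_add_one] at d1 d2
    have n1 := betaFun_nonneg h l ht
    have n2 := betaFun_nonneg k s ht
    have b1 : betaFun h l ((t + 1 : ℕ) : ℝ) ≤ l.factorial / ((t + 1 : ℕ) : ℝ) ^ (l + 1) := by
      refine (betaFun_le h l ht).trans ?_
      gcongr; linarith
    have b2 : betaFun k s ((t + 1 : ℕ) : ℝ) ≤ s.factorial / ((t + 1 : ℕ) : ℝ) ^ (s + 1) := by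
      refine (betaFun_le k s ht).trans ?_
      gcongr; linarith
    generalize ((t + 1 : ℕ) : ℝ) = v at *
    have hv0 : 0 < v := by linarith
    calc _ ≤ (C * v ^ (l + s) / v) * ((s.factorial / v ^ (s + 1)) * (l.factorial / v ^ (l + 1))) +
        (C * v ^ (l + s)) * (((s + 1).factorial / v ^ (s + 2)) * (l.factorial / v ^ (l + 1))) +
        (C * v ^ (l + s)) * ((s.factorial / v ^ (s + 1)) * ((l + 1).factorial / v ^ (l + 2))) := by
          gcongr
      _ = _ := by
        field_simp
        ring

/-- The Rhin–Viola integrand. -/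
noncomputable def rvFun (h l k s j q e : ℕ) (x y z : ℝ) : ℝ :=
  x ^ h * (1 - x) ^ l * (y ^ k * (1 - y) ^ s) * (z ^ j * (1 - z) ^ q) /
    (1 - (1 - x * y) * z) ^ (e + 1)

/-- The Rhin–Viola integral over the unit cube, with values in `[0, ∞]`. -/
noncomputable def rvLint (h l k s j q e : ℕ) : ℝ≥0∞ :=
  ∫⁻ y in Ioo (0 : ℝ) 1, ∫⁻ z in Ioo (0 : ℝ) 1, ∫⁻ x in Ioo (0 : ℝ) 1,
    ENNReal.ofReal (rvFun h l k s j q e x y z)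

/-- The Rhin–Viola integral. -/
noncomputable def rvInt (h l k s j q e : ℕ) : ℝ := (rvLint h l k s j q e).toReal

theorem lintegral_rvFun_z (h l k s j q e : ℕ) {x y : ℝ} (hx : x ∈ Ioo (0 : ℝ) 1)
    (hy : y ∈ Ioo (0 : ℝ) 1) :
    ∫⁻ z in Ioo (0 : ℝ) 1, ENNReal.ofReal (rvFun h l k s j q e x y z) =
      ENNReal.ofReal (x ^ h * (1 - x) ^ l * (y ^ k * (1 - y) ^ s) * innerInt j q e (x * y)) := by
  have hu0 : 0 < x * y := mul_pos hx.1 hy.1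
  have hu1 : x * y < 1 := by nlinarith [hx.1, hx.2, hy.1, hy.2]
  have hi := (innerInt_intervalIntegrable j q e hu0 hu1).const_mul
    (x ^ h * (1 - x) ^ l * (y ^ k * (1 - y) ^ s))
  have hi2 : IntegrableOn (fun z => rvFun h l k s j q e x y z) (Ioo 0 1) := by
    refine IntegrableOn.congr_fun ((intervalIntegrable_iff_integrableOn_Ioo_of_le zero_le_one).1 hi)
      (fun z _ => ?_) measurableSet_Ioo
    simp only [rvFun]
    ring
  rw [← ofReal_integral_eq_lintegral_ofReal hi2]
  · congr 1
    rw [innerInt, intervalIntegral.integral_of_le zero_le_one, integral_Ioc_eq_integral_Ioo,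
      ← integral_const_mul]
    refine integral_congr_ae (Eventually.of_forall fun z => ?_)
    simp only [rvFun]
    ring
  · refine (ae_restrict_iff' measurableSet_Ioo).2 (Eventually.of_forall fun z hz => ?_)
    have h1 := innerInt_denom_pos hu0 hu1 (Ioo_subset_Icc_self hz)
    have hx0 := hx.1; have hy0 := hy.1; have hz0 := hz.1
    have hx1 : 0 < 1 - x := by linarith [hx.2]
    have hy1 : 0 < 1 - y := by linarith [hy.2]
    have hz1 : 0 < 1 - z := by linarith [hz.2]
    simp only [rvFun, Pi.zero_apply]
    positivity

theorem measurable_rvFun (h l k s j q e : ℕ) :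
    Measurable fun p : ℝ × ℝ × ℝ => rvFun h l k s j q e p.1 p.2.1 p.2.2 := by
  unfold rvFun
  fun_prop

theorem rvLint_eq_prod (h l k s j q e : ℕ) :
    rvLint h l k s j q e =
      ∫⁻ p, ENNReal.ofReal (p.2 ^ h * (1 - p.2) ^ l * (p.1 ^ k * (1 - p.1) ^ s) *
        innerInt j q e (p.2 * p.1))
        ∂((volume.restrict (Ioo (0 : ℝ) 1)).prod (volume.restrict (Ioo (0 : ℝ) 1))) := by
  have hm : Measurable fun p : ℝ × ℝ => ∫⁻ z in Ioo (0 : ℝ) 1,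
      ENNReal.ofReal (rvFun h l k s j q e p.2 p.1 z) := by
    refine Measurable.lintegral_prod_right' (f := fun w : (ℝ × ℝ) × ℝ =>
      ENNReal.ofReal (rvFun h l k s j q e w.1.2 w.1.1 w.2)) ?_
    exact ((measurable_rvFun h l k s j q e).comp
      (by fun_prop : Measurable fun w : (ℝ × ℝ) × ℝ => (w.1.2, w.1.1, w.2))).ennreal_ofReal
  have e1 : rvLint h l k s j q e = ∫⁻ y in Ioo (0 : ℝ) 1, ∫⁻ x in Ioo (0 : ℝ) 1,
      ∫⁻ z in Ioo (0 : ℝ) 1, ENNReal.ofReal (rvFun h l k s j q e x y z) := by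
    unfold rvLint
    refine lintegral_congr fun y => ?_
    refine lintegral_lintegral_swap ?_
    exact ((measurable_rvFun h l k s j q e).comp
      (by fun_prop : Measurable fun w : ℝ × ℝ => (w.2, y, w.1))).ennreal_ofReal.aemeasurable
  rw [e1, ← lintegral_prod (fun p : ℝ × ℝ => ∫⁻ z in Ioo (0 : ℝ) 1,
      ENNReal.ofReal (rvFun h l k s j q e p.2 p.1 z)) hm.aemeasurable]
  refine lintegral_congr_ae ?_
  rw [Measure.prod_restrict]
  refine (ae_restrict_iff' (measurableSet_Ioo.prod measurableSet_Ioo)).2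
    (Eventually.of_forall fun p hp => ?_)
  exact lintegral_rvFun_z h l k s j q e hp.2 hp.1

theorem integrable_unit_pow_mul (n l : ℕ) :
    Integrable (fun x : ℝ => x ^ n * (1 - x) ^ l) (volume.restrict (Ioo (0 : ℝ) 1)) :=
  (intervalIntegrable_iff_integrableOn_Ioo_of_le zero_le_one).1 (intervalIntegrable_pow_mul n l)

theorem integrable_unit_pow_mul_log (n l : ℕ) :
    Integrable (fun x : ℝ => x ^ n * (1 - x) ^ l * log x) (volume.restrict (Ioo (0 : ℝ) 1)) :=
  (intervalIntegrable_iff_integrableOn_Ioo_of_le zero_le_one).1 (intervalIntegrable_pow_mul_log n l)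

theorem integral_unit_beta (h l t : ℕ) :
    ∫ x in Ioo (0 : ℝ) 1, x ^ (h + t) * (1 - x) ^ l = betaFun h l t := by
  rw [← integral_beta, intervalIntegral.integral_of_le zero_le_one, integral_Ioc_eq_integral_Ioo]

theorem integral_unit_beta_log (h l t : ℕ) :
    ∫ x in Ioo (0 : ℝ) 1, x ^ (h + t) * (1 - x) ^ l * log x = deriv (betaFun h l) t := by
  rw [← integral_beta_log, intervalIntegral.integral_of_le zero_le_one,
    integral_Ioc_eq_integral_Ioo]

theorem integral_unit_beta_abs_log (h l t : ℕ) :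
    ∫ x in Ioo (0 : ℝ) 1, x ^ (h + t) * (1 - x) ^ l * |log x| = |deriv (betaFun h l) t| := by
  have : ∫ x in Ioo (0 : ℝ) 1, x ^ (h + t) * (1 - x) ^ l * |log x| = - deriv (betaFun h l) t := by
    rw [← integral_unit_beta_log, ← integral_neg]
    refine setIntegral_congr_fun measurableSet_Ioo fun x hx => ?_
    rw [abs_of_nonpos (Real.log_nonpos hx.1.le hx.2.le)]
    ring
  rw [this, abs_of_nonpos]
  have h2 : 0 ≤ ∫ x in Ioo (0 : ℝ) 1, x ^ (h + t) * (1 - x) ^ l * |log x| := by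
    refine setIntegral_nonneg measurableSet_Ioo fun x hx => ?_
    have := hx.1
    have : 0 ≤ 1 - x := by linarith [hx.2]
    positivity
  linarith

/-- The `t`-th term of the expansion of the integrand on the unit square. -/
noncomputable def rvSqTerm (h l k s j d e t : ℕ) (p : ℝ × ℝ) : ℝ :=
  (innerPoly j d e).derivative.eval (t : ℝ) *
      ((p.1 ^ (k + t) * (1 - p.1) ^ s) * (p.2 ^ (h + t) * (1 - p.2) ^ l)) +
  (innerPoly j d e).eval (t : ℝ) *
      ((p.1 ^ (k + t) * (1 - p.1) ^ s * log p.1) * (p.2 ^ (h + t) * (1 - p.2) ^ l)) +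
  (innerPoly j d e).eval (t : ℝ) *
      ((p.1 ^ (k + t) * (1 - p.1) ^ s) * (p.2 ^ (h + t) * (1 - p.2) ^ l * log p.2))

theorem ae_unit_square {P : ℝ × ℝ → Prop}
    (hP : ∀ x ∈ Ioo (0 : ℝ) 1, ∀ y ∈ Ioo (0 : ℝ) 1, P (x, y)) :
    ∀ᵐ p ∂((volume.restrict (Ioo (0 : ℝ) 1)).prod (volume.restrict (Ioo (0 : ℝ) 1))), P p := by
  rw [Measure.prod_restrict]
  exact (ae_restrict_iff' (measurableSet_Ioo.prod measurableSet_Ioo)).2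
    (Eventually.of_forall fun p hp => hP p.1 hp.1 p.2 hp.2)

theorem integral_linear_combination {α : Type*} [MeasurableSpace α] {μ : Measure α} {f g h : α → ℝ}
    (hf : Integrable f μ) (hg : Integrable g μ) (hh : Integrable h μ) (a b c : ℝ) :
    ∫ p, (a * f p + b * g p + c * h p) ∂μ = a * ∫ p, f p ∂μ + b * ∫ p, g p ∂μ + c * ∫ p,
        h p ∂μ := by
  have h1 : Integrable (fun p => a * f p + b * g p) μ := (hf.const_mul a).add (hg.const_mul b)
  rw [integral_add h1 (hh.const_mul c), integral_add (hf.const_mul a) (hg.const_mul b)]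
  simp only [integral_const_mul]

theorem hasSum_integral_rvSqTerm (h l k s j d e : ℕ) (hd : l + s = j + e + d) :
    rvInt h l k s j (e + d) e = (-1) ^ (d + 1) * ∑' t : ℕ, deriv (rvTerm h l k s j d e) t ∧
    rvLint h l k s j (e + d) e ≠ ⊤ ∧
    Summable fun t : ℕ => deriv (rvTerm h l k s j d e) t := by
  set μ := (volume.restrict (Ioo (0 : ℝ) 1)).prod (volume.restrict (Ioo (0 : ℝ) 1)) with hμ
  set P := innerPoly j d e with hPdef
  have i1 : ∀ t : ℕ, Integrable (fun p : ℝ × ℝ =>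
      (p.1 ^ (k + t) * (1 - p.1) ^ s) * (p.2 ^ (h + t) * (1 - p.2) ^ l)) μ := fun t =>
    (integrable_unit_pow_mul (k + t) s).mul_prod (integrable_unit_pow_mul (h + t) l)
  have i2 : ∀ t : ℕ, Integrable (fun p : ℝ × ℝ =>
      (p.1 ^ (k + t) * (1 - p.1) ^ s * log p.1) * (p.2 ^ (h + t) * (1 - p.2) ^ l)) μ := fun t =>
    (integrable_unit_pow_mul_log (k + t) s).mul_prod (integrable_unit_pow_mul (h + t) l)
  have i3 : ∀ t : ℕ, Integrable (fun p : ℝ × ℝ =>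
      (p.1 ^ (k + t) * (1 - p.1) ^ s) * (p.2 ^ (h + t) * (1 - p.2) ^ l * log p.2)) μ := fun t =>
    (integrable_unit_pow_mul (k + t) s).mul_prod (integrable_unit_pow_mul_log (h + t) l)
  have iT : ∀ t : ℕ, Integrable (rvSqTerm h l k s j d e t) μ := fun t =>
    (((i1 t).const_mul _).add ((i2 t).const_mul _)).add ((i3 t).const_mul _)
  have hintg : ∀ t : ℕ, ∫ p, rvSqTerm h l k s j d e t p ∂μ = deriv (rvTerm h l k s j d e) t := by
    intro t
    have ht : (-1 : ℝ) < t := by have : (0 : ℝ) ≤ t := by positivity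
                                 linarith
    have e1 : ∫ p, rvSqTerm h l k s j d e t p ∂μ =
        P.derivative.eval (t : ℝ) * (betaFun k s t * betaFun h l t) +
        P.eval (t : ℝ) * (deriv (betaFun k s) t * betaFun h l t) +
        P.eval (t : ℝ) * (betaFun k s t * deriv (betaFun h l) t) := by
      unfold rvSqTerm
      rw [integral_linear_combination (i1 t) (i2 t) (i3 t)]
      rw [hμ, integral_prod_mul (fun x : ℝ => x ^ (k + t) * (1 - x) ^ s)
        (fun x : ℝ => x ^ (h + t) * (1 - x) ^ l),
        integral_prod_mul (fun x : ℝ => x ^ (k + t) * (1 - x) ^ s * log x)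
        (fun x : ℝ => x ^ (h + t) * (1 - x) ^ l),
        integral_prod_mul (fun x : ℝ => x ^ (k + t) * (1 - x) ^ s)
        (fun x : ℝ => x ^ (h + t) * (1 - x) ^ l * log x),
        integral_unit_beta, integral_unit_beta, integral_unit_beta_log, integral_unit_beta_log]
    rw [e1, deriv_rvTerm h l k s j d e ht]
    ring
  have hbd : ∀ t : ℕ, ∫ p, ‖rvSqTerm h l k s j d e t p‖ ∂μ ≤
      |P.derivative.eval (t : ℝ)| * (betaFun k s t * betaFun h l t) +
      |P.eval (t : ℝ)| * (|deriv (betaFun k s) t| * betaFun h l t) +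
      |P.eval (t : ℝ)| * (betaFun k s t * |deriv (betaFun h l) t|) := by
    intro t
    have a2 : Integrable (fun p : ℝ × ℝ =>
        (p.1 ^ (k + t) * (1 - p.1) ^ s * |log p.1|) * (p.2 ^ (h + t) * (1 - p.2) ^ l)) μ := by
      refine (i2 t).norm.congr (ae_unit_square fun x hx y hy => ?_)
      have hx0 := hx.1; have hy0 := hy.1
      have hx1 : 0 ≤ 1 - x := by linarith [hx.2]
      have hy1 : 0 ≤ 1 - y := by linarith [hy.2]
      simp only [norm_mul, Real.norm_eq_abs, abs_pow, abs_of_nonneg hx1, abs_of_nonneg hy1,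
        abs_of_pos hx0, abs_of_pos hy0]
    have a3 : Integrable (fun p : ℝ × ℝ =>
        (p.1 ^ (k + t) * (1 - p.1) ^ s) * (p.2 ^ (h + t) * (1 - p.2) ^ l * |log p.2|)) μ := by
      refine (i3 t).norm.congr (ae_unit_square fun x hx y hy => ?_)
      have hx0 := hx.1; have hy0 := hy.1
      have hx1 : 0 ≤ 1 - x := by linarith [hx.2]
      have hy1 : 0 ≤ 1 - y := by linarith [hy.2]
      simp only [norm_mul, Real.norm_eq_abs, abs_pow, abs_of_nonneg hx1, abs_of_nonneg hy1,
        abs_of_pos hx0, abs_of_pos hy0]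
    have e1 : ∫ p : ℝ × ℝ, (|P.derivative.eval (t : ℝ)| *
          ((p.1 ^ (k + t) * (1 - p.1) ^ s) * (p.2 ^ (h + t) * (1 - p.2) ^ l)) +
        |P.eval (t : ℝ)| *
          ((p.1 ^ (k + t) * (1 - p.1) ^ s * |log p.1|) * (p.2 ^ (h + t) * (1 - p.2) ^ l)) +
        |P.eval (t : ℝ)| *
          ((p.1 ^ (k + t) * (1 - p.1) ^ s) * (p.2 ^ (h + t) * (1 - p.2) ^ l * |log p.2|))) ∂μ =
        |P.derivative.eval (t : ℝ)| * (betaFun k s t * betaFun h l t) +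
        |P.eval (t : ℝ)| * (|deriv (betaFun k s) t| * betaFun h l t) +
        |P.eval (t : ℝ)| * (betaFun k s t * |deriv (betaFun h l) t|) := by
      rw [integral_linear_combination (i1 t) a2 a3]
      rw [hμ, integral_prod_mul (fun x : ℝ => x ^ (k + t) * (1 - x) ^ s)
        (fun x : ℝ => x ^ (h + t) * (1 - x) ^ l),
        integral_prod_mul (fun x : ℝ => x ^ (k + t) * (1 - x) ^ s * |log x|)
        (fun x : ℝ => x ^ (h + t) * (1 - x) ^ l),
        integral_prod_mul (fun x : ℝ => x ^ (k + t) * (1 - x) ^ s)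
        (fun x : ℝ => x ^ (h + t) * (1 - x) ^ l * |log x|),
        integral_unit_beta, integral_unit_beta, integral_unit_beta_abs_log,
        integral_unit_beta_abs_log]
    rw [← e1]
    refine integral_mono_ae (iT t).norm
      ((((i1 t).const_mul _).add (a2.const_mul _)).add (a3.const_mul _))
      (ae_unit_square fun x hx y hy => ?_)
    have hx0 := hx.1; have hy0 := hy.1
    have hx1 : 0 ≤ 1 - x := by linarith [hx.2]
    have hy1 : 0 ≤ 1 - y := by linarith [hy.2]
    refine (norm_add_le _ _).trans <| add_le_add ((norm_add_le _ _).trans <| add_le_add ?_ ?_) ?_ <;>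
    · refine le_of_eq ?_
      simp only [norm_mul, Real.norm_eq_abs, abs_pow, abs_of_nonneg hx1, abs_of_nonneg hy1,
        abs_of_pos hx0, abs_of_pos hy0]
      rfl
  have hsum : Summable fun t : ℕ => ∫ p, ‖rvSqTerm h l k s j d e t p‖ ∂μ :=
    Summable.of_nonneg_of_le (fun t => integral_nonneg fun _ => norm_nonneg _) hbd
      (summable_rvTerm_bound h l k s j d e hd)
  have hS := hasSum_integral_of_summable_integral_norm iT hsum
  simp only [hintg] at hS
  have hpt : ∀ᵐ p ∂μ, p.2 ^ h * (1 - p.2) ^ l * (p.1 ^ k * (1 - p.1) ^ s) *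
      innerInt j (e + d) e (p.2 * p.1) =
      (-1) ^ (d + 1) * ∑' t : ℕ, rvSqTerm h l k s j d e t p := by
    refine ae_unit_square fun y hy x hx => ?_
    have hu0 : 0 < x * y := mul_pos hx.1 hy.1
    have hu1 : x * y < 1 := by nlinarith [hx.1, hx.2, hy.1, hy.2]
    rw [innerInt_eq_derivSum j d e hu0 hu1, derivSum, mul_left_comm, ← tsum_mul_left]
    congr 1
    refine tsum_congr fun t => ?_
    rw [rvSqTerm, Real.log_mul hx.1.ne' hy.1.ne', mul_pow]
    ring
  have hnn : ∀ᵐ p ∂μ, 0 ≤ p.2 ^ h * (1 - p.2) ^ l * (p.1 ^ k * (1 - p.1) ^ s) *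
      innerInt j (e + d) e (p.2 * p.1) := by
    refine ae_unit_square fun y hy x hx => ?_
    have hu0 : 0 < x * y := mul_pos hx.1 hy.1
    have hu1 : x * y < 1 := by nlinarith [hx.1, hx.2, hy.1, hy.2]
    have hx0 := hx.1; have hy0 := hy.1
    have hx1 : 0 ≤ 1 - x := by linarith [hx.2]
    have hy1 : 0 ≤ 1 - y := by linarith [hy.2]
    have : 0 ≤ innerInt j (e + d) e (x * y) := by
      refine intervalIntegral.integral_nonneg zero_le_one fun z hz => ?_
      have hz0 := hz.1
      have hz1 : 0 ≤ 1 - z := by linarith [hz.2]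
      have := innerInt_denom_pos hu0 hu1 hz
      positivity
    positivity
  have hF : Integrable (fun p => ∑' t : ℕ, rvSqTerm h l k s j d e t p) μ := by
    refine ⟨?_, ?_⟩
    · refine AEMeasurable.aestronglyMeasurable ?_
      exact (Measurable.tsum fun t => by unfold rvSqTerm; fun_prop).aemeasurable
    · have h1 : ∫⁻ p, ‖∑' t : ℕ, rvSqTerm h l k s j d e t p‖ₑ ∂μ ≤
          ∫⁻ p, ∑' t : ℕ, ‖rvSqTerm h l k s j d e t p‖ₑ ∂μ :=
        lintegral_mono fun p => enorm_tsum_le_tsum_enorm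
      rw [lintegral_tsum fun t => (iT t).1.enorm] at h1
      refine lt_of_le_of_lt h1 ?_
      have h2 : ∀ t, ∫⁻ p, ‖rvSqTerm h l k s j d e t p‖ₑ ∂μ =
          ENNReal.ofReal (∫ p, ‖rvSqTerm h l k s j d e t p‖ ∂μ) := fun t => by
        rw [ofReal_integral_norm_eq_lintegral_enorm (iT t)]
      simp only [h2]
      exact lt_top_iff_ne_top.2 hsum.tsum_ofReal_ne_top
  have hlint : rvLint h l k s j (e + d) e =
      ENNReal.ofReal ((-1) ^ (d + 1) * ∑' t : ℕ, deriv (rvTerm h l k s j d e) t) := by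
    rw [rvLint_eq_prod, ← ofReal_integral_eq_lintegral_ofReal _ hnn]
    · rw [integral_congr_ae hpt, integral_const_mul, hS.tsum_eq]
    · exact (hF.const_mul _).congr (hpt.mono fun p hp => hp.symm)
  refine ⟨?_, by rw [hlint]; exact ENNReal.ofReal_ne_top, hS.summable⟩
  rw [rvInt, hlint, ENNReal.toReal_ofReal]
  rw [hS.tsum_eq, ← integral_const_mul, ← integral_congr_ae hpt]
  exact integral_nonneg_of_ae hnn

theorem lintegral_Ioo_scale (f : ℝ → ℝ≥0∞) {c : ℝ} (hc : 0 < c) :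
    ∫⁻ y in Ioo 0 c, f y = ∫⁻ z in Ioo (0 : ℝ) 1, ENNReal.ofReal c * f (c * z) := by
  have him : (fun z => c * z) '' Ioo (0 : ℝ) 1 = Ioo 0 c := by
    rw [image_mul_left_Ioo hc]; simp
  rw [← him, lintegral_image_eq_lintegral_abs_deriv_mul measurableSet_Ioo
    (f' := fun _ => c) (fun z _ => ?_) (fun x _ y _ hxy => mul_left_cancel₀ hc.ne' hxy),
    abs_of_pos hc]
  simpa using ((hasDerivAt_id z).const_mul c).hasDerivWithinAt

theorem lintegral_mobius (f : ℝ → ℝ≥0∞) {a b : ℝ} (ha : 0 < a) (hb : 0 < b) :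
    ∫⁻ x in Ioo (0 : ℝ) 1, f x = ∫⁻ y in Ioo (0 : ℝ) 1,
      ENNReal.ofReal (a * (a + b) / (a + b * y) ^ 2) * f (a * (1 - y) / (a + b * y)) := by
  have hmaps : ∀ y ∈ Ioo (0 : ℝ) 1, a * (1 - y) / (a + b * y) ∈ Ioo (0 : ℝ) 1 := by
    intro y hy
    have hy0 := hy.1
    have hy1 : 0 < 1 - y := by linarith [hy.2]
    refine ⟨by positivity, ?_⟩
    rw [div_lt_one (by positivity)]
    nlinarith [mul_pos ha hy0, mul_pos hb hy0]
  have hinv : ∀ y ∈ Ioo (0 : ℝ) 1,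
      a * (1 - a * (1 - y) / (a + b * y)) / (a + b * (a * (1 - y) / (a + b * y))) = y := by
    intro y hy
    have hy0 := hy.1
    have : 0 < a + b * y := by positivity
    have h2 : a + b * (a * (1 - y) / (a + b * y)) = a * (a + b) / (a + b * y) := by
      field_simp; ring
    rw [h2]
    have : 0 < a + b := by positivity
    field_simp
    ring
  have him : (fun y => a * (1 - y) / (a + b * y)) '' Ioo (0 : ℝ) 1 = Ioo 0 1 := by
    ext x
    constructor
    · rintro ⟨y, hy, rfl⟩; exact hmaps y hy
    · intro hx; exact ⟨_, hmaps x hx, hinv x hx⟩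
  conv_lhs => rw [← him]
  rw [lintegral_image_eq_lintegral_abs_deriv_mul measurableSet_Ioo
    (f' := fun y => - (a * (a + b) / (a + b * y) ^ 2)) (fun y hy => ?_) (fun x hx y hy hxy => ?_)]
  · refine setLIntegral_congr_fun measurableSet_Ioo fun y hy => ?_
    have hy0 := hy.1
    simp only [abs_neg]
    rw [abs_of_nonneg (by positivity)]
  · have hy0 := hy.1
    have hne : a + b * y ≠ 0 := by positivity
    have h1 := ((((hasDerivAt_id y).const_sub 1).const_mul a).div
      (((hasDerivAt_id y).const_mul b).const_add a) hne).hasDerivWithinAt (s := Ioo 0 1)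
    refine HasDerivWithinAt.congr_deriv h1 ?_
    simp only [id]
    field_simp
    ring
  · rw [← hinv x hx, ← hinv y hy]
    rw [hxy]

theorem lintegral_rvFun_x (h l k s j q e r g : ℕ) (hr : q + h = e + r) (hg : h + l = e + g)
    {y z : ℝ}
    (hy : y ∈ Ioo (0 : ℝ) 1) (hz : z ∈ Ioo (0 : ℝ) 1) :
    ∫⁻ x in Ioo (0 : ℝ) 1, ENNReal.ofReal (rvFun h l k s j q e x y z) =
    ∫⁻ x in Ioo (0 : ℝ) 1, ENNReal.ofReal (x ^ l * (1 - x) ^ h * (y ^ k * (1 - y) ^ s) *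
      (z ^ j * (1 - z) ^ r) * ((1 - z + y * z) ^ l / (1 - z + y * z) ^ e) /
      (1 - z + x * y * z) ^ (g + 1)) := by
  have ha : 0 < 1 - z := by linarith [hz.2]
  have hb : 0 < y * z := mul_pos hy.1 hz.1
  rw [lintegral_mobius _ ha hb]
  refine setLIntegral_congr_fun measurableSet_Ioo fun x hx => ?_
  have hx0 := hx.1
  have hx1 : 0 < 1 - x := by linarith [hx.2]
  have hy0 := hy.1
  have hz0 := hz.1
  have hy1 : 0 < 1 - y := by linarith [hy.2]
  rw [← ENNReal.ofReal_mul (by positivity)]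
  congr 1
  unfold rvFun
  have hD : 0 < (1 - z) + y * z * x := by positivity
  have e1 : 1 - (1 - (1 - z) * (1 - x) / (1 - z + y * z * x) * y) * z =
      (1 - z) * (1 - z + y * z) / (1 - z + y * z * x) := by
    field_simp; ring
  have e2 : 1 - (1 - z) * (1 - x) / (1 - z + y * z * x) =
      (1 - z + y * z) * x / (1 - z + y * z * x) := by
    field_simp; ring
  rw [e1, e2, show x * y * z = y * z * x by ring]
  have hS : 0 < 1 - z + y * z := by positivity
  generalize 1 - z + y * z * x = D at *
  generalize 1 - z + y * z = S at *
  generalize 1 - z = a at *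
  have h1 : a ^ q * a ^ h = a ^ e * a ^ r := by rw [← pow_add, hr, pow_add]
  have h2 : D ^ h * D ^ l = D ^ e * D ^ g := by rw [← pow_add, hg, pow_add]
  simp only [div_pow, mul_pow, pow_succ]
  have h3 : a ^ h = a ^ e * a ^ r / a ^ q := by field_simp; linarith
  have h4 : D ^ g = D ^ h * D ^ l / D ^ e := by field_simp; linarith
  rw [h3, h4]
  field_simp

theorem measurable_lintegral_indicator {f : ℝ × ℝ × ℝ → ℝ} (hf : Measurable f) :
    Measurable fun p : ℝ × ℝ => {p : ℝ × ℝ | p.1 + p.2 < 1}.indicator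
      (fun p => ∫⁻ x in Ioo (0 : ℝ) 1, ENNReal.ofReal (f (x, p.1, p.2))) p := by
  refine Measurable.indicator ?_ (measurableSet_lt (by fun_prop) (by fun_prop))
  exact Measurable.lintegral_prod_right' (f := fun w : (ℝ × ℝ) × ℝ =>
      ENNReal.ofReal (f (w.2, w.1.1, w.1.2))) (hf.comp
      (by fun_prop : Measurable fun w : (ℝ × ℝ) × ℝ => (w.2, w.1.1, w.1.2))).ennreal_ofReal

theorem rvLint_T (h l k s j q e r m g : ℕ) (hls : l + s = j + q) (hr : q + h = e + r)
    (hm : q + k = e + m) (hg : h + l = e + g) :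
    rvLint h l k s j q e = rvLint l h j m k r g := by
  obtain ⟨κ, hκ⟩ : ∃ κ : ℝ → ℝ → ℝ → ℝ, ∀ x y X, κ x y X = x ^ l * (1 - x) ^ h * y ^ k * X ^ j *
    (1 - y - X) ^ r * ((1 - X) ^ l / (1 - X) ^ e) / (1 - y - X + y * X * x) ^ (g + 1) :=
    ⟨_, fun _ _ _ => rfl⟩
  obtain ⟨K, hK⟩ : ∃ K : ℝ → ℝ → ℝ≥0∞, ∀ y X, K y X =
    ∫⁻ x in Ioo (0 : ℝ) 1, ENNReal.ofReal (κ x y X) := ⟨_, fun _ _ => rfl⟩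
  have hκm : Measurable fun p : ℝ × ℝ × ℝ => κ p.1 p.2.1 p.2.2 := by
    simp only [hκ]; fun_prop
  have hmeas := measurable_lintegral_indicator hκm
  have s1 : rvLint h l k s j q e = ∫⁻ y in Ioo (0 : ℝ) 1, ∫⁻ X in Ioo (0 : ℝ) (1 - y), K y X := by
    unfold rvLint
    refine setLIntegral_congr_fun measurableSet_Ioo fun y hy => ?_
    have hy1 : 0 < 1 - y := by linarith [hy.2]
    have hy0 := hy.1
    rw [lintegral_Ioo_scale _ hy1]
    refine setLIntegral_congr_fun measurableSet_Ioo fun z hz => ?_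
    rw [lintegral_rvFun_x h l k s j q e r g hr hg hy hz, hK,
      ← lintegral_const_mul' _ _ ENNReal.ofReal_ne_top]
    refine setLIntegral_congr_fun measurableSet_Ioo fun x hx => ?_
    rw [← ENNReal.ofReal_mul hy1.le, hκ]
    congr 1
    have hz0 := hz.1
    have hz1 : 0 < 1 - z := by linarith [hz.2]
    have hx0 := hx.1
    rw [show 1 - y - (1 - y) * z = (1 - y) * (1 - z) by ring,
      show 1 - (1 - y) * z = 1 - z + y * z by ring,
      show (1 - y) * (1 - z) + y * ((1 - y) * z) * x = (1 - y) * (1 - z + x * y * z) by ring]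
    have hS : 0 < 1 - z + y * z := by positivity
    have hD : 0 < 1 - z + x * y * z := by positivity
    have hexp : s + g = j + r := by omega
    generalize 1 - z + x * y * z = D at *
    generalize 1 - z + y * z = S at *
    generalize 1 - y = a at *
    have h1 : a ^ s * a ^ g = a ^ j * a ^ r := by rw [← pow_add, hexp, pow_add]
    have h3 : a ^ s = a ^ j * a ^ r / a ^ g := by field_simp; linarith
    simp only [mul_pow, pow_succ]
    rw [h3]
    field_simp
  have s2 : rvLint l h j m k r g = ∫⁻ X in Ioo (0 : ℝ) 1, ∫⁻ y in Ioo (0 : ℝ) (1 - X), K y X := by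
    unfold rvLint
    refine setLIntegral_congr_fun measurableSet_Ioo fun X hX => ?_
    have hX1 : 0 < 1 - X := by linarith [hX.2]
    have hX0 := hX.1
    rw [lintegral_Ioo_scale _ hX1]
    refine setLIntegral_congr_fun measurableSet_Ioo fun z hz => ?_
    rw [hK, ← lintegral_const_mul' _ _ ENNReal.ofReal_ne_top]
    refine setLIntegral_congr_fun measurableSet_Ioo fun x hx => ?_
    rw [← ENNReal.ofReal_mul hX1.le, hκ, rvFun]
    congr 1
    have hz0 := hz.1
    have hz1 : 0 < 1 - z := by linarith [hz.2]
    have hx0 := hx.1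
    rw [show 1 - (1 - X) * z - X = (1 - X) * (1 - z) by ring,
      show (1 - X) * (1 - z) + (1 - X) * z * X * x = (1 - X) * (1 - z + x * X * z) by ring,
      show 1 - (1 - x * X) * z = 1 - z + x * X * z by ring]
    have hD : 0 < 1 - z + x * X * z := by positivity
    have hexp : m + e + g = k + r + l := by omega
    generalize 1 - z + x * X * z = D at *
    generalize 1 - X = a at *
    have h1 : a ^ m * a ^ e * a ^ g = a ^ k * a ^ r * a ^ l := by
      rw [← pow_add, ← pow_add, hexp, pow_add, pow_add]
    have h3 : a ^ m = a ^ k * a ^ r * a ^ l / (a ^ e * a ^ g) := by field_simp; linarith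
    simp only [mul_pow, pow_succ]
    rw [h3]
    field_simp
  have ind : ∀ y ∈ Ioo (0 : ℝ) 1, ∀ F : ℝ → ℝ≥0∞, ∫⁻ X in Ioo (0 : ℝ) (1 - y), F X =
      ∫⁻ X in Ioo (0 : ℝ) 1, {X : ℝ | y + X < 1}.indicator F X := by
    intro y hy F
    have hms : MeasurableSet {X : ℝ | y + X < 1} := measurableSet_lt (by fun_prop) (by fun_prop)
    rw [lintegral_indicator hms, Measure.restrict_restrict hms]
    congr 2
    ext X
    simp only [mem_Ioo, mem_inter_iff, mem_ofPred_eq]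
    constructor
    · rintro ⟨h1, h2⟩; exact ⟨by linarith, h1, by linarith [hy.1]⟩
    · rintro ⟨h1, h2, h3⟩; exact ⟨h2, by linarith⟩
  have s3 : ∀ y X, {p : ℝ × ℝ | p.1 + p.2 < 1}.indicator
      (fun p => ∫⁻ x in Ioo (0 : ℝ) 1, ENNReal.ofReal (κ x p.1 p.2)) (y, X) =
      {X : ℝ | y + X < 1}.indicator (fun X => K y X) X := by
    intro y X
    simp only [indicator, mem_ofPred_eq, hK]
  have s4 : ∀ y X, {p : ℝ × ℝ | p.1 + p.2 < 1}.indicator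
      (fun p => ∫⁻ x in Ioo (0 : ℝ) 1, ENNReal.ofReal (κ x p.1 p.2)) (y, X) =
      {y : ℝ | X + y < 1}.indicator (fun y => K y X) y := by
    intro y X
    simp only [indicator, mem_ofPred_eq, hK, add_comm]
  rw [s1, s2]
  calc ∫⁻ y in Ioo (0 : ℝ) 1, ∫⁻ X in Ioo (0 : ℝ) (1 - y), K y X
      = ∫⁻ y in Ioo (0 : ℝ) 1, ∫⁻ X in Ioo (0 : ℝ) 1, {p : ℝ × ℝ | p.1 + p.2 < 1}.indicator
          (fun p => ∫⁻ x in Ioo (0 : ℝ) 1, ENNReal.ofReal (κ x p.1 p.2)) (y, X) := by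
        refine setLIntegral_congr_fun measurableSet_Ioo fun y hy => ?_
        rw [ind y hy]
        simp only [s3]
    _ = ∫⁻ X in Ioo (0 : ℝ) 1, ∫⁻ y in Ioo (0 : ℝ) 1, {p : ℝ × ℝ | p.1 + p.2 < 1}.indicator
          (fun p => ∫⁻ x in Ioo (0 : ℝ) 1, ENNReal.ofReal (κ x p.1 p.2)) (y, X) :=
        lintegral_lintegral_swap hmeas.aemeasurable
    _ = _ := by
        refine setLIntegral_congr_fun measurableSet_Ioo fun X hX => ?_
        rw [ind X hX]
        simp only [s4]

/-- The symmetric rational function whose derivative is summed in the series expansion of the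
Rhin–Viola integral. -/
noncomputable def coreFun (a₁ a₂ a₃ a₄ b₁ b₂ d : ℕ) (t : ℝ) : ℝ :=
  (fallPoly d).eval t * ((risePoly a₁).eval t * (risePoly a₂).eval t * (risePoly a₃).eval t *
    (risePoly a₄).eval t) / ((risePoly (b₁ + 1)).eval t * (risePoly (b₂ + 1)).eval t)

/-- The series attached to `coreFun`. -/
noncomputable def coreSum (a₁ a₂ a₃ a₄ b₁ b₂ d : ℕ) : ℝ :=
  (-1) ^ (d + 1) * ∑' t : ℕ, deriv (coreFun a₁ a₂ a₃ a₄ b₁ b₂ d) t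

theorem rvTerm_eq_coreFun (h l k s j d e : ℕ) {t : ℝ} (ht : -1 < t) :
    rvTerm h l k s j d e t = (l.factorial * s.factorial / (e.factorial * (j + d).factorial)) *
      coreFun h k j e (h + l) (k + s) d t := by
  rw [rvTerm, betaFun_eq h l ht, betaFun_eq k s ht, innerPoly, coreFun]
  simp only [eval_mul, eval_C]
  field_simp

theorem deriv_rvTerm_eq_coreFun (h l k s j d e : ℕ) (t : ℕ) :
    deriv (rvTerm h l k s j d e) t = (l.factorial * s.factorial / (e.factorial *
        (j + d).factorial)) *
      deriv (coreFun h k j e (h + l) (k + s) d) t := by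
  have ht : (-1 : ℝ) < t := by have : (0 : ℝ) ≤ t := by positivity
                               linarith
  have : rvTerm h l k s j d e =ᶠ[𝓝 (t : ℝ)] fun t =>
      (l.factorial * s.factorial / (e.factorial * (j + d).factorial)) *
      coreFun h k j e (h + l) (k + s) d t := by
    filter_upwards [lt_mem_nhds ht] with x hx using rvTerm_eq_coreFun h l k s j d e hx
  rw [this.deriv_eq, deriv_const_mul_field]

theorem rvInt_mul_factorial (h l k s j d e : ℕ) (hd : l + s = j + e + d) :
    rvInt h l k s j (e + d) e * (e.factorial * (j + d).factorial) =
      l.factorial * s.factorial * coreSum h k j e (h + l) (k + s) d := by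
  rw [(hasSum_integral_rvSqTerm h l k s j d e hd).1]
  simp only [deriv_rvTerm_eq_coreFun, tsum_mul_left, coreSum]
  field_simp

theorem rvInt_S_move (h l k s j q e h' l' k' s' j' q' e' : ℕ) (d : ℕ) (hq : q = e + d)
    (hq' : q' = e' + d) (hd : l + s = j + q) (hd' : l' + s' = j' + q')
    (hc : ∀ t, coreFun h k j e (h + l) (k + s) d t = coreFun h' k' j' e' (h' + l') (k' + s') d t) :
    rvInt h l k s j q e * (e.factorial * (j + d).factorial * (l'.factorial * s'.factorial)) =
    rvInt h' l' k' s' j' q' e' *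
      (e'.factorial * (j' + d).factorial * (l.factorial * s.factorial)) := by
  subst hq hq'
  have h1 := rvInt_mul_factorial h l k s j d e (by omega)
  have h2 := rvInt_mul_factorial h' l' k' s' j' d e' (by omega)
  have h3 : coreSum h k j e (h + l) (k + s) d = coreSum h' k' j' e' (h' + l') (k' + s') d := by
    unfold coreSum
    rw [show coreFun h k j e (h + l) (k + s) d = coreFun h' k' j' e' (h' + l') (k' + s') d from
      funext hc]
  rw [h3] at h1
  linear_combination (l'.factorial * s'.factorial : ℝ) * h1 - (l.factorial * s.factorial : ℝ) * h2

theorem rvInt_T_move (h l k s j q e r m g : ℕ) (hls : l + s = j + q) (hr : q + h = e + r)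
    (hm : q + k = e + m) (hg : h + l = e + g) :
    rvInt h l k s j q e = rvInt l h j m k r g := by
  rw [rvInt, rvLint_T h l k s j q e r m g hls hr hm hg, rvInt]

end

section

open Real Set Filter Topology MeasureTheory Polynomial

/-- The polynomial `X (X - 1) ⋯ (X - n + 1) / n!`. -/
noncomputable def binPoly (n : ℕ) : ℝ[X] := C (1 / (n.factorial : ℝ)) * fallPoly n

theorem binPoly_zero : binPoly 0 = 1 := by simp [binPoly, fallPoly_zero]

theorem binPoly_comp_succ (n : ℕ) :
    (binPoly (n + 1)).comp (X + C 1) = binPoly (n + 1) + binPoly n := by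
  have h1 : (fallPoly (n + 1)).comp (X + C 1) = (X + C 1) * fallPoly n := by
    rw [fallPoly_succ', mul_comp, comp_assoc]
    simp
  unfold binPoly
  rw [mul_comp, h1, C_comp, fallPoly_succ, Nat.factorial_succ]
  have h2 : C (1 / (n.factorial : ℝ)) = C (1 / (((n + 1) * n.factorial : ℕ) : ℝ)) *
      C ((n : ℝ) + 1) := by
    rw [← C_mul]; congr 1; push_cast; field_simp
  rw [h2, C_add]
  ring

theorem eval_binPoly_zero (n : ℕ) : (binPoly (n + 1)).eval 0 = 0 := by
  simp [binPoly, fallPoly_succ']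

theorem eval_derivative_binPoly_zero (n : ℕ) :
    (binPoly (n + 1)).derivative.eval 0 = (-1) ^ n / (n + 1) := by
  rw [binPoly, fallPoly_succ', derivative_C_mul, derivative_mul]
  simp only [derivative_X, one_mul, eval_mul, eval_C, eval_add, eval_X, zero_mul, add_zero,
    eval_comp,
    eval_sub, zero_sub]
  rw [eval_fallPoly_neg_one, Nat.factorial_succ]
  push_cast
  field_simp

theorem eval_binPoly_int (n : ℕ) (z : ℤ) : ∃ m : ℤ, (binPoly n).eval (z : ℝ) = m := by
  induction n generalizing z with
  | zero => exact ⟨1, by simp [binPoly_zero]⟩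
  | succ n ih =>
    have hstep : ∀ x : ℝ, (binPoly (n + 1)).eval (x + 1) =
        (binPoly (n + 1)).eval x + (binPoly n).eval x := by
      intro x
      have := congrArg (eval x) (binPoly_comp_succ n)
      simpa using this
    induction z using Int.induction_on with
    | zero => exact ⟨0, by simp [eval_binPoly_zero]⟩
    | succ i hi =>
      obtain ⟨m, hm⟩ := hi
      obtain ⟨m', hm'⟩ := ih i
      exact ⟨m + m', by push_cast at *; rw [hstep, hm, hm']⟩
    | pred i hi =>
      obtain ⟨m, hm⟩ := hi
      obtain ⟨m', hm'⟩ := ih (-i - 1)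
      refine ⟨m - m', ?_⟩
      have := hstep (((-i - 1 : ℤ)) : ℝ)
      rw [hm'] at this
      push_cast at *
      rw [sub_add_cancel, hm] at this
      linarith

theorem eval_derivative_binPoly_int (n M D : ℕ) (hD : ∀ i, 1 ≤ i → i ≤ M → i ∣ D) (hn : n ≤ M)
    (z : ℤ) : ∃ m : ℤ, D * (binPoly n).derivative.eval (z : ℝ) = m := by
  induction n generalizing z with
  | zero => exact ⟨0, by simp [binPoly_zero]⟩
  | succ n ih =>
    have ih := ih (by omega)
    have hstep : ∀ x : ℝ, (binPoly (n + 1)).derivative.eval (x + 1) =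
        (binPoly (n + 1)).derivative.eval x + (binPoly n).derivative.eval x := by
      intro x
      have := congrArg (fun p => eval x (derivative p)) (binPoly_comp_succ n)
      simpa [derivative_comp] using this
    induction z using Int.induction_on with
    | zero =>
      obtain ⟨c, hc⟩ := hD (n + 1) (by omega) hn
      refine ⟨c * (-1) ^ n, ?_⟩
      rw [Int.cast_zero, eval_derivative_binPoly_zero, hc]
      push_cast
      field_simp
    | succ i hi =>
      obtain ⟨m, hm⟩ := hi
      obtain ⟨m', hm'⟩ := ih i
      exact ⟨m + m', by push_cast at *; rw [hstep, mul_add, hm, hm']⟩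
    | pred i hi =>
      obtain ⟨m, hm⟩ := hi
      obtain ⟨m', hm'⟩ := ih (-i - 1)
      refine ⟨m - m', ?_⟩
      have := hstep (((-i - 1 : ℤ)) : ℝ)
      push_cast at *
      rw [sub_add_cancel] at this
      rw [this, mul_add, hm'] at hm
      linarith

theorem fallPoly_add (m n : ℕ) : fallPoly (m + n) = fallPoly m *
    (fallPoly n).comp (X - C (m : ℝ)) := by
  unfold fallPoly
  rw [Finset.prod_range_add, prod_comp]
  congr 1
  refine Finset.prod_congr rfl fun i _ => ?_
  simp; ring

theorem risePoly_eq_comp (n : ℕ) : risePoly n = (fallPoly n).comp (X + C (n : ℝ)) := by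
  induction n with
  | zero => simp [risePoly_zero, fallPoly_zero]
  | succ n ih =>
    rw [risePoly_succ, ih, fallPoly_succ', mul_comp, comp_assoc, mul_comm]
    congr 1
    · simp
    · congr 1; simp; ring

theorem innerPoly_eq_binPoly (j d e : ℕ) :
    innerPoly j d e = (binPoly e).comp (X + C (e : ℝ)) * (binPoly (j + d)).comp
        (X + C (j : ℝ)) := by
  have h1 : (fallPoly (j + d)).comp (X + C (j : ℝ)) = risePoly j * fallPoly d := by
    rw [fallPoly_add, mul_comp, ← risePoly_eq_comp, comp_assoc]
    simp
  unfold innerPoly binPoly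
  rw [mul_comp, mul_comp, ← risePoly_eq_comp, h1, C_comp, C_comp, one_div, mul_inv, C_mul, one_div,
    one_div]
  ring

theorem eval_innerPoly_int (j d e : ℕ) (z : ℤ) : ∃ m : ℤ, (innerPoly j d e).eval (z : ℝ) = m := by
  obtain ⟨m, hm⟩ := eval_binPoly_int e (z + e)
  obtain ⟨m', hm'⟩ := eval_binPoly_int (j + d) (z + j)
  refine ⟨m * m', ?_⟩
  rw [innerPoly_eq_binPoly]
  push_cast at *
  simp [hm, hm']

theorem eval_derivative_innerPoly_int (j d e M D : ℕ) (hD : ∀ i, 1 ≤ i → i ≤ M → i ∣ D)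
    (he : e ≤ M) (hj : j + d ≤ M) (z : ℤ) :
    ∃ m : ℤ, D * (innerPoly j d e).derivative.eval (z : ℝ) = m := by
  obtain ⟨m, hm⟩ := eval_binPoly_int e (z + e)
  obtain ⟨m', hm'⟩ := eval_binPoly_int (j + d) (z + j)
  obtain ⟨n, hn⟩ := eval_derivative_binPoly_int e M D hD he (z + e)
  obtain ⟨n', hn'⟩ := eval_derivative_binPoly_int (j + d) M D hD hj (z + j)
  refine ⟨n * m' + m * n', ?_⟩
  rw [innerPoly_eq_binPoly, derivative_mul, derivative_comp, derivative_comp]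
  push_cast at *
  simp [hm, hm', ← hn, ← hn']
  ring

theorem abs_eval_risePoly_neg (e κ : ℕ) :
    |(risePoly e).eval (-((κ : ℝ) + 1))| = e.factorial * (κ.choose e) := by
  rw [← Nat.cast_mul, ← Nat.descFactorial_eq_factorial_mul_choose]
  induction e with
  | zero => simp [risePoly_zero]
  | succ e ih =>
    rw [risePoly_succ, eval_mul, abs_mul, ih, Nat.descFactorial_succ, mul_comm, Nat.cast_mul]
    by_cases h : e ≤ κ
    · rw [Nat.cast_sub h]
      congr 1
      have : (e : ℝ) ≤ κ := by exact_mod_cast h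
      rw [eval_add, eval_X, eval_C, abs_of_nonpos (by linarith)]
      ring
    · rw [Nat.descFactorial_of_lt (by omega)]
      simp

theorem abs_eval_fallPoly_neg (d κ : ℕ) :
    |(fallPoly d).eval (-((κ : ℝ) + 1))| * κ.factorial = (κ + d).factorial := by
  induction d with
  | zero => simp [fallPoly_zero]
  | succ d ih =>
    rw [fallPoly_succ, eval_mul, abs_mul, mul_right_comm, ih, ← add_assoc, Nat.factorial_succ]
    rw [eval_sub, eval_X, eval_C, abs_of_nonpos]
    · push_cast; ring
    · have : (0 : ℝ) ≤ κ + d := by positivity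
      linarith

theorem abs_eval_innerPoly_neg (j d e κ : ℕ) :
    |(innerPoly j d e).eval (-((κ : ℝ) + 1))| = κ.choose e * (κ + d).choose (j + d) := by
  rw [innerPoly, eval_mul, eval_mul, eval_mul, eval_C, abs_mul, abs_mul, abs_mul,
    abs_eval_risePoly_neg, abs_eval_risePoly_neg, abs_of_nonneg (by positivity)]
  have h := abs_eval_fallPoly_neg d κ
  by_cases hj : j ≤ κ
  · have h1 := Nat.choose_mul_factorial_mul_factorial hj
    have h2 := Nat.choose_mul_factorial_mul_factorial (show j + d ≤ κ + d by omega)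
    rw [Nat.add_sub_add_right] at h2
    rw [← h2, ← h1] at h
    have h3 : (0 : ℝ) < (κ - j).factorial := by positivity
    push_cast at h
    have h4 : |(fallPoly d).eval (-((κ : ℝ) + 1))| * (κ.choose j * j.factorial) =
        (κ + d).choose (j + d) * (j + d).factorial := by
      refine mul_right_cancel₀ h3.ne' ?_
      linear_combination h
    field_simp
    linear_combination (κ.choose e : ℝ) * h4
  · rw [Nat.choose_eq_zero_of_lt (show κ < j by omega),
      Nat.choose_eq_zero_of_lt (show κ + d < j + d by omega)]
    simp

/-- `R` has a partial fraction decomposition with double poles at `-1, …, -N`, integral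
coefficients of the double poles with sum `a`, and residues in `ℤ / D`. -/
def IsPF (N D : ℕ) (R : ℝ → ℝ) (a : ℤ) : Prop :=
  ∃ (G : ℝ[X]) (A B : ℕ → ℤ), ∑ κ ∈ Finset.range N, A κ = a ∧ ∀ τ : ℝ, -1 < τ →
    R τ = G.eval τ + ∑ κ ∈ Finset.range N,
      ((A κ : ℝ) / (τ + κ + 1) ^ 2 + (B κ / D : ℝ) / (τ + κ + 1))

theorem IsPF.add {N D : ℕ} {R S : ℝ → ℝ} {a b : ℤ} (hR : IsPF N D R a) (hS : IsPF N D S b) :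
    IsPF N D (fun τ => R τ + S τ) (a + b) := by
  obtain ⟨G, A, B, h1, h2⟩ := hR
  obtain ⟨G', A', B', h1', h2'⟩ := hS
  refine ⟨G + G', fun κ => A κ + A' κ, fun κ => B κ + B' κ, ?_, fun τ hτ => ?_⟩
  · rw [Finset.sum_add_distrib, h1, h1']
  · beta_reduce
    rw [h2 τ hτ, h2' τ hτ, eval_add, add_add_add_comm, ← Finset.sum_add_distrib]
    congr 1
    refine Finset.sum_congr rfl fun κ _ => ?_
    push_cast
    ring

theorem IsPF.const_mul {N D : ℕ} {R : ℝ → ℝ} {a : ℤ} (hR : IsPF N D R a) (c : ℤ) :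
    IsPF N D (fun τ => c * R τ) (c * a) := by
  obtain ⟨G, A, B, h1, h2⟩ := hR
  refine ⟨C (c : ℝ) * G, fun κ => c * A κ, fun κ => c * B κ, ?_, fun τ hτ => ?_⟩
  · rw [← Finset.mul_sum, h1]
  · beta_reduce
    rw [h2 τ hτ, eval_mul, eval_C, mul_add, Finset.mul_sum]
    congr 1
    refine Finset.sum_congr rfl fun κ _ => ?_
    push_cast
    ring

theorem IsPF.zero (N D : ℕ) : IsPF N D (fun _ => 0) 0 :=
  ⟨0, fun _ => 0, fun _ => 0, by simp, fun τ _ => by simp⟩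

theorem IsPF.sum {N D : ℕ} {ι : Type*} (s : Finset ι) {R : ι → ℝ → ℝ} {a : ι → ℤ}
    (h : ∀ i ∈ s, IsPF N D (R i) (a i)) :
    IsPF N D (fun τ => ∑ i ∈ s, R i τ) (∑ i ∈ s, a i) := by
  classical
  induction s using Finset.induction_on with
  | empty => simpa using IsPF.zero N D
  | insert i s hi ih =>
    simp only [Finset.sum_insert hi]
    exact (h i (Finset.mem_insert_self _ _)).add
      (ih fun j hj => h j (Finset.mem_insert_of_mem hj))

theorem exists_eval_sub_factor (Q : ℝ[X]) (c : ℝ) :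
    ∃ G : ℝ[X], ∀ x : ℝ, Q.eval x = Q.eval c + (x - c) * G.eval x := by
  refine ⟨Q /ₘ (X - C c), fun x => ?_⟩
  have := congrArg (eval x) (modByMonic_add_div Q (X - C c))
  rw [modByMonic_X_sub_C_eq_C_eval] at this
  simpa using this.symm

theorem isPF_pair {M N D : ℕ} (hN : N ≤ M + 1) (hD : ∀ i, 1 ≤ i → i ≤ M → i ∣ D) (hD0 : D ≠ 0)
    (Q : ℝ[X])
    (hQ' : ∀ z : ℤ, ∃ m : ℤ, D * Q.derivative.eval (z : ℝ) = m) (q : ℕ → ℤ)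
    (hq : ∀ u : ℕ, Q.eval (-((u : ℝ) + 1)) = q u)
    {u v : ℕ} (hu : u < N) (hv : v < N) :
    IsPF N D (fun τ => Q.eval τ / ((τ + u + 1) * (τ + v + 1))) (if u = v then q u else 0) := by
  have hD0' : (D : ℝ) ≠ 0 := by exact_mod_cast hD0
  have hpos : ∀ (w : ℕ) (τ : ℝ), -1 < τ → τ + w + 1 ≠ 0 := by
    intro w τ hτ
    have : (0 : ℝ) ≤ w := by positivity
    linarith
  by_cases huv : u = v
  · subst huv
    rw [if_pos rfl]
    obtain ⟨G, hG⟩ := exists_eval_sub_factor Q (-((u : ℝ) + 1))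
    obtain ⟨G', hG'⟩ := exists_eval_sub_factor G (-((u : ℝ) + 1))
    obtain ⟨m, hm⟩ := hQ' (-((u : ℤ) + 1))
    have hder : Q.derivative.eval (-((u : ℝ) + 1)) = G.eval (-((u : ℝ) + 1)) := by
      have h1 : Q = C (Q.eval (-((u : ℝ) + 1))) + (X - C (-((u : ℝ) + 1))) * G := by
        refine Polynomial.funext fun x => ?_
        rw [hG x]; simp
      conv_lhs => rw [h1]
      rw [derivative_add, derivative_C, derivative_mul]
      simp
    refine ⟨G', fun κ => if κ = u then q u else 0, fun κ => if κ = u then m else 0, ?_,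
      fun τ hτ => ?_⟩
    · simp [hu]
    · beta_reduce
      have h1 : ∀ κ ∈ Finset.range N, (((if κ = u then q u else 0 : ℤ) : ℝ) / (τ + κ + 1) ^ 2 +
          (((if κ = u then m else 0 : ℤ) : ℝ) / D) / (τ + κ + 1)) = if κ = u then
          ((q u : ℝ) / (τ + u + 1) ^ 2 + ((m : ℝ) / D) / (τ + u + 1)) else 0 := by
        intro κ _
        split_ifs with h
        · subst h; rfl
        · simp
      rw [Finset.sum_congr rfl h1, Finset.sum_ite_eq' , if_pos (Finset.mem_range.2 hu)]
      push_cast at hm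
      rw [← hm, hder, ← hq, hG τ, hG' τ]
      have := hpos u τ hτ
      field_simp
      ring
  · rw [if_neg huv]
    obtain ⟨G, hG⟩ := exists_eval_sub_factor Q (-((u : ℝ) + 1))
    obtain ⟨G', hG'⟩ := exists_eval_sub_factor Q (-((v : ℝ) + 1))
    obtain ⟨c, hc⟩ : ((v : ℤ) - u) ∣ D := by
      rcases Nat.lt_or_gt_of_ne huv with h | h
      · have := hD (v - u) (by omega) (by omega)
        have h2 : ((v - u : ℕ) : ℤ) ∣ D := by exact_mod_cast this
        rwa [Nat.cast_sub h.le] at h2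
      · have := hD (u - v) (by omega) (by omega)
        have h2 : ((u - v : ℕ) : ℤ) ∣ D := by exact_mod_cast this
        rw [Nat.cast_sub h.le] at h2
        rw [← neg_sub]
        exact (neg_dvd).2 h2
    have hc' : (D : ℝ) = ((v : ℝ) - u) * c := by exact_mod_cast hc
    have hvu : (v : ℝ) - u ≠ 0 := by
      rw [sub_ne_zero]; exact_mod_cast (Ne.symm huv)
    refine ⟨C (1 / ((v : ℝ) - u)) * (G - G'), fun _ => 0,
      fun κ => (if κ = u then q u * c else 0) + (if κ = v then - (q v * c) else 0), by simp,
      fun τ hτ => ?_⟩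
    beta_reduce
    have h1 : ∀ κ ∈ Finset.range N, (((0 : ℤ) : ℝ) / (τ + κ + 1) ^ 2 +
        ((((if κ = u then q u * c else 0) + (if κ = v then - (q v * c) else 0) : ℤ) : ℝ) / D) /
          (τ + κ + 1)) = (if κ = u then ((q u * c / D : ℝ) / (τ + u + 1)) else 0) +
        (if κ = v then (-(q v * c) / D : ℝ) / (τ + v + 1) else 0) := by
      intro κ _
      split_ifs with h h'
      · exact absurd (h.symm.trans h') huv
      · subst h; push_cast; ring
      · subst κ; push_cast; ring
      · simp
    rw [Finset.sum_congr rfl h1, Finset.sum_add_distrib, Finset.sum_ite_eq', Finset.sum_ite_eq',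
      if_pos (Finset.mem_range.2 hu), if_pos (Finset.mem_range.2 hv)]
    have hu1 := hpos u τ hτ
    have hv1 := hpos v τ hτ
    have hcne : (c : ℝ) ≠ 0 := fun h => hD0' (by rw [hc', h, mul_zero])
    have e1 : (q u : ℝ) * c / D = q u / (v - u) := by rw [hc']; field_simp
    have e2 : (-(q v * c) : ℝ) / D = - q v / (v - u) := by rw [hc']; field_simp
    rw [e1, e2, ← hq, ← hq, eval_mul, eval_C, eval_sub]
    have g1 := hG τ
    have g2 := hG' τ
    have g3 : G.eval τ = (Q.eval τ - Q.eval (-((u : ℝ) + 1))) / (τ + u + 1) := by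
      rw [eq_div_iff hu1]; linear_combination -g1
    have g4 : G'.eval τ = (Q.eval τ - Q.eval (-((v : ℝ) + 1))) / (τ + v + 1) := by
      rw [eq_div_iff hv1]; linear_combination -g2
    rw [g3, g4]
    field_simp
    ring

theorem hasSum_zetaR {s : ℕ} (hs : 2 ≤ s) : HasSum (fun n : ℕ => 1 / (n + 1 : ℝ) ^ s)
    (zetaR s) := by
  refine Summable.hasSum ?_
  have := (summable_nat_add_iff 1).2 (Real.summable_one_div_nat_pow.2 (by omega : 1 < s))
  simpa using this

theorem hasSum_zetaR_shift {s : ℕ} (hs : 2 ≤ s) (κ : ℕ) :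
    HasSum (fun n : ℕ => 1 / (n + κ + 1 : ℝ) ^ s)
      (zetaR s - ∑ i ∈ Finset.range κ, 1 / (i + 1 : ℝ) ^ s) := by
  have := (hasSum_nat_add_iff' (f := fun n : ℕ => 1 / (n + 1 : ℝ) ^ s) κ).2 (hasSum_zetaR hs)
  simpa using this

theorem exists_int_harmonic (M D κ s : ℕ) (hD : ∀ i, 1 ≤ i → i ≤ M → i ∣ D) (hκ : κ ≤ M) :
    ∃ m : ℤ, (D : ℝ) ^ s * ∑ i ∈ Finset.range κ, 1 / (i + 1 : ℝ) ^ s = m := by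
  induction κ with
  | zero => exact ⟨0, by simp⟩
  | succ κ ih =>
    obtain ⟨m, hm⟩ := ih (by omega)
    obtain ⟨c, hc⟩ := hD (κ + 1) (by omega) hκ
    refine ⟨m + c ^ s, ?_⟩
    rw [Finset.sum_range_succ, mul_add, hm, hc]
    push_cast
    rw [mul_pow]
    field_simp

theorem tendsto_div_pow_atTop (c k : ℝ) :
    Tendsto (fun τ : ℝ => c / (τ + k)) atTop (𝓝 0) :=
  tendsto_const_nhds.div_atTop (tendsto_atTop_add_const_right _ _ tendsto_id)

theorem tendsto_mul_div_atTop (c k : ℝ) :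
    Tendsto (fun τ : ℝ => τ * (c / (τ + k))) atTop (𝓝 c) := by
  have h1 : Tendsto (fun τ : ℝ => c - k * (c / (τ + k))) atTop (𝓝 (c - k * 0)) :=
    tendsto_const_nhds.sub ((tendsto_div_pow_atTop c k).const_mul k)
  simp only [mul_zero, sub_zero] at h1
  refine h1.congr' ?_
  filter_upwards [eventually_gt_atTop (-k)] with τ hτ
  have : τ + k ≠ 0 := by linarith
  field_simp
  ring

theorem IsPF.tsum {M N D : ℕ} {R : ℝ → ℝ} {a : ℤ} (hR : IsPF N D R a) (hN : N ≤ M + 1)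
    (hD : ∀ i, 1 ≤ i → i ≤ M → i ∣ D) (hD0 : D ≠ 0)
    (hlim : Tendsto (fun τ => τ * R τ) atTop (𝓝 0)) :
    ∃ b : ℤ, ∑' t : ℕ, deriv R t = b / (D : ℝ) ^ 3 - 2 * a * zetaR 3 := by
  obtain ⟨G, A, B, hA, hG⟩ := hR
  have hD0' : (D : ℝ) ≠ 0 := by exact_mod_cast hD0
  have hR0 : Tendsto R atTop (𝓝 0) := by
    have h1 : Tendsto (fun τ : ℝ => τ * R τ * τ⁻¹) atTop (𝓝 (0 * 0)) :=
      hlim.mul tendsto_inv_atTop_zero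
    rw [zero_mul] at h1
    refine h1.congr' ?_
    filter_upwards [eventually_gt_atTop 0] with τ hτ
    field_simp
  have hpf : ∀ κ ∈ Finset.range N, Tendsto (fun τ : ℝ =>
      τ * ((A κ : ℝ) / (τ + κ + 1) ^ 2 + (B κ / D : ℝ) / (τ + κ + 1))) atTop (𝓝 (B κ / D : ℝ)) := by
    intro κ _
    have h1 := (tendsto_mul_div_atTop (A κ : ℝ) (κ + 1)).mul (tendsto_div_pow_atTop 1 (κ + 1))
    have h2 := h1.add (tendsto_mul_div_atTop (B κ / D : ℝ) (κ + 1))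
    rw [mul_zero, zero_add] at h2
    refine h2.congr fun τ => ?_
    rw [add_assoc]
    by_cases h : τ + (κ + 1) = 0
    · simp [h]
    · field_simp
      try ring
  have hpfs := tendsto_finsetSum _ hpf
  have hpf0 : ∀ κ ∈ Finset.range N, Tendsto (fun τ : ℝ =>
      ((A κ : ℝ) / (τ + κ + 1) ^ 2 + (B κ / D : ℝ) / (τ + κ + 1))) atTop (𝓝 0) := by
    intro κ hκ
    have h1 := (hpf κ hκ).mul tendsto_inv_atTop_zero
    rw [mul_zero] at h1
    refine h1.congr' ?_
    filter_upwards [eventually_gt_atTop 0] with τ hτ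
    field_simp
  have hpf0s := tendsto_finsetSum _ hpf0
  rw [Finset.sum_const_zero] at hpf0s
  have hG0 : G = 0 := by
    have h1 : Tendsto (fun τ => G.eval τ) atTop (𝓝 0) := by
      have h2 := hR0.sub hpf0s
      rw [sub_zero] at h2
      refine h2.congr' ?_
      filter_upwards [eventually_gt_atTop (-1)] with τ hτ
      rw [hG τ hτ]; ring
    have := (Polynomial.tendsto_nhds_iff (P := G)).1 h1
    exact leadingCoeff_eq_zero.1 this.1
  have hB : ∑ κ ∈ Finset.range N, (B κ / D : ℝ) = 0 := by
    refine tendsto_nhds_unique hpfs (hlim.congr' ?_)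
    filter_upwards [eventually_gt_atTop (-1)] with τ hτ
    rw [hG τ hτ, hG0, eval_zero, zero_add, Finset.mul_sum]
  have hderiv : ∀ t : ℕ, deriv R t = ∑ κ ∈ Finset.range N,
      ((-2 * A κ) * (1 / (t + κ + 1 : ℝ) ^ 3) + (- (B κ / D : ℝ)) * (1 / (t + κ + 1 : ℝ) ^ 2)) := by
    intro t
    have ht : (-1 : ℝ) < t := by have : (0 : ℝ) ≤ t := by positivity
                                 linarith
    have h1 : R =ᶠ[𝓝 (t : ℝ)] fun τ => ∑ κ ∈ Finset.range N,
      ((A κ : ℝ) / (τ + κ + 1) ^ 2 + (B κ / D : ℝ) / (τ + κ + 1)) := by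
      filter_upwards [lt_mem_nhds ht] with τ hτ
      rw [hG τ hτ, hG0, eval_zero, zero_add]
    rw [h1.deriv_eq]
    refine HasDerivAt.deriv (HasDerivAt.fun_sum fun κ _ => ?_)
    have hne : (t : ℝ) + κ + 1 ≠ 0 := by positivity
    have h3 : HasDerivAt (fun τ : ℝ => τ + κ + 1) 1 (t : ℝ) :=
      ((hasDerivAt_id _).add_const (κ : ℝ)).add_const (1 : ℝ)
    have h4 := ((hasDerivAt_const (t : ℝ) (A κ : ℝ)).fun_div (h3.fun_pow 2)
        (pow_ne_zero 2 hne)).fun_add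
      ((hasDerivAt_const (t : ℝ) (B κ / D : ℝ)).fun_div h3 hne)
    refine h4.congr_deriv ?_
    field_simp
    push_cast
    ring
  have hsum : HasSum (fun t : ℕ => deriv R t) (∑ κ ∈ Finset.range N,
      ((-2 * A κ) * (zetaR 3 - ∑ i ∈ Finset.range κ, 1 / (i + 1 : ℝ) ^ 3) +
        (- (B κ / D : ℝ)) * (zetaR 2 - ∑ i ∈ Finset.range κ, 1 / (i + 1 : ℝ) ^ 2))) := by
    simp only [hderiv]
    exact hasSum_sum fun κ _ => ((hasSum_zetaR_shift (by norm_num) κ).mul_left _).add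
      ((hasSum_zetaR_shift (by norm_num) κ).mul_left _)
  rw [hsum.tsum_eq]
  have hintg : ∀ κ : ℕ, ∃ m : ℤ, κ ∈ Finset.range N →
      (2 * A κ * ∑ i ∈ Finset.range κ, 1 / (i + 1 : ℝ) ^ 3 +
      (B κ / D : ℝ) * ∑ i ∈ Finset.range κ, 1 / (i + 1 : ℝ) ^ 2) * D ^ 3 = m := by
    intro κ
    by_cases hκ : κ ∈ Finset.range N
    · have hκ' : κ ≤ M := by have := Finset.mem_range.1 hκ; omega
      obtain ⟨m, hm⟩ := exists_int_harmonic M D κ 3 hD hκ'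
      obtain ⟨m', hm'⟩ := exists_int_harmonic M D κ 2 hD hκ'
      refine ⟨2 * A κ * m + B κ * m', fun _ => ?_⟩
      push_cast
      rw [← hm, ← hm']
      field_simp
    · exact ⟨0, fun h => absurd h hκ⟩
  choose m hm using hintg
  refine ⟨∑ κ ∈ Finset.range N, m κ, ?_⟩
  rw [eq_sub_iff_add_eq, eq_div_iff (pow_ne_zero 3 hD0'), Int.cast_sum, ← Finset.sum_congr rfl hm,
    ← Finset.sum_mul]
  congr 1
  have h5 : (a : ℝ) = ∑ κ ∈ Finset.range N, (A κ : ℝ) := by rw [← hA]; push_cast; rfl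
  have h6 : ∑ κ ∈ Finset.range N, (B κ / D : ℝ) * zetaR 2 = 0 := by
    rw [← Finset.sum_mul, hB, zero_mul]
  rw [h5, Finset.mul_sum, Finset.sum_mul, ← Finset.sum_add_distrib,
    ← sub_eq_zero, ← Finset.sum_sub_distrib, ← neg_eq_zero, ← h6, ← Finset.sum_neg_distrib]
  refine Finset.sum_congr rfl fun κ _ => ?_
  ring

theorem sum_alternating_choose_succ (g : ℕ → ℝ) (l : ℕ) :
    ∑ i ∈ Finset.range (l + 2), (-1 : ℝ) ^ i * (l + 1).choose i * g i =
      ∑ i ∈ Finset.range (l + 1), (-1 : ℝ) ^ i * l.choose i * g i -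
      ∑ i ∈ Finset.range (l + 1), (-1 : ℝ) ^ i * l.choose i * g (i + 1) := by
  have h1 : ∑ i ∈ Finset.range (l + 1), (-1 : ℝ) ^ i * l.choose i * g i =
      ∑ i ∈ Finset.range (l + 2), (-1 : ℝ) ^ i * l.choose i * g i := by
    rw [Finset.sum_range_succ _ (l + 1)]; simp
  rw [h1, Finset.sum_range_succ' _ (l + 1), Finset.sum_range_succ' _ (l + 1), add_sub_right_comm,
    ← Finset.sum_sub_distrib]
  congr 1
  · refine Finset.sum_congr rfl fun i _ => ?_
    rw [Nat.choose_succ_succ]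
    push_cast
    ring
  · simp

theorem betaFun_eq_sum (h l : ℕ) (t : ℝ) :
    betaFun h l t = ∑ i ∈ Finset.range (l + 1), (-1 : ℝ) ^ i * l.choose i *
        (1 / (t + (h + i : ℕ) + 1)) := by
  induction l generalizing h with
  | zero => simp [betaFun]
  | succ l ih =>
    rw [betaFun, ih, ih, sum_alternating_choose_succ fun i => 1 / (t + (h + i : ℕ) + 1)]
    congr 1
    refine Finset.sum_congr rfl fun i _ => ?_
    rw [add_right_comm h 1 i, add_assoc h i 1]

theorem betaFun_sub_nat (U a l : ℕ) (τ : ℝ) : betaFun (U + a) l (τ - a) = betaFun U l τ := by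
  induction l generalizing U with
  | zero => simp only [betaFun]; push_cast; ring_nf
  | succ l ih => rw [betaFun, betaFun, ih, add_right_comm, ih]

theorem eval_innerPoly_root (j d e : ℕ) (i : ℕ) (he : i < e) (hj : i < j) :
    (innerPoly j d e).eval (-((i : ℝ) + 1)) = 0 ∧
    (innerPoly j d e).derivative.eval (-((i : ℝ) + 1)) = 0 := by
  have h0 : ∀ n, i < n → (risePoly n).eval (-((i : ℝ) + 1)) = 0 := by
    intro n hn
    rw [risePoly, eval_prod]
    refine Finset.prod_eq_zero (Finset.mem_range.2 hn) ?_
    simp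
  unfold innerPoly
  simp only [derivative_mul, derivative_C, eval_mul, eval_add, h0 e he, h0 j hj]
  simp

theorem hasSum_deriv_shift (U l V s j d e a : ℕ) (hae : a ≤ e) (haj : a ≤ j)
    (hd : l + s = j + e + d) :
    ∑' t : ℕ, deriv (rvTerm (U + a) l (V + a) s j d e) t =
      ∑' τ : ℕ, deriv (fun τ : ℝ => ((innerPoly j d e).comp (X - C (a : ℝ))).eval τ *
        betaFun U l τ * betaFun V s τ) τ := by
  set R : ℝ → ℝ := fun τ : ℝ => ((innerPoly j d e).comp (X - C (a : ℝ))).eval τ *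
        betaFun U l τ * betaFun V s τ with hR
  have hRe : R = fun τ => rvTerm (U + a) l (V + a) s j d e (τ - a) := by
    funext τ
    simp only [hR, rvTerm, betaFun_sub_nat]
    simp
  have hsh : ∀ t : ℕ, deriv R ((t + a : ℕ) : ℝ) = deriv (rvTerm (U + a) l (V + a) s j d e) t := by
    intro t
    rw [hRe, deriv_comp_sub_const]
    push_cast
    simp
  have hsm : Summable fun t : ℕ => deriv R t := by
    rw [← summable_nat_add_iff a]
    simp only [hsh]
    exact (hasSum_integral_rvSqTerm (U + a) l (V + a) s j d e hd).2.2
  rw [← hsm.sum_add_tsum_nat_add a]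
  simp only [hsh]
  rw [Finset.sum_eq_zero, zero_add]
  intro τ hτ
  have hτa := Finset.mem_range.1 hτ
  have h1 : (-1 : ℝ) < (τ : ℝ) := by
    have : (0 : ℝ) ≤ τ := by positivity
    linarith
  have := (((((innerPoly j d e).comp (X - C (a : ℝ))).hasDerivAt (τ : ℝ)).fun_mul
    (betaFun_hasDerivAt U l h1)).fun_mul (betaFun_hasDerivAt V s h1)).deriv
  rw [hR, this]
  obtain ⟨h2, h3⟩ := eval_innerPoly_root j d e (a - 1 - τ) (by omega) (by omega)
  have h4 : (τ : ℝ) - a = -(((a - 1 - τ : ℕ) : ℝ) + 1) := by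
    rw [Nat.sub_sub, Nat.cast_sub (by omega)]
    push_cast; ring
  simp only [derivative_comp, eval_mul, eval_comp, eval_sub, eval_X, eval_C, h4, h2, h3]
  simp

theorem tendsto_mul_rvTerm (h l k s j d e a : ℕ) (hd : l + s = j + e + d) :
    Tendsto (fun t : ℝ => (t + a) * rvTerm h l k s j d e t) atTop (𝓝 0) := by
  obtain ⟨K, hK, hb⟩ := exists_eval_bound (innerPoly j d e) (l + s)
    ((natDegree_innerPoly_le j d e).trans (by omega))
  have hlim : Tendsto (fun t : ℝ => ((1 + a) * (K * l.factorial * s.factorial)) * t⁻¹) atTop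
      (𝓝 0) := by
    simpa using tendsto_inv_atTop_zero.const_mul ((1 + a) * (K * l.factorial * s.factorial))
  refine squeeze_zero_norm' ?_ hlim
  filter_upwards [eventually_ge_atTop 1] with t ht
  have ht0 : 0 < t := by linarith
  have ht1 : -1 < t := by linarith
  have n1 := betaFun_nonneg h l ht1
  have n2 := betaFun_nonneg k s ht1
  have b1 : betaFun h l t ≤ l.factorial / t ^ (l + 1) := by
    refine (betaFun_le h l ht1).trans ?_
    gcongr; linarith
  have b2 : betaFun k s t ≤ s.factorial / t ^ (s + 1) := by
    refine (betaFun_le k s ht1).trans ?_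
    gcongr; linarith
  have hta : |t + a| ≤ (1 + a) * t := by
    rw [abs_of_nonneg (by positivity)]
    have : (0 : ℝ) ≤ a := by positivity
    nlinarith
  rw [rvTerm, norm_mul, norm_mul, norm_mul, Real.norm_eq_abs, Real.norm_eq_abs, Real.norm_eq_abs,
    Real.norm_eq_abs, abs_of_nonneg n1, abs_of_nonneg n2]
  calc _ ≤ ((1 + a) * t) * ((K * t ^ (l + s)) * (l.factorial / t ^ (l + 1)) *
        (s.factorial / t ^ (s + 1))) := by
        gcongr
        exact hb t ht
    _ = _ := by
      field_simp
      ring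

theorem rvInt_eq_zeta (U l V s j d e a M D : ℕ) (hd : l + s = j + e + d) (hae : a ≤ e) (haj : a ≤ j)
    (heM : e ≤ M) (hjM : j + d ≤ M) (hU : U + l ≤ M) (hV : V + s ≤ M)
    (hD : ∀ i, 1 ≤ i → i ≤ M → i ∣ D) (hD0 : D ≠ 0) :
    ∃ A B : ℤ, rvInt (U + a) l (V + a) s j (e + d) e = A * zetaR 3 - B / (D : ℝ) ^ 3 ∧
      |A| ≤ 2 * ∑ i ∈ Finset.range (l + 1), ∑ i' ∈ Finset.range (s + 1),
        if U + i = V + i' then ((l.choose i * s.choose i' * ((U + i + a).choose e *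
          (U + i + a + d).choose (j + d)) : ℕ) : ℤ) else 0 := by
  set Q := (innerPoly j d e).comp (X - C (a : ℝ)) with hQ
  have hQd : ∀ z : ℤ, ∃ m : ℤ, D * Q.derivative.eval (z : ℝ) = m := by
    intro z
    obtain ⟨m, hm⟩ := eval_derivative_innerPoly_int j d e M D hD heM hjM (z - a)
    refine ⟨m, ?_⟩
    rw [← hm, hQ, derivative_comp]
    simp
  have hQi : ∀ u : ℕ, ∃ m : ℤ, Q.eval (-((u : ℝ) + 1)) = m := by
    intro u
    obtain ⟨m, hm⟩ := eval_innerPoly_int j d e (-((u : ℤ) + 1) - a)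
    refine ⟨m, ?_⟩
    rw [← hm, hQ]
    simp
  choose q hq using hQi
  have hqa : ∀ u : ℕ, |q u| = (((u + a).choose e * (u + a + d).choose (j + d) : ℕ) : ℤ) := by
    intro u
    have := abs_eval_innerPoly_neg j d e (u + a)
    have h2 : Q.eval (-((u : ℝ) + 1)) = (innerPoly j d e).eval (-(((u + a : ℕ) : ℝ) + 1)) := by
      rw [hQ]; simp; ring_nf
    rw [← h2, hq] at this
    exact_mod_cast this
  have hPF : IsPF (M + 1) D (fun τ => Q.eval τ * betaFun U l τ * betaFun V s τ)
      (∑ i ∈ Finset.range (l + 1), ∑ i' ∈ Finset.range (s + 1),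
        ((-1) ^ i * l.choose i * ((-1) ^ i' * s.choose i')) *
          (if U + i = V + i' then q (U + i) else 0)) := by
    have h1 := IsPF.sum (N := M + 1) (D := D) (Finset.range (l + 1)) (fun i hi =>
      IsPF.sum (Finset.range (s + 1)) (fun i' hi' =>
        (isPF_pair (le_refl (M + 1)) hD hD0 Q hQd q hq (u := U + i) (v := V + i')
          (by have := Finset.mem_range.1 hi; omega)
          (by have := Finset.mem_range.1 hi'; omega)).const_mul
          ((-1) ^ i * l.choose i * ((-1) ^ i' * s.choose i'))))
    refine Eq.subst (motive := fun F => IsPF (M + 1) D F _) ?_ h1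
    funext τ
    rw [betaFun_eq_sum, betaFun_eq_sum, mul_assoc, Finset.sum_mul_sum, Finset.mul_sum]
    refine Finset.sum_congr rfl fun i _ => ?_
    rw [Finset.mul_sum]
    refine Finset.sum_congr rfl fun i' _ => ?_
    push_cast
    rw [div_eq_mul_inv, mul_inv]
    ring
  set at' := (∑ i ∈ Finset.range (l + 1), ∑ i' ∈ Finset.range (s + 1),
        ((-1) ^ i * l.choose i * ((-1) ^ i' * s.choose i')) *
          (if U + i = V + i' then q (U + i) else 0)) with hat
  have hab : |at'| ≤ ∑ i ∈ Finset.range (l + 1), ∑ i' ∈ Finset.range (s + 1),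
        if U + i = V + i' then ((l.choose i * s.choose i' * ((U + i + a).choose e *
          (U + i + a + d).choose (j + d)) : ℕ) : ℤ) else 0 := by
    rw [hat]
    refine (Finset.abs_sum_le_sum_abs _ _).trans (Finset.sum_le_sum fun i _ => ?_)
    refine (Finset.abs_sum_le_sum_abs _ _).trans (Finset.sum_le_sum fun i' _ => ?_)
    split_ifs
    · rw [abs_mul, hqa, abs_mul, abs_mul, abs_mul, abs_pow, abs_pow]
      simp
    · simp
  have hlim : Tendsto (fun τ : ℝ => τ * (Q.eval τ * betaFun U l τ * betaFun V s τ)) atTop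
      (𝓝 0) := by
    have h1 := (tendsto_mul_rvTerm (U + a) l (V + a) s j d e a hd).comp
      (tendsto_atTop_add_const_right atTop (-(a : ℝ)) tendsto_id)
    refine h1.congr fun τ => ?_
    simp only [Function.comp, id, rvTerm, ← sub_eq_add_neg, betaFun_sub_nat, sub_add_cancel]
    simp [hQ]
  obtain ⟨b, hb⟩ := hPF.tsum (le_refl _) hD hD0 hlim
  have hI := (hasSum_integral_rvSqTerm (U + a) l (V + a) s j d e hd).1
  rw [hasSum_deriv_shift U l V s j d e a hae haj hd, ← hQ, hb] at hI
  refine ⟨(-1) ^ (d + 1) * (-2 * at'), -((-1) ^ (d + 1) * b), ?_, ?_⟩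
  · rw [hI]
    push_cast
    ring
  · rw [abs_mul, abs_mul, abs_pow]
    simp only [abs_neg, abs_one, one_pow, one_mul, Nat.abs_ofNat]
    linarith

end

section

open Real Set Filter Topology MeasureTheory

/-- The Rhin–Viola integral with all parameters multiplied by `n`. -/
noncomputable def rvScaled (n h l k s j q e : ℕ) : ℝ :=
  rvInt (h * n) (l * n) (k * n) (s * n) (j * n) (q * n) (e * n)

/-- The product of the factorials `(c n)!`, for `c` in a list. -/
def facProd (n : ℕ) (L : List ℕ) : ℕ := (L.map fun c => (c * n).factorial).prod

theorem coreFun_perm (n a₁ a₂ a₃ a₄ b₁ b₂ c₁ c₂ c₃ c₄ e₁ e₂ d : ℕ)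
    (h : [a₁, a₂, a₃, a₄].Perm [c₁, c₂, c₃, c₄]) (h' : [b₁, b₂].Perm [e₁, e₂]) (t : ℝ) :
    coreFun (a₁ * n) (a₂ * n) (a₃ * n) (a₄ * n) (b₁ * n) (b₂ * n) (d * n) t =
    coreFun (c₁ * n) (c₂ * n) (c₃ * n) (c₄ * n) (e₁ * n) (e₂ * n) (d * n) t := by
  have h1 := (h.map fun a => (risePoly (a * n)).eval t).prod_eq
  have h2 := (h'.map fun a => (risePoly (a * n + 1)).eval t).prod_eq
  simp only [List.map_cons, List.map_nil, List.prod_cons, List.prod_nil, mul_one] at h1 h2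
  rw [coreFun, coreFun, h2]
  congr 2
  linarith

theorem rvScaled_S (n h l k s j q e h' l' k' s' j' q' e' d : ℕ) (hq : q = e + d)
    (hq' : q' = e' + d) (hd : l + s = j + q) (hd' : l' + s' = j' + q')
    (hp : [h, k, j, e].Perm [h', k', j', e']) (hp' : [h + l, k + s].Perm [h' + l', k' + s']) :
    rvScaled n h l k s j q e * facProd n [e, j + d, l', s'] =
    rvScaled n h' l' k' s' j' q' e' * facProd n [e', j' + d, l, s] := by
  have := rvInt_S_move (h * n) (l * n) (k * n) (s * n) (j * n) (q * n) (e * n) (h' * n) (l' * n)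
    (k' * n) (s' * n) (j' * n) (q' * n) (e' * n) (d * n) (by rw [hq, add_mul]) (by rw [hq',
      add_mul])
    (by rw [← add_mul, ← add_mul, hd]) (by rw [← add_mul, ← add_mul, hd'])
    (fun t => by simpa only [add_mul] using coreFun_perm n _ _ _ _ _ _ _ _ _ _ _ _ d hp hp' t)
  simp only [rvScaled, facProd, List.map_cons, List.map_nil, List.prod_cons, List.prod_nil, mul_one,
    add_mul]
  push_cast
  linarith

theorem rvScaled_T (n h l k s j q e r m g : ℕ) (hls : l + s = j + q) (hr : q + h = e + r)
    (hm : q + k = e + m) (hg : h + l = e + g) :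
    rvScaled n h l k s j q e = rvScaled n l h j m k r g :=
  rvInt_T_move _ _ _ _ _ _ _ _ _ _ (by rw [← add_mul, ← add_mul, hls])
    (by rw [← add_mul, ← add_mul, hr]) (by rw [← add_mul, ← add_mul, hm])
    (by rw [← add_mul, ← add_mul, hg])

theorem facProd_append (n : ℕ) (L L' : List ℕ) : facProd n (L ++ L') =
    facProd n L * facProd n L' := by
  simp [facProd]

theorem exists_zeta_of_rvScaled (n h l k s j q e a M : ℕ) (hq : e ≤ q) (hls : l + s = j + q)
    (hh : a ≤ h) (hk : a ≤ k) (hj : a ≤ j) (he : a ≤ e) (hM : e ≤ M) (hM' : j + (q - e) ≤ M)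
    (h1 : h + l ≤ M + a) (h2 : k + s ≤ M + a) :
    ∃ A B : ℤ, rvScaled n h l k s j q e =
      A * zetaR 3 - B / (Nat.lcmUpto (M * n) : ℝ) ^ 3 ∧
      |A| ≤ 2 * ∑ i ∈ Finset.range (l * n + 1), ∑ i' ∈ Finset.range (s * n + 1),
        if (h - a) * n + i = (k - a) * n + i' then (((l * n).choose i * (s * n).choose i' *
          (((h - a) * n + i + a * n).choose (e * n) *
          ((h - a) * n + i + a * n + (q - e) * n).choose (j * n + (q - e) * n)) : ℕ) : ℤ) else
              0 := by
  obtain ⟨d, rfl⟩ := Nat.exists_eq_add_of_le hq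
  obtain ⟨U, rfl⟩ := Nat.exists_eq_add_of_le' hh
  obtain ⟨V, rfl⟩ := Nat.exists_eq_add_of_le' hk
  rw [Nat.add_sub_cancel_left] at hM' ⊢
  rw [Nat.add_sub_cancel, Nat.add_sub_cancel]
  have := rvInt_eq_zeta (U * n) (l * n) (V * n) (s * n) (j * n) (d * n) (e * n) (a * n) (M * n)
    (Nat.lcmUpto (M * n)) (by rw [← add_mul, ← add_mul, ← add_mul, hls, add_assoc])
    (Nat.mul_le_mul_right n he) (Nat.mul_le_mul_right n hj)
    (Nat.mul_le_mul_right n hM) (by rw [← add_mul]; exact Nat.mul_le_mul_right n hM')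
    (by rw [← add_mul]; exact Nat.mul_le_mul_right n (by omega))
    (by rw [← add_mul]; exact Nat.mul_le_mul_right n (by omega))
    (fun i hi hi' => Finset.dvd_lcm (f := id) (Finset.mem_Icc.2 ⟨hi, hi'⟩))
    (Nat.lcmUpto_ne_zero _)
  simpa only [rvScaled, add_mul] using this

/-- The Rhin–Viola integral used for the irrationality exponent. -/
noncomputable def rvBase (n : ℕ) : ℝ := rvScaled n 10 14 11 14 9 19 12

theorem link_trans {x y w z : ℝ} {n : ℕ} {N P N' P' : List ℕ}
    (h : x * facProd n N = y * facProd n P)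
    (hw : y = w) (h' : w * facProd n N' = z * facProd n P') :
    x * facProd n (N ++ N') = z * facProd n (P ++ P') := by
  subst hw
  rw [facProd_append, facProd_append]
  push_cast
  linear_combination (facProd n N' : ℝ) * h + (facProd n P : ℝ) * h'

/-- Pairs of lists `(N, P)` such that `rvBase n * ∏ (c n)! = J * ∏ (c' n)!`, with `c ∈ N`, `c' ∈ P`
and another Rhin–Viola integral `J`. -/
def realizations : List (List ℕ × List ℕ) :=
  [([12, 16, 12, 16, 14, 14, 12, 18], [10, 18, 14, 14, 11, 19, 12, 16]),
   ([12, 16, 13, 13], [10, 16, 14, 14]),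
   ([12, 16, 16, 12, 14, 14, 15, 15], [11, 17, 14, 14, 12, 18, 9, 19]),
   ([12, 16, 15, 12], [11, 16, 14, 14]),
   ([12, 16, 15, 13, 13, 15, 19, 11], [11, 17, 14, 14, 12, 18, 9, 19]),
   ([12, 16, 15, 13, 14, 14, 13, 16], [10, 18, 14, 14, 12, 17, 9, 19]),
   ([12, 16, 16, 12, 14, 14, 19, 13], [11, 17, 14, 14, 16, 16, 9, 19]),
   ([12, 16, 15, 13, 13, 15, 14, 14], [11, 17, 14, 14, 12, 16, 9, 19]),
   ([12, 16, 15, 13, 13, 15, 12, 16], [11, 17, 14, 14, 10, 18, 9, 19]),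
   ([12, 16, 16, 12], [10, 18, 14, 14]),
   ([12, 16, 16, 12, 15, 13, 15, 9], [10, 18, 14, 14, 12, 12, 9, 19])]

theorem exists_zeta_of_mem_realizations (n : ℕ) : ∀ L ∈ realizations, ∃ A B : ℤ,
    rvBase n * facProd n L.1 =
      (A * zetaR 3 - B / (Nat.lcmUpto (19 * n) : ℝ) ^ 3) * facProd n L.2 := by
  simp only [realizations, List.forall_mem_cons]
  refine ⟨?_, ?_, ?_, ?_, ?_, ?_, ?_, ?_, ?_, ?_, ?_, by simp⟩
  · obtain ⟨A, b, hA, -⟩ := exists_zeta_of_rvScaled n 12 12 9 18 14 16 11 9 19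
      (by decide) (by decide) (by decide) (by decide) (by decide)
      (by decide) (by decide) (by decide) (by decide) (by decide)
    refine ⟨A, b, ?_⟩
    rw [← hA]
    simpa only [List.cons_append, List.nil_append, Nat.reduceAdd, rvBase] using
      link_trans (rvScaled_S n 10 14 11 14 9 19 12 12 12 9 16 11 17 10 7 rfl rfl rfl rfl (by decide)
          (by decide))
      (rvScaled_T n 12 12 9 16 11 17 10 19 16 14 rfl rfl rfl rfl)
      (rvScaled_S n 12 12 11 16 9 19 14 12 12 9 18 14 16 11 5 rfl rfl rfl rfl (by decide)
          (by decide))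
  · obtain ⟨A, b, hA, -⟩ := exists_zeta_of_rvScaled n 12 13 11 13 9 17 10 9 19
      (by decide) (by decide) (by decide) (by decide) (by decide)
      (by decide) (by decide) (by decide) (by decide) (by decide)
    refine ⟨A, b, ?_⟩
    rw [← hA]
    exact rvScaled_S n 10 14 11 14 9 19 12 12 13 11 13 9 17 10 7 rfl rfl rfl rfl (by decide)
        (by decide)
  · obtain ⟨A, b, hA, -⟩ := exists_zeta_of_rvScaled n 14 15 10 15 16 14 12 10 19
      (by decide) (by decide) (by decide) (by decide) (by decide)
      (by decide) (by decide) (by decide) (by decide) (by decide)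
    refine ⟨A, b, ?_⟩
    rw [← hA]
    simpa only [List.cons_append, List.nil_append, Nat.reduceAdd, rvBase] using
      link_trans (rvScaled_S n 10 14 11 14 9 19 12 9 16 12 12 10 18 11 7 rfl rfl rfl rfl (by decide)
          (by decide))
      (rvScaled_T n 9 16 12 12 10 18 11 16 19 14 rfl rfl rfl rfl)
      (rvScaled_S n 16 9 10 19 12 16 14 14 15 10 15 16 14 12 2 rfl rfl rfl rfl (by decide)
          (by decide))
  · obtain ⟨A, b, hA, -⟩ := exists_zeta_of_rvScaled n 10 15 12 12 9 18 11 9 19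
      (by decide) (by decide) (by decide) (by decide) (by decide)
      (by decide) (by decide) (by decide) (by decide) (by decide)
    refine ⟨A, b, ?_⟩
    rw [← hA]
    exact rvScaled_S n 10 14 11 14 9 19 12 10 15 12 12 9 18 11 7 rfl rfl rfl rfl (by decide)
        (by decide)
  · obtain ⟨A, b, hA, -⟩ := exists_zeta_of_rvScaled n 10 19 13 11 15 15 12 10 19
      (by decide) (by decide) (by decide) (by decide) (by decide)
      (by decide) (by decide) (by decide) (by decide) (by decide)
    refine ⟨A, b, ?_⟩
    rw [← hA]
    simpa only [List.cons_append, List.nil_append, Nat.reduceAdd, rvBase] using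
      link_trans (rvScaled_S n 10 14 11 14 9 19 12 9 15 12 13 10 18 11 7 rfl rfl rfl rfl (by decide)
          (by decide))
      (rvScaled_T n 9 15 12 13 10 18 11 16 19 13 rfl rfl rfl rfl)
      (rvScaled_S n 15 9 10 19 12 16 13 10 19 13 11 15 15 12 3 rfl rfl rfl rfl (by decide)
          (by decide))
  · obtain ⟨A, b, hA, -⟩ := exists_zeta_of_rvScaled n 11 13 14 16 15 14 12 11 19
      (by decide) (by decide) (by decide) (by decide) (by decide)
      (by decide) (by decide) (by decide) (by decide) (by decide)
    refine ⟨A, b, ?_⟩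
    rw [← hA]
    simpa only [List.cons_append, List.nil_append, Nat.reduceAdd, rvBase] using
      link_trans (rvScaled_S n 10 14 11 14 9 19 12 9 15 12 13 11 17 10 7 rfl rfl rfl rfl (by decide)
          (by decide))
      (rvScaled_T n 9 15 12 13 11 17 10 16 19 14 rfl rfl rfl rfl)
      (rvScaled_S n 15 9 11 19 12 16 14 11 13 14 16 15 14 12 2 rfl rfl rfl rfl (by decide)
          (by decide))
  · obtain ⟨A, b, hA, -⟩ := exists_zeta_of_rvScaled n 10 19 12 13 14 18 16 10 19
      (by decide) (by decide) (by decide) (by decide) (by decide)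
      (by decide) (by decide) (by decide) (by decide) (by decide)
    refine ⟨A, b, ?_⟩
    rw [← hA]
    simpa only [List.cons_append, List.nil_append, Nat.reduceAdd, rvBase] using
      link_trans (rvScaled_S n 10 14 11 14 9 19 12 9 16 12 12 10 18 11 7 rfl rfl rfl rfl (by decide)
          (by decide))
      (rvScaled_T n 9 16 12 12 10 18 11 16 19 14 rfl rfl rfl rfl)
      (rvScaled_S n 16 9 10 19 12 16 14 10 19 12 13 14 18 16 2 rfl rfl rfl rfl (by decide)
          (by decide))
  · obtain ⟨A, b, hA, -⟩ := exists_zeta_of_rvScaled n 10 14 15 14 13 15 12 10 19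
      (by decide) (by decide) (by decide) (by decide) (by decide)
      (by decide) (by decide) (by decide) (by decide) (by decide)
    refine ⟨A, b, ?_⟩
    rw [← hA]
    simpa only [List.cons_append, List.nil_append, Nat.reduceAdd, rvBase] using
      link_trans (rvScaled_S n 10 14 11 14 9 19 12 9 15 12 13 10 18 11 7 rfl rfl rfl rfl (by decide)
          (by decide))
      (rvScaled_T n 9 15 12 13 10 18 11 16 19 13 rfl rfl rfl rfl)
      (rvScaled_S n 15 9 10 19 12 16 13 10 14 15 14 13 15 12 3 rfl rfl rfl rfl (by decide)
          (by decide))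
  · obtain ⟨A, b, hA, -⟩ := exists_zeta_of_rvScaled n 12 12 13 16 15 13 10 10 19
      (by decide) (by decide) (by decide) (by decide) (by decide)
      (by decide) (by decide) (by decide) (by decide) (by decide)
    refine ⟨A, b, ?_⟩
    rw [← hA]
    simpa only [List.cons_append, List.nil_append, Nat.reduceAdd, rvBase] using
      link_trans (rvScaled_S n 10 14 11 14 9 19 12 9 15 12 13 10 18 11 7 rfl rfl rfl rfl (by decide)
          (by decide))
      (rvScaled_T n 9 15 12 13 10 18 11 16 19 13 rfl rfl rfl rfl)
      (rvScaled_S n 15 9 10 19 12 16 13 12 12 13 16 15 13 10 3 rfl rfl rfl rfl (by decide)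
          (by decide))
  · obtain ⟨A, b, hA, -⟩ := exists_zeta_of_rvScaled n 9 16 12 12 11 17 10 9 19
      (by decide) (by decide) (by decide) (by decide) (by decide)
      (by decide) (by decide) (by decide) (by decide) (by decide)
    refine ⟨A, b, ?_⟩
    rw [← hA]
    exact rvScaled_S n 10 14 11 14 9 19 12 9 16 12 12 11 17 10 7 rfl rfl rfl rfl (by decide)
        (by decide)
  · obtain ⟨A, b, hA, -⟩ := exists_zeta_of_rvScaled n 15 15 16 9 11 13 12 11 19
      (by decide) (by decide) (by decide) (by decide) (by decide)
      (by decide) (by decide) (by decide) (by decide) (by decide)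
    refine ⟨A, b, ?_⟩
    rw [← hA]
    simpa only [List.cons_append, List.nil_append, Nat.reduceAdd, rvBase] using
      link_trans (rvScaled_S n 10 14 11 14 9 19 12 9 16 12 12 11 17 10 7 rfl rfl rfl rfl (by decide)
          (by decide))
      (rvScaled_T n 9 16 12 12 11 17 10 16 19 15 rfl rfl rfl rfl)
      (rvScaled_S n 16 9 11 19 12 16 15 15 15 16 9 11 13 12 1 rfl rfl rfl rfl (by decide)
          (by decide))

theorem facProd_ne_zero (n : ℕ) (L : List ℕ) : facProd n L ≠ 0 := by
  rw [facProd, Ne, List.prod_eq_zero_iff]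
  simp [Nat.factorial_ne_zero]

theorem factorization_factorial_of_lt_sq {p m : ℕ} (hp : p.Prime) (hm : m < p ^ 2) :
    m.factorial.factorization p = m / p := by
  rcases eq_or_ne m 0 with rfl | h0
  · simp
  · rw [Nat.factorization_factorial hp (Nat.log_lt_of_lt_pow h0 hm)]
    simp

theorem factorization_facProd {n p : ℕ} (hp : p.Prime) (hpn : 19 * n < p ^ 2) (L : List ℕ)
    (hL : ∀ c ∈ L, c ≤ 19) :
    (facProd n L).factorization p = (L.map fun c => c * n / p).sum := by
  induction L with
  | nil => simp [facProd]
  | cons c L ih =>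
    have h1 : facProd n (c :: L) = (c * n).factorial * facProd n L := by simp [facProd]
    rw [h1, Nat.factorization_mul (Nat.factorial_ne_zero _) (facProd_ne_zero _ _),
      Finsupp.add_apply,
      ih fun x hx => hL x (List.mem_cons_of_mem _ hx), factorization_factorial_of_lt_sq hp
        (lt_of_le_of_lt (Nat.mul_le_mul_right n (hL c List.mem_cons_self)) hpn)]
    simp

/-- The exponent of `p` gained from one realization. -/
def gainOf (n p : ℕ) (L : List ℕ × List ℕ) : ℕ :=
  (L.2.map fun c => c * n / p).sum - (L.1.map fun c => c * n / p).sum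

/-- The exponent of `p` gained from all realizations. -/
def gainMax (n p : ℕ) : ℕ := (realizations.map (gainOf n p)).foldr max 0

theorem foldr_max_induction {α : Type*} (Q : ℕ → Prop) (f : α → ℕ) (L : List α) (h0 : Q 0)
    (h : ∀ x ∈ L, Q (f x)) : Q ((L.map f).foldr max 0) := by
  induction L with
  | nil => simpa using h0
  | cons a L ih =>
    rw [List.map_cons, List.foldr_cons]
    rcases max_choice (f a) ((L.map f).foldr max 0) with h1 | h1 <;> rw [h1]
    · exact h a List.mem_cons_self
    · exact ih fun x hx => h x (List.mem_cons_of_mem _ hx)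

theorem le_foldr_max {α : Type*} (f : α → ℕ) (L : List α) {x : α} (hx : x ∈ L) :
    f x ≤ (L.map f).foldr max 0 := by
  induction L with
  | nil => simp at hx
  | cons a L ih =>
    rw [List.map_cons, List.foldr_cons]
    rcases List.mem_cons.1 hx with rfl | h
    · exact le_max_left _ _
    · exact (ih h).trans (le_max_right _ _)

theorem pow_dvd_of_mul_eq {p N P x y g : ℕ} (hp : p.Prime) (hN : N ≠ 0) (hP : P ≠ 0)
    (h : x * N = y * P) (hg : g ≤ P.factorization p - N.factorization p) : p ^ g ∣ x := by
  rcases eq_or_ne x 0 with rfl | hx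
  · simp
  have hy : y ≠ 0 := by
    rintro rfl
    rw [zero_mul] at h
    rcases Nat.mul_eq_zero.1 h with h | h <;> contradiction
  rw [hp.pow_dvd_iff_le_factorization hx]
  have := congrArg (fun m => m.factorization p) h
  simp only [Nat.factorization_mul hx hN, Nat.factorization_mul hy hP, Finsupp.add_apply] at this
  omega

theorem coeff_eq_of_irrational {ζ : ℝ} (hζ : Irrational ζ) {A A' B B' : ℤ} {D D' N P : ℕ}
    (hD : D ≠ 0)
    (hD' : D' ≠ 0)
    (h : ((A : ℝ) * ζ - B / (D : ℝ) ^ 3) * N = ((A' : ℝ) * ζ - B' / (D' : ℝ) ^ 3) * P) :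
    A.natAbs * N = A'.natAbs * P ∧ B.natAbs * (N * D' ^ 3) = B'.natAbs * (P * D ^ 3) := by
  have hD0 : (D : ℝ) ≠ 0 := by exact_mod_cast hD
  have hD0' : (D' : ℝ) ≠ 0 := by exact_mod_cast hD'
  have h1 : A * N = A' * P := by
    by_contra hne
    have hne' : ((A * N - A' * P : ℤ) : ℝ) ≠ 0 := by exact_mod_cast sub_ne_zero.2 hne
    refine hζ.ne_rat ((B * N / D ^ 3 - B' * P / D' ^ 3) / (A * N - A' * P)) ?_
    push_cast at hne' ⊢
    rw [eq_div_iff hne']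
    linear_combination h
  have h1' : (A : ℝ) * N = A' * P := by exact_mod_cast h1
  have h2 : B * (N * D' ^ 3) = B' * (P * D ^ 3) := by
    have h3 : (B : ℝ) / (D : ℝ) ^ 3 * N = B' / (D' : ℝ) ^ 3 * P := by
      linear_combination ζ * h1' - h
    field_simp at h3
    have h4 : (B : ℝ) * (N * D' ^ 3) = B' * (P * D ^ 3) := by linear_combination h3
    exact_mod_cast h4
  constructor
  · have := congrArg Int.natAbs h1
    simpa only [Int.natAbs_mul, Int.natAbs_natCast] using this
  · have := congrArg Int.natAbs h2
    simpa only [Int.natAbs_mul, Int.natAbs_pow, Int.natAbs_natCast] using this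

theorem factorization_lcmUpto_eq_one {m p : ℕ} (hp : p.Prime) (h1 : p ≤ m) (h2 : m < p ^ 2) :
    (Nat.lcmUpto m).factorization p = 1 := by
  rw [Nat.factorization_lcmUpto _ hp, Nat.log_eq_one_iff]
  exact ⟨by rwa [← sq], hp.one_lt, h1⟩

/-- The primes that contribute to `gainProd`. -/
def gainPrimes (n : ℕ) : Finset ℕ := {p ∈ Finset.range (16 * n + 1) | p.Prime ∧ 19 * n < p ^ 2}

/-- The common factor of the coefficients of the linear forms. -/
def gainProd (n : ℕ) : ℕ := ∏ p ∈ gainPrimes n, p ^ gainMax n p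

theorem gainProd_dvd {n x : ℕ} (h : ∀ p ∈ gainPrimes n, ∀ L ∈ realizations, p ^ gainOf n p L ∣ x) :
    gainProd n ∣ x := by
  rw [← Int.natCast_dvd_natCast, gainProd, Nat.cast_prod]
  refine Finset.prod_dvd_of_coprime ?_ fun p hp => ?_
  · intro p hp q hq hpq
    have hp' := (Finset.mem_filter.1 hp).2.1
    have hq' := (Finset.mem_filter.1 hq).2.1
    simp only [Function.onFun]
    rw [Nat.isCoprime_iff_coprime]
    exact Nat.Coprime.pow _ _ ((Nat.coprime_primes hp' hq').2 hpq)
  · rw [Int.natCast_dvd_natCast]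
    exact foldr_max_induction (fun g => p ^ g ∣ x) _ _ (by simp) (h p hp)

theorem gainProd_dvd_coeff (hζ : Irrational (zetaR 3)) (n : ℕ) {A B : ℤ}
    (hAB : rvBase n = A * zetaR 3 - B / (Nat.lcmUpto (16 * n) : ℝ) ^ 3) :
    (gainProd n : ℤ) ∣ A ∧ (gainProd n : ℤ) ∣ B := by
  rw [Int.natCast_dvd, Int.natCast_dvd]
  have hle : ∀ L ∈ realizations, (∀ c ∈ L.1, c ≤ 19) ∧ ∀ c ∈ L.2, c ≤ 19 := by decide
  have key : ∀ p ∈ gainPrimes n, ∀ L ∈ realizations,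
      p ^ gainOf n p L ∣ A.natAbs ∧ p ^ gainOf n p L ∣ B.natAbs := by
    intro p hp L hL
    obtain ⟨A', B', h⟩ := exists_zeta_of_mem_realizations n L hL
    rw [hAB] at h
    obtain ⟨h1, h2⟩ := coeff_eq_of_irrational hζ (Nat.lcmUpto_ne_zero _) (Nat.lcmUpto_ne_zero _) h
    obtain ⟨hpm, hpp, hpn⟩ := Finset.mem_filter.1 hp
    have hpm' := Finset.mem_range_succ_iff.1 hpm
    have e1 := factorization_facProd hpp hpn L.1 (hle L hL).1
    have e2 := factorization_facProd hpp hpn L.2 (hle L hL).2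
    have d16 := factorization_lcmUpto_eq_one hpp hpm' (by omega)
    have d19 := factorization_lcmUpto_eq_one (m := 19 * n) hpp (by omega) hpn
    refine ⟨pow_dvd_of_mul_eq hpp (facProd_ne_zero _ _) (facProd_ne_zero _ _) h1 ?_,
      pow_dvd_of_mul_eq hpp (mul_ne_zero (facProd_ne_zero _ _)
          (pow_ne_zero _ (Nat.lcmUpto_ne_zero _)))
        (mul_ne_zero (facProd_ne_zero _ _) (pow_ne_zero _ (Nat.lcmUpto_ne_zero _))) h2 ?_⟩
    · rw [e1, e2, gainOf]
    · rw [Nat.factorization_mul (facProd_ne_zero _ _) (pow_ne_zero _ (Nat.lcmUpto_ne_zero _)),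
        Nat.factorization_mul (facProd_ne_zero _ _) (pow_ne_zero _ (Nat.lcmUpto_ne_zero _)),
        Nat.factorization_pow, Nat.factorization_pow]
      simp only [Finsupp.add_apply, Finsupp.smul_apply, e1, e2, d16, d19, gainOf]
      omega
  exact ⟨gainProd_dvd fun p hp L hL => (key p hp L hL).1, gainProd_dvd fun p hp L hL =>
      (key p hp L hL).2⟩

/-- A row of the gain table: for `n / p` with fractional part in `[a / b, a' / b')`, the exponent
of `p` gained is at least `g`. -/
structure GainRow where
  /-- numerator of the left endpoint -/
  a : ℕ
  /-- denominator of the left endpoint -/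
  b : ℕ
  /-- numerator of the right endpoint -/
  a' : ℕ
  /-- denominator of the right endpoint -/
  b' : ℕ
  /-- the gain -/
  g : ℕ

/-- The gain table. -/
def gainTable : List GainRow :=
  [⟨1, 19, 1, 18, 1⟩, ⟨1, 18, 1, 17, 2⟩, ⟨1, 17, 1, 16, 3⟩, ⟨1, 16, 1, 15, 2⟩, ⟨1, 15, 1, 14, 1⟩,
   ⟨1, 14, 1, 13, 2⟩, ⟨1, 13, 1, 12, 1⟩, ⟨2, 19, 1, 9, 1⟩, ⟨1, 9, 2, 17, 2⟩, ⟨2, 17, 1, 8, 3⟩,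
   ⟨1, 8, 2, 15, 2⟩, ⟨2, 15, 1, 7, 1⟩, ⟨1, 7, 2, 13, 2⟩, ⟨2, 13, 3, 19, 1⟩, ⟨3, 19, 1, 6, 1⟩,
   ⟨1, 6, 3, 17, 1⟩, ⟨3, 17, 2, 11, 1⟩, ⟨2, 11, 3, 16, 2⟩, ⟨3, 16, 1, 5, 1⟩, ⟨4, 19, 3, 14, 1⟩,
   ⟨3, 14, 2, 9, 2⟩, ⟨2, 9, 3, 13, 3⟩, ⟨3, 13, 4, 17, 2⟩, ⟨4, 17, 1, 4, 2⟩, ⟨5, 19, 4, 15, 1⟩,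
   ⟨2, 7, 5, 17, 1⟩, ⟨5, 17, 3, 10, 2⟩, ⟨3, 10, 4, 13, 3⟩, ⟨4, 13, 5, 16, 2⟩, ⟨5, 16, 6, 19, 1⟩,
   ⟨6, 19, 1, 3, 1⟩, ⟨6, 17, 5, 14, 1⟩, ⟨5, 14, 4, 11, 2⟩, ⟨4, 11, 7, 19, 2⟩, ⟨7, 19, 3, 8, 3⟩,
   ⟨3, 8, 5, 13, 2⟩, ⟨5, 13, 7, 18, 1⟩, ⟨7, 18, 2, 5, 1⟩, ⟨2, 5, 7, 17, 1⟩, ⟨7, 17, 5, 12, 1⟩,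
   ⟨8, 19, 3, 7, 1⟩, ⟨3, 7, 7, 16, 2⟩, ⟨7, 16, 4, 9, 1⟩, ⟨4, 9, 5, 11, 2⟩, ⟨5, 11, 6, 13, 2⟩,
   ⟨6, 13, 7, 15, 1⟩, ⟨8, 17, 9, 19, 1⟩, ⟨9, 19, 1, 2, 1⟩, ⟨1, 2, 10, 19, 1⟩, ⟨10, 19, 9, 17, 2⟩,
   ⟨9, 17, 8, 15, 2⟩, ⟨8, 15, 7, 13, 1⟩, ⟨6, 11, 5, 9, 1⟩, ⟨5, 9, 9, 16, 2⟩, ⟨9, 16, 4, 7, 1⟩,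
   ⟨4, 7, 11, 19, 2⟩, ⟨11, 19, 7, 12, 2⟩, ⟨7, 12, 10, 17, 1⟩, ⟨10, 17, 3, 5, 2⟩, ⟨3, 5, 11, 18, 1⟩,
   ⟨11, 18, 8, 13, 2⟩, ⟨8, 13, 5, 8, 1⟩, ⟨7, 11, 9, 14, 1⟩, ⟨9, 14, 11, 17, 2⟩, ⟨11, 17, 2, 3, 2⟩,
   ⟨2, 3, 13, 19, 1⟩, ⟨13, 19, 11, 16, 2⟩, ⟨11, 16, 9, 13, 1⟩, ⟨5, 7, 13, 18, 1⟩,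
       ⟨13, 18, 8, 11, 2⟩,
   ⟨8, 11, 11, 15, 3⟩, ⟨11, 15, 14, 19, 2⟩, ⟨14, 19, 3, 4, 2⟩, ⟨13, 17, 10, 13, 1⟩,
       ⟨7, 9, 11, 14, 1⟩,
   ⟨11, 14, 15, 19, 2⟩, ⟨15, 19, 4, 5, 2⟩, ⟨4, 5, 13, 16, 2⟩, ⟨13, 16, 9, 11, 1⟩,
       ⟨9, 11, 14, 17, 1⟩,
   ⟨14, 17, 5, 6, 2⟩, ⟨5, 6, 16, 19, 1⟩, ⟨16, 19, 11, 13, 2⟩, ⟨11, 13, 6, 7, 1⟩, ⟨6, 7, 13, 15, 2⟩,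
   ⟨13, 15, 7, 8, 1⟩, ⟨8, 9, 17, 19, 1⟩, ⟨17, 19, 9, 10, 1⟩, ⟨9, 10, 10, 11, 2⟩,
       ⟨10, 11, 11, 12, 3⟩,
   ⟨11, 12, 12, 13, 2⟩, ⟨12, 13, 13, 14, 1⟩, ⟨13, 14, 14, 15, 2⟩, ⟨14, 15, 15, 16, 1⟩]

/-- The condition that `L` realizes the gain of the row `r`. -/
def GainRow.Realized (r : GainRow) (L : List ℕ × List ℕ) : Prop :=
  (∀ c ∈ L.1 ++ L.2, 0 < c ∧ c * r.a' ≤ r.b' * (c * r.a / r.b + 1)) ∧ L.1.sum = L.2.sum ∧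
    (L.2.map fun c => c * r.a / r.b).sum = (L.1.map fun c => c * r.a / r.b).sum + r.g

instance (r : GainRow) (L : List ℕ × List ℕ) : Decidable (r.Realized L) :=
  inferInstanceAs (Decidable (_ ∧ _ ∧ _))

theorem gainTable_realized : ∀ r ∈ gainTable, ∃ L ∈ realizations, r.Realized L := by
  decide +kernel

/-- The condition that `n / p - k` lies in the interval of the row `r`. -/
def GainRow.Mem (r : GainRow) (k n p : ℕ) : Prop :=
  (k * r.b + r.a) * p ≤ r.b * n ∧ r.b' * n < (k * r.b' + r.a') * p

instance (r : GainRow) (k n p : ℕ) : Decidable (r.Mem k n p) :=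
  inferInstanceAs (Decidable (_ ∧ _))

theorem div_eq_of_mem {r : GainRow} {k n p c : ℕ} (h : r.Mem k n p) (hc : 0 < c) (hb : 0 < r.b)
    (hr : c * r.a' ≤ r.b' * (c * r.a / r.b + 1)) : c * n / p = c * k + c * r.a / r.b := by
  obtain ⟨h1, h2⟩ := h
  have hd : r.b * (c * r.a / r.b) ≤ c * r.a := Nat.mul_div_le _ _
  refine Nat.div_eq_of_lt_le ?_ ?_
  · refine Nat.le_of_mul_le_mul_left ?_ hb
    calc
      _ = (c * (k * r.b) + r.b * (c * r.a / r.b)) * p := by ring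
      _ ≤ (c * (k * r.b) + c * r.a) * p := by gcongr
      _ = c * ((k * r.b + r.a) * p) := by ring
      _ ≤ c * (r.b * n) := by gcongr
      _ = _ := by ring
  · refine Nat.lt_of_mul_lt_mul_left (a := r.b') ?_
    calc r.b' * (c * n) = c * (r.b' * n) := by ring
      _ < c * ((k * r.b' + r.a') * p) := by gcongr
      _ = (c * (k * r.b') + c * r.a') * p := by ring
      _ ≤ (c * (k * r.b') + r.b' * (c * r.a / r.b + 1)) * p := by gcongr
      _ = _ := by ring

theorem sum_map_div_eq_of_mem {r : GainRow} {k n p : ℕ} (h : r.Mem k n p) (hb : 0 < r.b)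
    (L : List ℕ)
    (hL : ∀ c ∈ L, 0 < c ∧ c * r.a' ≤ r.b' * (c * r.a / r.b + 1)) :
    (L.map fun c => c * n / p).sum = L.sum * k + (L.map fun c => c * r.a / r.b).sum := by
  induction L with
  | nil => simp
  | cons c L ih =>
    rw [List.map_cons, List.sum_cons, List.map_cons, List.sum_cons, List.sum_cons,
      ih fun x hx => hL x (List.mem_cons_of_mem _ hx),
      div_eq_of_mem h (hL c List.mem_cons_self).1 hb (hL c List.mem_cons_self).2]
    ring

theorem gainTable_pos : ∀ r ∈ gainTable, 0 < r.b ∧ 0 < r.b' ∧ 0 < r.a ∧ r.a * r.b' < r.a' * r.b ∧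
    r.a' ≤ r.b' := by
  decide +kernel

theorem gainTable_pairwise : gainTable.Pairwise fun r r' => r.a' * r'.b ≤ r'.a * r.b' := by
  decide +kernel

theorem le_gainMax_of_mem {r : GainRow} (hr : r ∈ gainTable) {k n p : ℕ} (h : r.Mem k n p) :
    r.g ≤ gainMax n p := by
  obtain ⟨L, hL, h1, h2, h3⟩ := gainTable_realized r hr
  obtain ⟨hb, -⟩ := gainTable_pos r hr
  refine le_trans ?_ (le_foldr_max (gainOf n p) realizations hL)
  rw [gainOf, sum_map_div_eq_of_mem h hb L.1 fun c hc => h1 c (List.mem_append_left _ hc),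
    sum_map_div_eq_of_mem h hb L.2 fun c hc => h1 c (List.mem_append_right _ hc), h2, h3]
  omega

theorem sum_map_le_of_pairwise {α : Type*} (f : α → ℕ) (m : ℕ) (L : List α) (hm : ∀ x ∈ L, f x ≤ m)
    (h : L.Pairwise fun x y => f x = 0 ∨ f y = 0) : (L.map f).sum ≤ m := by
  induction L with
  | nil => simp
  | cons a L ih =>
    rw [List.map_cons, List.sum_cons]
    obtain ⟨h1, h2⟩ := List.pairwise_cons.1 h
    rcases Nat.eq_zero_or_pos (f a) with h0 | h0
    · rw [h0, zero_add]
      exact ih (fun x hx => hm x (List.mem_cons_of_mem _ hx)) h2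
    · have : (L.map f).sum = 0 := by
        rw [List.sum_eq_zero_iff]
        intro x hx
        obtain ⟨y, hy, rfl⟩ := List.mem_map.1 hx
        exact (h1 y hy).resolve_left h0.ne'
      rw [this, add_zero]
      exact hm a List.mem_cons_self

/-- The rows used for a given integral part. -/
def GainRow.Used (r : GainRow) (k : ℕ) : Prop := r.b ≤ 16 * (k * r.b + r.a)

instance (r : GainRow) (k : ℕ) : Decidable (r.Used k) := inferInstanceAs (Decidable (_ ≤ _))

theorem sum_gain_le (K n p : ℕ) :
    ∑ k ∈ Finset.range K, (gainTable.map fun r => if r.Mem k n p then r.g else 0).sum ≤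
      gainMax n p := by
  rcases Nat.eq_zero_or_pos p with rfl | hp
  · rw [Finset.sum_eq_zero]
    · exact Nat.zero_le _
    · intro k _
      rw [List.sum_eq_zero_iff]
      intro x hx
      obtain ⟨r, hr, rfl⟩ := List.mem_map.1 hx
      rw [if_neg]
      rintro ⟨-, h⟩
      simp at h
  have hk : ∀ k ∈ Finset.range K, k ≠ n / p →
      (gainTable.map fun r => if r.Mem k n p then r.g else 0).sum = 0 := by
    intro k _ hne
    rw [List.sum_eq_zero_iff]
    intro x hx
    obtain ⟨r, hr, rfl⟩ := List.mem_map.1 hx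
    rw [if_neg]
    rintro ⟨h1, h2⟩
    obtain ⟨hb, hb', -, -, ha'⟩ := gainTable_pos r hr
    refine hne (Nat.div_eq_of_lt_le ?_ ?_).symm
    · refine Nat.le_of_mul_le_mul_left ?_ hb
      calc r.b * (k * p) = (k * r.b) * p := by ring
        _ ≤ (k * r.b + r.a) * p := by gcongr; omega
        _ ≤ _ := h1
    · refine Nat.lt_of_mul_lt_mul_left (a := r.b') ?_
      calc r.b' * n < (k * r.b' + r.a') * p := h2
        _ ≤ (k * r.b' + r.b') * p := by gcongr
        _ = _ := by ring
  have hrow : ∀ k, (gainTable.map fun r => if r.Mem k n p then r.g else 0).sum ≤ gainMax n p := by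
    intro k
    refine sum_map_le_of_pairwise _ _ _ (fun r hr => ?_) (gainTable_pairwise.imp_of_mem ?_)
    · split_ifs with h
      · exact le_gainMax_of_mem hr h
      · exact Nat.zero_le _
    · intro r r' hr hr' h
      by_contra! hne
      obtain ⟨m1, m2⟩ := hne
      have h1 : r.Mem k n p := by by_contra hc; exact m1 (if_neg hc)
      have h2 : r'.Mem k n p := by by_contra hc; exact m2 (if_neg hc)
      obtain ⟨hb, hb', -⟩ := gainTable_pos r hr
      obtain ⟨hb2, hb2', -⟩ := gainTable_pos r' hr'
      have e1 := h1.2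
      have e2 := h2.1
      refine absurd (Nat.mul_lt_mul_of_pos_left e1 hb2) (not_lt.2 ?_)
      calc r'.b * ((k * r.b' + r.a') * p) = (k * r.b' * r'.b + r.a' * r'.b) * p := by ring
        _ ≤ (k * r.b' * r'.b + r'.a * r.b') * p := by gcongr
        _ = r.b' * ((k * r'.b + r'.a) * p) := by ring
        _ ≤ r.b' * (r'.b * n) := by gcongr
        _ = _ := by ring
  by_cases hmem : n / p ∈ Finset.range K
  · rw [Finset.sum_eq_single_of_mem _ hmem hk]
    exact hrow _
  · rw [Finset.sum_eq_zero]
    · exact Nat.zero_le _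
    · intro k hk'
      exact hk k hk' (fun h => hmem (h ▸ hk'))

theorem theta_le_add_sum {n k : ℕ} {r : GainRow} (hr : r ∈ gainTable) (hu : r.Used k) {K : ℕ}
    (hkK : k < K) (hn : 19 * K ^ 2 < n) :
    Chebyshev.theta (n * (r.b / (k * r.b + r.a))) ≤ Chebyshev.theta
        (n * (r.b' / (k * r.b' + r.a'))) +
      ∑ p ∈ gainPrimes n, if r.Mem k n p then log p else 0 := by
  obtain ⟨hb, hb', ha, haa, ha'⟩ := gainTable_pos r hr
  have hpb : (0 : ℝ) < k * r.b + r.a := by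
    have : (0 : ℝ) < r.a := by exact_mod_cast ha
    positivity
  have ha'0 : 0 < r.a' := by
    rcases Nat.eq_zero_or_pos r.a' with h | h
    · rw [h] at haa; omega
    · exact h
  have hpb' : (0 : ℝ) < k * r.b' + r.a' := by
    have : (0 : ℝ) < r.a' := by exact_mod_cast ha'0
    positivity
  rw [← Finset.sum_filter]
  unfold Chebyshev.theta
  set x := (n : ℝ) * (r.b' / (k * r.b' + r.a')) with hx
  set y := (n : ℝ) * (r.b / (k * r.b + r.a)) with hy
  have hx0 : 0 ≤ x := by positivity
  have hy0 : 0 ≤ y := by positivity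
  have hlog : ∀ p : ℕ, 0 ≤ log (p : ℝ) := fun p => Real.log_natCast_nonneg p
  rw [← Finset.sum_filter_add_sum_filter_not _ (fun p : ℕ => p ≤ ⌊x⌋₊)]
  refine add_le_add (Finset.sum_le_sum_of_subset_of_nonneg ?_ fun p _ _ => hlog p)
    (Finset.sum_le_sum_of_subset_of_nonneg ?_ fun p _ _ => hlog p)
  · intro p hp
    simp only [Finset.mem_filter, Finset.mem_Ioc] at hp ⊢
    exact ⟨⟨hp.1.1.1, hp.2⟩, hp.1.2⟩
  · intro p hp
    simp only [Finset.mem_filter, Finset.mem_Ioc, not_le] at hp ⊢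
    obtain ⟨⟨⟨hp0, hpy⟩, hpr⟩, hxp⟩ := hp
    rw [Nat.le_floor_iff hy0, hy, ← mul_div_assoc, le_div_iff₀ hpb] at hpy
    rw [Nat.floor_lt hx0, hx, ← mul_div_assoc, div_lt_iff₀ hpb'] at hxp
    have h1 : (k * r.b + r.a) * p ≤ r.b * n := by
      have : ((k * r.b + r.a) * p : ℝ) ≤ r.b * n := by linarith
      exact_mod_cast this
    have h2 : r.b' * n < (k * r.b' + r.a') * p := by
      have : (r.b' * n : ℝ) < (k * r.b' + r.a') * p := by linarith
      exact_mod_cast this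
    refine ⟨?_, h1, h2⟩
    rw [gainPrimes, Finset.mem_filter, Finset.mem_range]
    refine ⟨?_, hpr, ?_⟩
    · have : r.b * p ≤ r.b * (16 * n) := by
        calc r.b * p ≤ 16 * (k * r.b + r.a) * p := by gcongr; exact hu
          _ = 16 * ((k * r.b + r.a) * p) := by ring
          _ ≤ 16 * (r.b * n) := by gcongr
          _ = _ := by ring
      have := Nat.le_of_mul_le_mul_left this hb
      omega
    · have h3 : n < K * p := by
        refine Nat.lt_of_mul_lt_mul_left (a := r.b') ?_
        calc r.b' * n < (k * r.b' + r.a') * p := h2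
          _ ≤ (k * r.b' + r.b') * p := by gcongr
          _ = r.b' * ((k + 1) * p) := by ring
          _ ≤ r.b' * (K * p) := by gcongr; omega
      have h4 : n * n < (K * p) * (K * p) := Nat.mul_lt_mul'' h3 h3
      by_contra! hc
      have h5 : K ^ 2 * p ^ 2 ≤ K ^ 2 * (19 * n) := by gcongr
      have h6 : 19 * K ^ 2 * n ≤ n * n := by gcongr
      nlinarith

theorem sum_theta_le_log_gainProd {n K : ℕ} (hn : 19 * K ^ 2 < n) :
    ∑ k ∈ Finset.range K, (gainTable.map fun r => if r.Used k then
      (r.g : ℝ) * (Chebyshev.theta (n * (r.b / (k * r.b + r.a))) -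
        Chebyshev.theta (n * (r.b' / (k * r.b' + r.a')))) else 0).sum ≤ log (gainProd n) := by
  have hlog : ∀ p : ℕ, 0 ≤ log (p : ℝ) := fun p => Real.log_natCast_nonneg p
  have h1 : log (gainProd n : ℝ) = ∑ p ∈ gainPrimes n, (gainMax n p : ℝ) * log p := by
    rw [gainProd, Nat.cast_prod, Real.log_prod]
    · refine Finset.sum_congr rfl fun p _ => ?_
      rw [Nat.cast_pow, Real.log_pow]
    · intro p hp
      have := (Finset.mem_filter.1 hp).2.1.pos
      positivity
  have h2 : ∑ k ∈ Finset.range K, (gainTable.map fun r =>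
      ∑ p ∈ gainPrimes n, if r.Mem k n p then (r.g : ℝ) * log p else 0).sum ≤ log (gainProd n) := by
    rw [h1]
    have : ∀ k, (gainTable.map fun r =>
        ∑ p ∈ gainPrimes n, if r.Mem k n p then (r.g : ℝ) * log p else 0).sum =
        ∑ p ∈ gainPrimes n, ((gainTable.map fun r => if r.Mem k n p then r.g else 0).sum : ℕ) *
          log (p : ℝ) := by
      intro k
      induction gainTable with
      | nil => simp
      | cons r L ih =>
        simp only [List.map_cons, List.sum_cons, ih, Nat.cast_add, add_mul, Finset.sum_add_distrib]
        congr 1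
        refine Finset.sum_congr rfl fun p _ => ?_
        split_ifs <;> simp
    rw [Finset.sum_congr rfl fun k _ => this k, Finset.sum_comm]
    refine Finset.sum_le_sum fun p _ => ?_
    rw [← Finset.sum_mul, ← Nat.cast_sum]
    exact mul_le_mul_of_nonneg_right (by exact_mod_cast sum_gain_le K n p) (hlog p)
  refine le_trans (Finset.sum_le_sum fun k hk => ?_) h2
  refine List.sum_le_sum fun r hr => ?_
  split_ifs with hu
  · have := theta_le_add_sum hr hu (Finset.mem_range.1 hk) hn
    calc (r.g : ℝ) * _ ≤ r.g * ∑ p ∈ gainPrimes n, (if r.Mem k n p then log (p : ℝ) else 0) := by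
          gcongr; linarith
      _ = _ := by rw [Finset.mul_sum]; exact Finset.sum_congr rfl fun p _ => by split_ifs <;> simp
  · refine Finset.sum_nonneg fun p _ => ?_
    split_ifs
    exacts [mul_nonneg (Nat.cast_nonneg _) (hlog p), le_rfl]

theorem eventually_log_gainProd (K : ℕ) {c : ℝ}
    (hc : c < ∑ k ∈ Finset.range K, (gainTable.map fun r => if r.Used k then
      (r.g : ℝ) * (r.b / (k * r.b + r.a) - r.b' / (k * r.b' + r.a')) else 0).sum) :
    ∀ᶠ n : ℕ in atTop, c * n ≤ log (gainProd n) := by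
  have hθ : ∀ v : ℝ, 0 ≤ v → Tendsto (fun n : ℕ => Chebyshev.theta (n * v) / n) atTop (𝓝 v) := by
    intro v hv
    rcases hv.eq_or_lt with rfl | hv
    · simp
    have h := (tendsto_theta_div.comp
      (tendsto_natCast_atTop_atTop.atTop_mul_const hv)).mul_const v
    rw [one_mul] at h
    refine h.congr fun n => ?_
    simp only [Function.comp]
    field_simp
  have hlist : ∀ (k : ℕ) (L : List GainRow), Tendsto (fun n : ℕ => (L.map fun r => if r.Used k then
      (r.g : ℝ) * (Chebyshev.theta (n * (r.b / (k * r.b + r.a))) -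
        Chebyshev.theta (n * (r.b' / (k * r.b' + r.a')))) else 0).sum / (n : ℝ)) atTop
      (𝓝 (L.map fun r => if r.Used k then
      (r.g : ℝ) * (r.b / (k * r.b + r.a) - r.b' / (k * r.b' + r.a')) else 0).sum) := by
    intro k L
    induction L with
    | nil => simp
    | cons r L ih =>
      simp only [List.map_cons, List.sum_cons, add_div]
      refine Tendsto.add ?_ ih
      split_ifs
      · have h := ((hθ (r.b / (k * r.b + r.a)) (by positivity)).sub
          (hθ (r.b' / (k * r.b' + r.a')) (by positivity))).const_mul (r.g : ℝ)
        refine h.congr fun n => ?_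
        ring
      · simp
  have hT := tendsto_finsetSum (Finset.range K) fun k _ => hlist k gainTable
  filter_upwards [hT.eventually (lt_mem_nhds hc), eventually_gt_atTop (19 * K ^ 2)] with n h1 h2
  have h0 : (0 : ℝ) < n := by exact_mod_cast (Nat.zero_le _).trans_lt h2
  rw [← Finset.sum_div, lt_div_iff₀ h0] at h1
  exact h1.le.trans (sum_theta_le_log_gainProd h2)

theorem gainTable_sum_sub :
    (gainTable.map fun r => (r.g : ℝ) * (r.a' / r.b' - r.a / r.b)).sum = 15991 / 14535 := by
  norm_num [gainTable]

theorem gainTable_sum_sq :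
    (gainTable.map fun r => (r.g : ℝ) * ((r.a' / r.b' : ℝ) ^ 2 - (r.a / r.b : ℝ) ^ 2)).sum ≤
        15991 / 14535 := by
  norm_num [gainTable]

/-- The contribution to `log (gainProd n) / n` of the primes `p` with `⌊n / p⌋ = k`. -/
noncomputable def gainDensity (k : ℕ) : ℝ :=
  (gainTable.map fun r => if r.Used k then
      (r.g : ℝ) * (r.b / (k * r.b + r.a) - r.b' / (k * r.b' + r.a')) else 0).sum

theorem sum_floor_gain_le : 1897010255396 ≤ ∑ k ∈ Finset.range 60, (gainTable.map fun r =>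
    if r.Used k then (10 ^ 11 * (r.g * (r.a' * r.b - r.a * r.b'))) /
      ((k * r.b + r.a) * (k * r.b' + r.a')) else 0).sum := by
  decide +kernel

theorem sum_gainDensity_ge : (18.97010255396 : ℝ) ≤ ∑ k ∈ Finset.range 60, gainDensity k := by
  have key : ∀ k, ((gainTable.map fun r =>
      if r.Used k then (10 ^ 11 * (r.g * (r.a' * r.b - r.a * r.b'))) /
        ((k * r.b + r.a) * (k * r.b' + r.a')) else 0).sum : ℕ) ≤ (10 : ℝ) ^ 11 * gainDensity k := by
    intro k
    rw [gainDensity, Nat.cast_list_sum, ← List.sum_map_mul_left, List.map_map]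
    refine List.sum_le_sum fun r hr => ?_
    obtain ⟨hb, hb', ha, haa, ha'⟩ := gainTable_pos r hr
    have h0 : 0 < r.a' := by
      rcases Nat.eq_zero_or_pos r.a' with h | h
      · rw [h] at haa; omega
      · exact h
    simp only [Function.comp]
    split_ifs
    · refine Nat.cast_div_le.trans (le_of_eq ?_)
      have e1 : (0 : ℝ) < k * r.b + r.a := by
        have : (0 : ℝ) < r.a := by exact_mod_cast ha
        positivity
      have e2 : (0 : ℝ) < k * r.b' + r.a' := by
        have : (0 : ℝ) < r.a' := by exact_mod_cast h0
        positivity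
      push_cast [Nat.cast_sub haa.le]
      field_simp
      ring
    · simp
  have h := Finset.sum_le_sum fun k (_ : k ∈ Finset.range 60) => key k
  rw [← Finset.mul_sum, ← Nat.cast_sum] at h
  have h2 : (1897010255396 : ℝ) ≤ _ := (by exact_mod_cast sum_floor_gain_le : (1897010255396 : ℝ) ≤
    ((∑ k ∈ Finset.range 60, (gainTable.map fun r =>
    if r.Used k then (10 ^ 11 * (r.g * (r.a' * r.b - r.a * r.b'))) /
      ((k * r.b + r.a) * (k * r.b' + r.a')) else 0).sum : ℕ) : ℝ)).trans h
  linarith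

theorem inv_sub_inv_ge {X s t : ℝ} (hs : 0 < X + s) (ht : 0 < X + t) (hst : s ≤ t) (hX : 0 < X) :
    (t - s) / X ^ 2 - (t ^ 2 - s ^ 2) / X ^ 3 ≤ 1 / (X + s) - 1 / (X + t) := by
  have h : 1 / (X + s) - 1 / (X + t) - ((t - s) / X ^ 2 - (t ^ 2 - s ^ 2) / X ^ 3) =
      (t - s) * (X * (s ^ 2 + s * t + t ^ 2) + s * t * (s + t)) / ((X + s) * (X + t) * X ^ 3) := by
    field_simp
    ring
  have h2 : 0 ≤ X * (s ^ 2 + s * t + t ^ 2) + s * t * (s + t) := by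
    nlinarith [mul_nonneg (sq_nonneg s) ht.le, mul_nonneg (sq_nonneg t) hs.le,
      mul_nonneg hX.le (sq_nonneg (s + t)), mul_pos hs ht, mul_nonneg (sq_nonneg (s+t)) hs.le,
          mul_nonneg (sq_nonneg (s+t)) ht.le]
  have h3 : 0 ≤ 1 / (X + s) - 1 / (X + t) - ((t - s) / X ^ 2 - (t ^ 2 - s ^ 2) / X ^ 3) := by
    rw [h]
    have := sub_nonneg.2 hst
    positivity
  linarith

theorem gainDensity_ge {k : ℕ} (hk : 1 ≤ k) : (15991 / 14535 : ℝ) / (k + 1 / 2) ^ 2 ≤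
    gainDensity k := by
  set X : ℝ := k + 1 / 2 with hX
  have hX0 : 0 < X := by positivity
  have h1 : (gainTable.map fun r => (r.g : ℝ) * (r.a' / r.b' - r.a / r.b) *
      (1 / X ^ 2 + 1 / X ^ 3) -
      (r.g : ℝ) * ((r.a' / r.b' : ℝ) ^ 2 - (r.a / r.b : ℝ) ^ 2) * (1 / X ^ 3)).sum ≤
          gainDensity k := by
    refine List.sum_le_sum fun r hr => ?_
    obtain ⟨hb, hb', ha, haa, ha'⟩ := gainTable_pos r hr
    have hu : r.Used k := by
      unfold GainRow.Used
      nlinarith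
    rw [if_pos hu]
    have hb0 : (0 : ℝ) < r.b := by exact_mod_cast hb
    have hb0' : (0 : ℝ) < r.b' := by exact_mod_cast hb'
    have hk' : (1 : ℝ) ≤ k := by exact_mod_cast hk
    have hp : (0 : ℝ) ≤ r.a / r.b := by positivity
    have hp' : (0 : ℝ) ≤ r.a' / r.b' := by positivity
    have := inv_sub_inv_ge (X := X) (s := r.a / r.b - 1 / 2) (t := r.a' / r.b' - 1 / 2)
      (by linarith) (by linarith) (by
        have : (r.a / r.b : ℝ) ≤ r.a' / r.b' := by
          rw [div_le_div_iff₀ hb0 hb0']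
          exact_mod_cast haa.le
        linarith) hX0
    calc _ = r.g * ((r.a' / r.b' - 1 / 2 - (r.a / r.b - 1 / 2) : ℝ) / X ^ 2 -
          ((r.a' / r.b' - 1 / 2 : ℝ) ^ 2 - (r.a / r.b - 1 / 2 : ℝ) ^ 2) / X ^ 3) := by ring
      _ ≤ _ := by
        refine mul_le_mul_of_nonneg_left (this.trans (le_of_eq ?_)) (Nat.cast_nonneg _)
        have e1 : X + ((r.a : ℝ) / r.b - 1 / 2) = (k * r.b + r.a) / r.b := by
          rw [hX]; field_simp; ring
        have e2 : X + ((r.a' : ℝ) / r.b' - 1 / 2) = (k * r.b' + r.a') / r.b' := by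
          rw [hX]; field_simp; ring
        rw [e1, e2, one_div_div, one_div_div]
  have hsub : ∀ (f g : GainRow → ℝ) (c d : ℝ) (L : List GainRow),
      (L.map fun r => f r * c - g r * d).sum = (L.map f).sum * c - (L.map g).sum * d := by
    intro f g c d L
    induction L with
    | nil => simp
    | cons r L ih => simp only [List.map_cons, List.sum_cons, ih]; ring
  rw [hsub, gainTable_sum_sub] at h1
  refine le_trans ?_ h1
  have := mul_le_mul_of_nonneg_right gainTable_sum_sq (by positivity : 0 ≤ 1 / X ^ 3)
  rw [div_eq_mul_one_div _ (X ^ 2)]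
  linarith

theorem sum_gainDensity_ge' (m : ℕ) : (18.97010255396 : ℝ) +
    15991 / 14535 * (1 / (60 + 1 / 480) - 1 / (60 + m + 1 / 480)) ≤
      ∑ k ∈ Finset.range (60 + m), gainDensity k := by
  induction m with
  | zero => simpa using sum_gainDensity_ge
  | succ m ih =>
    rw [← add_assoc, Finset.sum_range_succ]
    have h := gainDensity_ge (k := 60 + m) (by omega)
    have h2 : 1 / (60 + m + 1 / 480 : ℝ) - 1 / (60 + (m + 1) + 1 / 480) ≤
        1 / (60 + m + 1 / 2) ^ 2 := by
      rw [div_sub_div _ _ (by positivity) (by positivity), div_le_div_iff₀ (by positivity)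
        (by positivity)]
      have : (0 : ℝ) ≤ m := m.cast_nonneg
      nlinarith
    push_cast at h ⊢
    rw [div_eq_mul_one_div] at h
    nlinarith

theorem eventually_log_gainProd_ge :
    ∀ᶠ n : ℕ in atTop, (18.988437 : ℝ) * n ≤ log (gainProd n) := by
  refine eventually_log_gainProd (60 + 10 ^ 7) (lt_of_lt_of_le ?_ (sum_gainDensity_ge' (10 ^ 7)))
  norm_num

/-- The function whose powers are integrated in `rvScaled`. -/
noncomputable def rvKer (h l k s j q e : ℕ) (x y z : ℝ) : ℝ :=
  x ^ h * (1 - x) ^ l * (y ^ k * (1 - y) ^ s) * (z ^ j * (1 - z) ^ q) /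
    (1 - (1 - x * y) * z) ^ e

theorem rvDenom_mem {x y z : ℝ} (hx : x ∈ Ioo (0 : ℝ) 1) (hy : y ∈ Ioo (0 : ℝ) 1)
    (hz : z ∈ Ioo (0 : ℝ) 1) : 1 - (1 - x * y) * z ∈ Ioo (0 : ℝ) 1 := by
  have h1 : 0 < x * y := mul_pos hx.1 hy.1
  have h2 : x * y < 1 := by nlinarith [hx.1, hx.2, hy.1, hy.2]
  have h3 : 0 < (1 - x * y) * z := mul_pos (by linarith) hz.1
  have h4 : (1 - x * y) * z < 1 := by nlinarith [hz.1, hz.2]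
  exact ⟨by linarith, by linarith⟩

theorem rvKer_pos (h l k s j q e : ℕ) {x y z : ℝ} (hx : x ∈ Ioo (0 : ℝ) 1)
    (hy : y ∈ Ioo (0 : ℝ) 1) (hz : z ∈ Ioo (0 : ℝ) 1) : 0 < rvKer h l k s j q e x y z := by
  have hD := (rvDenom_mem hx hy hz).1
  have := sub_pos.2 hx.2
  have := sub_pos.2 hy.2
  have := sub_pos.2 hz.2
  have := hx.1
  have := hy.1
  have := hz.1
  unfold rvKer
  positivity

theorem rvFun_eq_rvKer_pow (n h l k s j q e : ℕ) {x y z : ℝ} :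
    rvFun (h * n) (l * n) (k * n) (s * n) (j * n) (q * n) (e * n) x y z =
      rvKer h l k s j q e x y z ^ n / (1 - (1 - x * y) * z) := by
  simp only [rvFun, rvKer, pow_mul, div_pow, mul_pow, pow_succ, div_div]

theorem rvScaled_le {h l k s j q e : ℕ} {C : ℝ}
    (hC : ∀ x ∈ Ioo (0 : ℝ) 1, ∀ y ∈ Ioo (0 : ℝ) 1, ∀ z ∈ Ioo (0 : ℝ) 1,
      rvKer h l k s j q e x y z ≤ C ∧ rvKer h l k s j q e x y z ≤ 1 - (1 - x * y) * z) (n : ℕ) :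
    rvScaled (n + 1) h l k s j q e ≤ C ^ n := by
  have h2 : (1 / 2 : ℝ) ∈ Ioo (0 : ℝ) 1 := by constructor <;> norm_num
  have hC0 : 0 ≤ C := (rvKer_pos h l k s j q e h2 h2 h2).le.trans (hC _ h2 _ h2 _ h2).1
  have hv : volume (Ioo (0 : ℝ) 1) = 1 := by simp
  have hb : ∀ (f : ℝ → ENNReal) (c : ENNReal), (∀ x ∈ Ioo (0 : ℝ) 1, f x ≤ c) →
      ∫⁻ x in Ioo (0 : ℝ) 1, f x ≤ c := by
    intro f c hf
    refine (setLIntegral_mono measurable_const hf).trans ?_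
    rw [setLIntegral_const, hv, mul_one]
  refine ENNReal.toReal_le_of_le_ofReal (by positivity) ?_
  refine hb _ _ fun y hy => hb _ _ fun z hz => hb _ _ fun x hx => ENNReal.ofReal_le_ofReal ?_
  rw [rvFun_eq_rvKer_pow, pow_succ, mul_div_assoc]
  have hK := rvKer_pos h l k s j q e hx hy hz
  have hD := (rvDenom_mem hx hy hz).1
  obtain ⟨h1, h2⟩ := hC x hx y hy z hz
  calc _ ≤ C ^ n * 1 := by
        gcongr
        exact (div_le_one hD).2 h2
    _ = _ := mul_one _

theorem rvLint_scaled_ne_top (n : ℕ) {h l k s j q e : ℕ} (hls : l + s = j + q) (hq : e ≤ q) :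
    rvLint (h * n) (l * n) (k * n) (s * n) (j * n) (q * n) (e * n) ≠ ⊤ := by
  obtain ⟨d, rfl⟩ := Nat.exists_eq_add_of_le hq
  have := (hasSum_integral_rvSqTerm (h * n) (l * n) (k * n) (s * n) (j * n) (d * n) (e * n)
    (by rw [← add_mul, ← add_mul, ← add_mul, hls, add_assoc])).2.1
  rwa [← add_mul] at this

theorem exists_le_rvScaled {h l k s j q e : ℕ} (hls : l + s = j + q) (hq : e ≤ q) {x₀ y₀ z₀ c : ℝ}
    (hx : x₀ ∈ Ioo (0 : ℝ) 1) (hy : y₀ ∈ Ioo (0 : ℝ) 1) (hz : z₀ ∈ Ioo (0 : ℝ) 1)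
    (hc : c < rvKer h l k s j q e x₀ y₀ z₀) (hc0 : 0 ≤ c) :
    ∃ δ > 0, ∀ n, δ * c ^ n ≤ rvScaled n h l k s j q e := by
  have hcont : ContinuousAt (fun p : ℝ × ℝ × ℝ => rvKer h l k s j q e p.1 p.2.1 p.2.2) (x₀, y₀,
      z₀) := by
    unfold rvKer
    refine ContinuousAt.div (by fun_prop) (by fun_prop) ?_
    exact pow_ne_zero _ (rvDenom_mem hx hy hz).1.ne'
  have h1 : ∀ᶠ p : ℝ × ℝ × ℝ in 𝓝 (x₀, y₀, z₀), c < rvKer h l k s j q e p.1 p.2.1 p.2.2 :=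
    hcont.eventually (lt_mem_nhds hc)
  have h2 : ∀ᶠ p : ℝ × ℝ × ℝ in 𝓝 (x₀, y₀, z₀), p ∈ Ioo (0 : ℝ) 1 ×ˢ
      (Ioo (0 : ℝ) 1 ×ˢ Ioo (0 : ℝ) 1) :=
    (isOpen_Ioo.prod (isOpen_Ioo.prod isOpen_Ioo)).mem_nhds ⟨hx, hy, hz⟩
  obtain ⟨ε, hε, hball⟩ := Metric.eventually_nhds_iff.1 (h1.and h2)
  have hmem : ∀ x ∈ Ioo (x₀ - ε) (x₀ + ε), ∀ y ∈ Ioo (y₀ - ε) (y₀ + ε), ∀ z ∈ Ioo (z₀ - ε) (z₀ + ε),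
      c < rvKer h l k s j q e x y z ∧ x ∈ Ioo (0 : ℝ) 1 ∧ y ∈ Ioo (0 : ℝ) 1 ∧
          z ∈ Ioo (0 : ℝ) 1 := by
    intro x hx y hy z hz
    have hd : ∀ {u v : ℝ}, u ∈ Ioo (v - ε) (v + ε) → dist u v < ε := by
      intro u v hu
      rw [Real.dist_eq, abs_lt]
      exact ⟨by linarith [hu.1], by linarith [hu.2]⟩
    have := hball (y := (x, y, z)) (by
      simp only [Prod.dist_eq, max_lt_iff]
      exact ⟨hd hx, hd hy, hd hz⟩)
    exact ⟨this.1, this.2.1, this.2.2.1, this.2.2.2⟩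
  have hself : ∀ v : ℝ, v ∈ Ioo (v - ε) (v + ε) := fun v => ⟨by linarith, by linarith⟩
  have hb : ∀ (v : ℝ) (f : ℝ → ENNReal) (c : ENNReal), Ioo (v - ε) (v + ε) ⊆ Ioo 0 1 →
      (∀ x ∈ Ioo (v - ε) (v + ε), c ≤ f x) → c * ENNReal.ofReal (2 * ε) ≤ ∫⁻ x in Ioo (0 : ℝ) 1,
          f x := by
    intro v f c hv hf
    refine le_trans ?_ (lintegral_mono_set hv)
    refine le_trans (le_of_eq ?_) (setLIntegral_mono' measurableSet_Ioo hf)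
    rw [setLIntegral_const, Real.volume_Ioo]
    ring_nf
  refine ⟨(2 * ε) ^ 3, by positivity, fun n => ?_⟩
  refine (ENNReal.ofReal_le_iff_le_toReal (rvLint_scaled_ne_top n hls hq)).1 ?_
  have hprod : ENNReal.ofReal ((2 * ε) ^ 3 * c ^ n) = ENNReal.ofReal (c ^ n) *
      ENNReal.ofReal (2 * ε) *
      ENNReal.ofReal (2 * ε) * ENNReal.ofReal (2 * ε) := by
    rw [← ENNReal.ofReal_mul (by positivity), ← ENNReal.ofReal_mul (by positivity),
      ← ENNReal.ofReal_mul (by positivity)]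
    ring_nf
  rw [hprod]
  refine hb y₀ _ _ (fun y hy => (hmem x₀ (hself _) y hy z₀ (hself _)).2.2.1) fun y hy => ?_
  refine hb z₀ _ _ (fun z hz => (hmem x₀ (hself _) y hy z hz).2.2.2) fun z hz => ?_
  refine hb x₀ _ _ (fun x hx => (hmem x hx y hy z hz).2.1) fun x hx => ?_
  refine ENNReal.ofReal_le_ofReal ?_
  obtain ⟨m1, m2, m3, m4⟩ := hmem x hx y hy z hz
  have hD := rvDenom_mem m2 m3 m4
  rw [rvFun_eq_rvKer_pow, le_div_iff₀ hD.1]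
  calc c ^ n * _ ≤ c ^ n * 1 := by gcongr; exact hD.2.le
    _ = c ^ n := mul_one _
    _ ≤ _ := by gcongr

theorem mul_log_add_mul_log_one_sub_le {α β t : ℝ} (hα : 0 < α) (hβ : 0 < β)
    (ht : t ∈ Ioo (0 : ℝ) 1) :
    α * log t + β * log (1 - t) ≤ α * log α + β * log β - (α + β) * log (α + β) := by
  have ht1 : 0 < 1 - t := sub_pos.2 ht.2
  have hs : 0 < α + β := add_pos hα hβ
  have h1 := Real.log_le_sub_one_of_pos (x := t * (α + β) / α) (div_pos (mul_pos ht.1 hs) hα)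
  have h2 := Real.log_le_sub_one_of_pos (x := (1 - t) * (α + β) / β) (div_pos (mul_pos ht1 hs) hβ)
  rw [Real.log_div (mul_pos ht.1 hs).ne' hα.ne', Real.log_mul ht.1.ne' hs.ne'] at h1
  rw [Real.log_div (mul_pos ht1 hs).ne' hβ.ne', Real.log_mul ht1.ne' hs.ne'] at h2
  have h3 := mul_le_mul_of_nonneg_left h1 hα.le
  have h4 := mul_le_mul_of_nonneg_left h2 hβ.le
  have e1 : α * (t * (α + β) / α - 1) = t * (α + β) - α := by field_simp
  have e2 : β * ((1 - t) * (α + β) / β - 1) = (1 - t) * (α + β) - β := by field_simp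
  rw [e1] at h3
  rw [e2] at h4
  linarith

theorem le_log_add {u v w : ℝ} (hu : 0 < u) (hv : 0 < v) (hw : w ∈ Ioo (0 : ℝ) 1) :
    w * (log u - log w) + (1 - w) * (log v - log (1 - w)) ≤ log (u + v) := by
  have hw1 : 0 < 1 - w := sub_pos.2 hw.2
  have hs : 0 < u + v := add_pos hu hv
  have h1 := Real.log_le_sub_one_of_pos (x := u / (w * (u + v))) (div_pos hu (mul_pos hw.1 hs))
  have h2 := Real.log_le_sub_one_of_pos (x := v / ((1 - w) * (u + v))) (div_pos hv (mul_pos hw1 hs))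
  rw [Real.log_div hu.ne' (mul_pos hw.1 hs).ne', Real.log_mul hw.1.ne' hs.ne'] at h1
  rw [Real.log_div hv.ne' (mul_pos hw1 hs).ne', Real.log_mul hw1.ne' hs.ne'] at h2
  have h3 := mul_le_mul_of_nonneg_left h1 hw.1.le
  have h4 := mul_le_mul_of_nonneg_left h2 hw1.le
  have e : w * (u / (w * (u + v)) - 1) + (1 - w) * (v / ((1 - w) * (u + v)) - 1) = 0 := by
    have := hw.1.ne'
    field_simp
    ring
  linarith

theorem log_rvKer_le {h l k s j q e : ℕ} {w α₁ α₂ α₃ β₃ : ℝ} (hw : w ∈ Ioo (0 : ℝ) 1)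
    (h1 : α₁ = h - e * (1 - w)) (h2 : α₂ = k - e * (1 - w)) (h3 : α₃ = j - e * (1 - w))
    (h4 : β₃ = q - e * w) (p1 : 0 < α₁) (p2 : 0 < α₂) (p3 : 0 < α₃) (p4 : 0 < β₃) (pl : 0 < l)
        (ps : 0 < s)
    {x y z : ℝ} (hx : x ∈ Ioo (0 : ℝ) 1) (hy : y ∈ Ioo (0 : ℝ) 1) (hz : z ∈ Ioo (0 : ℝ) 1) :
    log (rvKer h l k s j q e x y z) ≤
      (α₁ * log α₁ + l * log l - (α₁ + l) * log (α₁ + l)) +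
      (α₂ * log α₂ + s * log s - (α₂ + s) * log (α₂ + s)) +
      (α₃ * log α₃ + β₃ * log β₃ - (α₃ + β₃) * log (α₃ + β₃)) +
      e * (w * log w + (1 - w) * log (1 - w)) := by
  have hx1 := sub_pos.2 hx.2
  have hy1 := sub_pos.2 hy.2
  have hz1 := sub_pos.2 hz.2
  obtain ⟨hx0, -⟩ := id hx
  obtain ⟨hy0, -⟩ := id hy
  obtain ⟨hz0, -⟩ := id hz
  have hD := rvDenom_mem hx hy hz
  have hlD : w * (log (1 - z) - log w) + (1 - w) * (log x + log y + log z - log (1 - w)) ≤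
      log (1 - (1 - x * y) * z) := by
    have := le_log_add hz1 (mul_pos (mul_pos hx0 hy0) hz0) hw
    rw [Real.log_mul (by positivity) hz0.ne', Real.log_mul hx0.ne' hy0.ne'] at this
    convert this using 2
    ring
  have hlog : log (rvKer h l k s j q e x y z) = h * log x + l * log (1 - x) +
      (k * log y + s * log (1 - y)) +
      (j * log z + q * log (1 - z)) - e * log (1 - (1 - x * y) * z) := by
    have hD0 := hD.1
    rw [rvKer, Real.log_div (by positivity) (by positivity), Real.log_mul (by positivity)
      (by positivity),
      Real.log_mul (by positivity) (by positivity), Real.log_mul (by positivity) (by positivity),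
      Real.log_mul (by positivity) (by positivity), Real.log_mul (by positivity) (by positivity)]
    simp only [Real.log_pow]
  have m := mul_le_mul_of_nonneg_left hlD (Nat.cast_nonneg (α := ℝ) e)
  have g1 := mul_log_add_mul_log_one_sub_le p1 (Nat.cast_pos.2 pl) hx
  have g2 := mul_log_add_mul_log_one_sub_le p2 (Nat.cast_pos.2 ps) hy
  have g3 := mul_log_add_mul_log_one_sub_le p3 p4 hz
  rw [hlog]
  rw [h1] at g1 ⊢
  rw [h2] at g2 ⊢
  rw [h3, h4] at g3 ⊢
  linarith

theorem log_le_of_artanh {t m b : ℝ} (k : ℕ) (h0 : 0 ≤ t) (h1 : t < 1)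
    (hm : m * (1 - t) = 2 ^ k * (1 + t))
    (hb : k * 0.6931471808 + 2 * (∑ i ∈ Finset.range 8, t ^ (2 * i + 1) / (2 * i + 1) +
      t ^ (2 * 8 + 1) / (1 - t ^ 2)) ≤ b) : log m ≤ b := by
  have e : m = 2 ^ k * ((1 + t) / (1 - t)) := by
    have : 1 - t ≠ 0 := by linarith
    field_simp
    linarith
  have h := Real.log_div_le_sum_range_add h0 h1 8
  have hk := mul_le_mul_of_nonneg_left Real.log_two_lt_d9.le (Nat.cast_nonneg (α := ℝ) k)
  have hp : 0 < (1 + t) / (1 - t) := div_pos (by linarith) (by linarith)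
  rw [e, Real.log_mul (by positivity) hp.ne', Real.log_pow]
  linarith

theorem le_log_of_artanh {t m b : ℝ} (k : ℕ) (h0 : 0 ≤ t) (h1 : t < 1)
    (hm : m * (1 - t) = 2 ^ k * (1 + t))
    (hb : b ≤ k * 0.6931471803 + 2 * ∑ i ∈ Finset.range 8, t ^ (2 * i + 1) / (2 * i + 1)) :
    b ≤ log m := by
  have e : m = 2 ^ k * ((1 + t) / (1 - t)) := by
    have : 1 - t ≠ 0 := by linarith
    field_simp
    linarith
  have h := Real.sum_range_le_log_div h0 h1 8
  have hk := mul_le_mul_of_nonneg_left Real.log_two_gt_d9.le (Nat.cast_nonneg (α := ℝ) k)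
  have hp : 0 < (1 + t) / (1 - t) := div_pos (by linarith) (by linarith)
  rw [e, Real.log_mul (by positivity) hp.ne', Real.log_pow]
  linarith

theorem log_rvKer_base_le {x y z : ℝ} (hx : x ∈ Ioo (0 : ℝ) 1) (hy : y ∈ Ioo (0 : ℝ) 1)
    (hz : z ∈ Ioo (0 : ℝ) 1) : log (rvKer 10 14 11 14 9 19 12 x y z) ≤ -46.353966 := by
  have h := log_rvKer_le (h := 10) (l := 14) (k := 11) (s := 14) (j := 9) (q := 19) (e := 12)
    (w := 80 / 91) (α₁ := 778 / 91) (α₂ := 869 / 91) (α₃ := 687 / 91) (β₃ := 769 / 91)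
    (by constructor <;> norm_num) (by norm_num) (by norm_num) (by norm_num) (by norm_num)
    (by norm_num) (by norm_num) (by norm_num) (by norm_num) (by norm_num) (by norm_num) hx hy hz
  refine h.trans ?_
  have u778 : log 778 ≤ 6.6567265264 :=
    log_le_of_artanh (t := 133 / 645) 9 (by norm_num) (by norm_num) (by norm_num)
      (by norm_num [Finset.sum_range_succ])
  have u14 : log 14 ≤ 2.6390573309 :=
    log_le_of_artanh (t := 3 / 11) 3 (by norm_num) (by norm_num) (by norm_num)
      (by norm_num [Finset.sum_range_succ])
  have l2052 : 7.6265702034 ≤ log 2052 :=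
    le_log_of_artanh (t := 1 / 1025) 11 (by norm_num) (by norm_num) (by norm_num)
      (by norm_num [Finset.sum_range_succ])
  have u869 : log 869 ≤ 6.7673431277 :=
    log_le_of_artanh (t := 357 / 1381) 9 (by norm_num) (by norm_num) (by norm_num)
      (by norm_num [Finset.sum_range_succ])
  have l2143 : 7.6699619926 ≤ log 2143 :=
    le_log_of_artanh (t := 95 / 4191) 11 (by norm_num) (by norm_num) (by norm_num)
      (by norm_num [Finset.sum_range_succ])
  have u687 : log 687 ≤ 6.5323342944 :=
    log_le_of_artanh (t := 175 / 1199) 9 (by norm_num) (by norm_num) (by norm_num)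
      (by norm_num [Finset.sum_range_succ])
  have u769 : log 769 ≤ 6.6450909717 :=
    log_le_of_artanh (t := 257 / 1281) 9 (by norm_num) (by norm_num) (by norm_num)
      (by norm_num [Finset.sum_range_succ])
  have l16 : 2.7725887212 ≤ log 16 :=
    le_log_of_artanh (t := 0) 4 (by norm_num) (by norm_num) (by norm_num)
      (by norm_num [Finset.sum_range_succ])
  have u80 : log 80 ≤ 4.3820266362 :=
    log_le_of_artanh (t := 1 / 9) 6 (by norm_num) (by norm_num) (by norm_num)
      (by norm_num [Finset.sum_range_succ])
  have u11 : log 11 ≤ 2.3978952736 :=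
    log_le_of_artanh (t := 3 / 19) 3 (by norm_num) (by norm_num) (by norm_num)
      (by norm_num [Finset.sum_range_succ])
  have d : ∀ m : ℝ, 0 < m → log (m / 91) = log m - log 91 := fun m hm =>
    Real.log_div hm.ne' (by norm_num)
  have e1 : (778 / 91 + (14 : ℕ) : ℝ) = 2052 / 91 := by norm_num
  have e2 : (869 / 91 + (14 : ℕ) : ℝ) = 2143 / 91 := by norm_num
  have e3 : (687 / 91 + 769 / 91 : ℝ) = 16 := by norm_num
  have e4 : (1 - 80 / 91 : ℝ) = 11 / 91 := by norm_num
  rw [e1, e2, e3, e4, d _ (by norm_num), d _ (by norm_num), d _ (by norm_num), d _ (by norm_num),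
    d _ (by norm_num), d _ (by norm_num), d _ (by norm_num), d _ (by norm_num)]
  push_cast
  linarith

theorem rvBase_succ_le (n : ℕ) : rvBase (n + 1) ≤ exp (-46.353966 * n) := by
  rw [mul_comm, Real.exp_nat_mul]
  refine rvScaled_le (fun x hx y hy z hz => ?_) n
  have hK := rvKer_pos 10 14 11 14 9 19 12 hx hy hz
  refine ⟨(Real.log_le_iff_le_exp hK).1 (log_rvKer_base_le hx hy hz), ?_⟩
  have hD := rvDenom_mem hx hy hz
  have hx1 := sub_pos.2 hx.2
  have hy1 := sub_pos.2 hy.2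
  have hz1 := sub_pos.2 hz.2
  obtain ⟨hx0, hx2⟩ := id hx
  obtain ⟨hy0, hy2⟩ := id hy
  obtain ⟨hz0, hz2⟩ := id hz
  have p : ∀ {t : ℝ} (m : ℕ), 0 < t → t < 1 → t ^ m ≤ 1 := fun m h1 h2 => pow_le_one₀ h1.le h2.le
  rw [rvKer, div_le_iff₀ (pow_pos hD.1 _), ← pow_succ']
  have hz19 : (1 - z) ^ 19 ≤ (1 - z) ^ 13 := pow_le_pow_of_le_one hz1.le (by linarith) (by norm_num)
  have hx14 := p 14 hx1 (by linarith)
  have hy14 := p 14 hy1 (by linarith)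
  calc x ^ 10 * (1 - x) ^ 14 * (y ^ 11 * (1 - y) ^ 14) * (z ^ 9 * (1 - z) ^ 19)
      ≤ 1 * 1 * (1 * 1) * (1 * (1 - z) ^ 13) :=
        mul_le_mul (mul_le_mul (mul_le_mul (p _ hx0 hx2) hx14 (by positivity) (by positivity))
          (mul_le_mul (p _ hy0 hy2) hy14 (by positivity) (by positivity)) (by positivity)
          (by positivity)) (mul_le_mul (p _ hz0 hz2) hz19 (by positivity) (by positivity))
          (by positivity) (by positivity)
    _ = (1 - z) ^ 13 := by ring
    _ ≤ _ := by
      refine pow_le_pow_left₀ hz1.le ?_ _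
      nlinarith [mul_pos (mul_pos hx0 hy0) hz0]

theorem exp_nat_add_ge {t : ℝ} (N : ℕ) (ht : 0 ≤ t) :
    2.7182818283 ^ N * ∑ i ∈ Finset.range 8, t ^ i / i.factorial ≤ exp (N + t) := by
  rw [Real.exp_add]
  have h1 : exp (N : ℝ) = exp 1 ^ N := by rw [← Real.exp_nat_mul, mul_one]
  rw [h1]
  gcongr
  · exact Real.exp_one_gt_d9.le
  · exact Real.sum_le_exp_of_nonneg ht 8

theorem exists_le_rvBase : ∃ δ > 0, ∀ n : ℕ, δ * exp (-46.35399 * n) ≤ rvBase n := by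
  obtain ⟨δ, hδ, h⟩ := exists_le_rvScaled (h := 10) (l := 14) (k := 11) (s := 14) (j := 9) (q := 19)
    (e := 12) (x₀ := 0.379) (y₀ := 0.406) (z₀ := 0.472) (c := exp (-46.35399)) (by norm_num)
        (by norm_num)
    (by constructor <;> norm_num) (by constructor <;> norm_num) (by constructor <;> norm_num)
    (by
      have h := exp_nat_add_ge (t := 0.35399) 46 (by norm_num)
      rw [Real.exp_neg, inv_lt_comm₀ (exp_pos _) (rvKer_pos _ _ _ _ _ _ _
        (by constructor <;> norm_num) (by constructor <;> norm_num) (by constructor <;> norm_num))]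
      have e : (46.35399 : ℝ) = (46 : ℕ) + 0.35399 := by norm_num
      rw [e]
      refine lt_of_lt_of_le ?_ h
      norm_num [Finset.sum_range_succ, rvKer, Nat.factorial])
    (exp_pos _).le
  refine ⟨δ, hδ, fun n => ?_⟩
  rw [mul_comm (-46.35399 : ℝ), Real.exp_nat_mul]
  exact h n

theorem eventually_lcmUpto_le (M : ℕ) (hM : 0 < M) {c : ℝ} (hc : M < c) :
    ∀ᶠ n : ℕ in atTop, (Nat.lcmUpto (M * n) : ℝ) ≤ exp (c * n) := by
  have h1 := (tendsto_psi_div.comp (tendsto_natCast_atTop_atTop.const_mul_atTop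
    (Nat.cast_pos.2 hM : (0 : ℝ) < M))).mul_const (M : ℝ)
  rw [one_mul] at h1
  filter_upwards [h1.eventually (gt_mem_nhds hc), eventually_gt_atTop 0] with n hn hn0
  have hn0' : (0 : ℝ) < n := by exact_mod_cast hn0
  have hM' : (0 : ℝ) < M := by exact_mod_cast hM
  have hL : (0 : ℝ) < Nat.lcmUpto (M * n) := by
    exact_mod_cast Nat.pos_of_ne_zero (Nat.lcmUpto_ne_zero _)
  rw [← Real.log_le_iff_le_exp hL, ← Chebyshev.psi_eq_log_lcmUpto]
  have e : Chebyshev.psi (M * n) / (M * n) * M = Chebyshev.psi (M * n) / n := by field_simp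
  simp only [Function.comp] at hn
  rw [e, div_lt_iff₀ hn0'] at hn
  push_cast
  exact hn.le

theorem rvKer_apery_le {x y z : ℝ} (hx : x ∈ Ioo (0 : ℝ) 1) (hy : y ∈ Ioo (0 : ℝ) 1)
    (hz : z ∈ Ioo (0 : ℝ) 1) : rvKer 1 1 1 1 1 1 1 x y z ≤ exp (-3.29) ∧
      rvKer 1 1 1 1 1 1 1 x y z ≤ 1 - (1 - x * y) * z := by
  have hD := rvDenom_mem hx hy hz
  have hx1 := sub_pos.2 hx.2
  have hy1 := sub_pos.2 hy.2
  have hz1 := sub_pos.2 hz.2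
  obtain ⟨hx0, hx2⟩ := id hx
  obtain ⟨hy0, hy2⟩ := id hy
  obtain ⟨hz0, hz2⟩ := id hz
  constructor
  · rw [← Real.log_le_iff_le_exp (rvKer_pos _ _ _ _ _ _ _ hx hy hz)]
    have h := log_rvKer_le (h := 1) (l := 1) (k := 1) (s := 1) (j := 1) (q := 1) (e := 1)
      (w := 1 / 2) (α₁ := 1 / 2) (α₂ := 1 / 2) (α₃ := 1 / 2) (β₃ := 1 / 2)
      (by constructor <;> norm_num) (by norm_num) (by norm_num) (by norm_num) (by norm_num)
      (by norm_num) (by norm_num) (by norm_num) (by norm_num) (by norm_num) (by norm_num) hx hy hz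
    refine h.trans ?_
    have e1 : (1 / 2 + (1 : ℕ) : ℝ) = 3 / 2 := by norm_num
    have e2 : (1 / 2 + 1 / 2 : ℝ) = 1 := by norm_num
    have e3 : (1 - 1 / 2 : ℝ) = 1 / 2 := by norm_num
    rw [e1, e2, e3, Real.log_div (by norm_num) (by norm_num),
      Real.log_div (by norm_num) (by norm_num)]
    simp only [Nat.cast_one, Real.log_one]
    have := Real.log_three_gt_d9
    linarith
  · simp only [rvKer, pow_one]
    rw [div_le_iff₀ hD.1]
    have h1 : 0 < x * y * z := mul_pos (mul_pos hx0 hy0) hz0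
    have h2 : (1 - x) * (1 - y) ≤ 1 := by nlinarith
    calc x * (1 - x) * (y * (1 - y)) * (z * (1 - z)) = (x * y * z * (1 - z)) *
          ((1 - x) * (1 - y)) := by ring
      _ ≤ (x * y * z * (1 - z)) * 1 := by gcongr
      _ ≤ _ := by nlinarith [sq_nonneg (x * y * z - (1 - z)), mul_pos h1 hz1]

theorem irrational_zetaR_three : Irrational (zetaR 3) := by
  rintro ⟨r, hr⟩
  obtain ⟨δ, hδ, hlow⟩ := exists_le_rvScaled (h := 1) (l := 1) (k := 1) (s := 1) (j := 1) (q := 1)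
    (e := 1) (x₀ := 1 / 2) (y₀ := 1 / 2) (z₀ := 1 / 2) (c := 1 / 100) (by norm_num) (by norm_num)
    (by constructor <;> norm_num) (by constructor <;> norm_num) (by constructor <;> norm_num)
    (by norm_num [rvKer]) (by norm_num)
  have hup := rvScaled_le (fun x hx y hy z hz => rvKer_apery_le hx hy hz)
  have hb := eventually_lcmUpto_le 1 one_pos (c := 1.05) (by norm_num)
  have hd : (0 : ℝ) < r.den := by exact_mod_cast r.den_pos
  have hsmall : Tendsto (fun n : ℕ => (r.den * exp 3.29) * exp (-0.14 * n)) atTop (𝓝 0) := by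
    have : Tendsto (fun n : ℕ => exp (-0.14 * n)) atTop (𝓝 0) :=
      Real.tendsto_exp_atBot.comp (tendsto_natCast_atTop_atTop.const_mul_atTop_of_neg (by norm_num))
    simpa using this.const_mul (r.den * exp 3.29)
  obtain ⟨n, hn, hn1, hn0⟩ := (hb.and ((hsmall.eventually (gt_mem_nhds one_pos)).and
    (eventually_gt_atTop 0))).exists
  obtain ⟨m, rfl⟩ := Nat.exists_eq_add_of_le' hn0
  obtain ⟨A, B, hAB, -⟩ :=
    exists_zeta_of_rvScaled (m + 1) 1 1 1 1 1 1 1 1 1 le_rfl (by norm_num) le_rfl le_rfl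
    le_rfl le_rfl le_rfl (by norm_num) (by norm_num) (by norm_num)
  have hL : (0 : ℝ) < Nat.lcmUpto (1 * (m + 1)) := by
    exact_mod_cast Nat.pos_of_ne_zero (Nat.lcmUpto_ne_zero _)
  set L := Nat.lcmUpto (1 * (m + 1)) with hLdef
  have hpos : 0 < rvScaled (m + 1) 1 1 1 1 1 1 1 := lt_of_lt_of_le (by positivity) (hlow (m + 1))
  have hintg : (r.den : ℝ) * L ^ 3 * rvScaled (m + 1) 1 1 1 1 1 1 1 =
      (A * r.num * L ^ 3 - r.den * B : ℤ) := by
    rw [hAB, ← hr, Rat.cast_def]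
    push_cast
    field_simp
  have h1 : (1 : ℝ) ≤ r.den * L ^ 3 * rvScaled (m + 1) 1 1 1 1 1 1 1 := by
    have : (0 : ℝ) < r.den * L ^ 3 * rvScaled (m + 1) 1 1 1 1 1 1 1 := by positivity
    rw [hintg] at this ⊢
    exact_mod_cast Int.add_one_le_iff.2 (Int.cast_pos.1 this)
  have h2 : (r.den : ℝ) * L ^ 3 * rvScaled (m + 1) 1 1 1 1 1 1 1 ≤
      r.den * exp (1.05 * (m + 1 : ℕ)) ^ 3 * exp (-3.29) ^ m := by
    gcongr
    exact hup m
  have h3 : (r.den : ℝ) * exp (1.05 * (m + 1 : ℕ)) ^ 3 * exp (-3.29) ^ m =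
      r.den * exp 3.29 * exp (-0.14 * (m + 1 : ℕ)) := by
    rw [mul_assoc, mul_assoc, ← Real.exp_nat_mul, ← Real.exp_nat_mul, ← Real.exp_add,
      ← Real.exp_add]
    congr 2
    push_cast
    ring
  linarith

theorem choose_le_pow_div (N i : ℕ) {x : ℝ} (hx : 0 < x) : (N.choose i : ℝ) ≤
    (1 + x) ^ N / x ^ i := by
  rw [le_div_iff₀ (by positivity)]
  rcases le_or_gt i N with h | h
  · rw [add_comm, add_pow]
    have := Finset.single_le_sum (f := fun m => x ^ m * 1 ^ (N - m) * (N.choose m : ℝ))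
      (fun m _ => by positivity) (Finset.mem_range_succ_iff.2 h)
    simp only [one_pow, mul_one] at this ⊢
    linarith
  · rw [Nat.choose_eq_zero_of_lt h]
    simp only [Nat.cast_zero, zero_mul]
    positivity

theorem coeff_term_le (n i : ℕ) :
    (((14 * n).choose (n + i) * (14 * n).choose i * ((11 * n + i).choose (12 * n) *
      (11 * n + i + 7 * n).choose (9 * n + 7 * n)) : ℕ) : ℝ) ≤ exp (49.270166 * n) := by
  set x : ℝ := 575 / 200
  set x' : ℝ := 116883 / 57500
  set y : ℝ := 286 / 200
  set w : ℝ := 281 / 200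
  have hC : (1 + x) ^ 14 / x * (1 + x') ^ 14 * ((1 + y) ^ 11 / y ^ 12) * ((1 + w) ^ 18 / w ^ 16) ≤
      exp 49.270166 := by
    have h := exp_nat_add_ge (t := 0.270166) 49 (by norm_num)
    have e : (49.270166 : ℝ) = (49 : ℕ) + 0.270166 := by norm_num
    rw [e]
    refine le_trans ?_ h
    norm_num [Finset.sum_range_succ, x, x', y, w, Nat.factorial]
  have hbal : (1 + y) * (1 + w) / (x * x') = 1 := by norm_num [x, x', y, w]
  have hx : 0 < x := by norm_num [x]
  have hx' : 0 < x' := by norm_num [x']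
  have hy : 0 < y := by norm_num [y]
  have hw : 0 < w := by norm_num [w]
  clear_value x x' y w
  push_cast
  calc _ ≤ (1 + x) ^ (14 * n) / x ^ (n + i) * ((1 + x') ^ (14 * n) / x' ^ i) *
        ((1 + y) ^ (11 * n + i) / y ^ (12 * n) * ((1 + w) ^ (11 * n + i + 7 * n) / w ^ (9 * n + 7 *
            n))) := by
        gcongr <;> exact choose_le_pow_div _ _ ‹_›
    _ = ((1 + x) ^ 14 / x * (1 + x') ^ 14 * ((1 + y) ^ 11 / y ^ 12) * ((1 + w) ^ 18 / w ^ 16)) ^ n *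
        ((1 + y) * (1 + w) / (x * x')) ^ i := by
        simp only [mul_pow, div_pow, ← pow_mul]
        field_simp
        ring
    _ ≤ exp 49.270166 ^ n * 1 ^ i := by
        rw [hbal]
        gcongr
    _ = _ := by rw [one_pow, mul_one, mul_comm, Real.exp_nat_mul]

theorem eventually_exists_zeta_rvBase : ∀ᶠ n : ℕ in atTop, ∃ A B : ℤ,
    rvBase n = A * zetaR 3 - B / (Nat.lcmUpto (16 * n) : ℝ) ^ 3 ∧ (|A| : ℝ) ≤
        exp (49.270167 * n) := by
  have hpoly : Tendsto (fun n : ℕ => (2 * (14 * (n : ℝ) + 1) ^ 2) * exp (-(0.000001 * n))) atTop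
      (𝓝 0) := by
    have hm : Tendsto (fun n : ℕ => (0.000001 : ℝ) * n) atTop atTop :=
      tendsto_natCast_atTop_atTop.const_mul_atTop (by norm_num)
    have h2 := ((Real.tendsto_pow_mul_exp_neg_atTop_nhds_zero 2).comp hm).const_mul
        (2 * 14 ^ 2 * 1000000 ^ 2)
    have h1 := ((Real.tendsto_pow_mul_exp_neg_atTop_nhds_zero 1).comp hm).const_mul
        (2 * 28 * 1000000)
    have h0 := ((Real.tendsto_pow_mul_exp_neg_atTop_nhds_zero 0).comp hm).const_mul 2
    have := (h2.add h1).add h0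
    simp only [mul_zero, add_zero] at this
    refine this.congr fun n => ?_
    simp only [Function.comp]
    ring
  filter_upwards [hpoly.eventually (gt_mem_nhds one_pos)] with n hn
  obtain ⟨A, B, hAB, hA⟩ :=
    exists_zeta_of_rvScaled n 10 14 11 14 9 19 12 9 16 (by norm_num) (by norm_num)
    (by norm_num) (by norm_num) (by norm_num) (by norm_num) (by norm_num) (by norm_num)
        (by norm_num)
    (by norm_num)
  refine ⟨A, B, hAB, ?_⟩
  have hA' : (|A| : ℝ) ≤ 2 * ∑ i ∈ Finset.range (14 * n + 1), ∑ i' ∈ Finset.range (14 * n + 1),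
      exp (49.270166 * n) := by
    rw [← Int.cast_abs]
    refine (Int.cast_le (R := ℝ).2 hA).trans ?_
    push_cast
    gcongr with i hi i' hi'
    split_ifs with h
    · obtain rfl : i = n + i' := by omega
      refine le_trans (le_of_eq ?_) (coeff_term_le n i')
      have e : (10 - 9) * n + (n + i') + 9 * n = 11 * n + i' := by omega
      rw [e]
      push_cast
      rfl
    · exact (exp_pos _).le
  simp only [Finset.sum_const, Finset.card_range, nsmul_eq_mul] at hA'
  push_cast at hA'
  refine hA'.trans ?_
  have e : exp (49.270166 * n) = exp (-(0.000001 * n)) * exp (49.270167 * n) := by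
    rw [← Real.exp_add]
    ring_nf
  rw [e]
  calc 2 * ((14 * (n : ℝ) + 1) * ((14 * n + 1) * (exp (-(0.000001 * n)) * exp (49.270167 * n)))) =
      (2 * (14 * (n : ℝ) + 1) ^ 2 * exp (-(0.000001 * n))) * exp (49.270167 * n) := by ring
    _ ≤ 1 * exp (49.270167 * n) := by gcongr
    _ = _ := one_mul _

theorem eventually_mul_add_le {c μ : ℝ} (h : c < μ) (d : ℝ) :
    ∀ᶠ L : ℝ in atTop, c * L + d ≤ μ * (L - log 2) := by
  filter_upwards [eventually_ge_atTop ((d + μ * log 2) / (μ - c))] with L hL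
  rw [div_le_iff₀ (sub_pos.2 h)] at hL
  linarith

theorem le_abs_sub_div_of_linear_form {α Q P τ a b L : ℝ} {n : ℕ} {p q : ℤ} (hq : 0 < q)
    (hQ : ∃ Q' P' : ℤ, Q = Q' ∧ P = P') (hpos : 0 < Q * α - P) (hle : Q * α - P ≤ exp (-(τ * n)))
    (hQa : |Q| ≤ exp (a * n)) (hQb : |Q| * exp (-(b * n)) ≤ Q * α - P) (hL : L = log (2 * q))
    (hn : L ≤ τ * n) (hn' : n ≤ L / τ + 1) (ha : 0 ≤ a) (hb : 0 ≤ b) {μ : ℝ}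
    (h1 : (a / τ + 1) * L + a ≤ μ * (L - log 2)) (h2 : b / τ * L + b ≤ μ * (L - log 2)) :
    1 / (q : ℝ) ^ μ ≤ |α - p / q| := by
  obtain ⟨Q', P', rfl, rfl⟩ := hQ
  have hq0 : (0 : ℝ) < q := by exact_mod_cast hq
  have hL2 : L - log 2 = log q := by
    rw [hL, Real.log_mul (by norm_num) hq0.ne']
    ring
  have hexpL : exp (-L) = 1 / (2 * q) := by
    rw [hL, Real.exp_neg, Real.exp_log (by positivity), one_div]
  have hμ : 1 / (q : ℝ) ^ μ = exp (-(μ * (L - log 2))) := by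
    rw [hL2, Real.rpow_def_of_pos hq0, Real.exp_neg, one_div, mul_comm]
  have hε : (Q' : ℝ) * α - P' ≤ 1 / (2 * q) := by
    refine hle.trans ?_
    rw [← hexpL]
    exact Real.exp_le_exp.2 (by linarith)
  have hQ0 : 0 < |(Q' : ℝ)| := by
    rw [abs_pos]
    intro h0
    have : Q' = 0 := by exact_mod_cast h0
    subst this
    have hP : (P' : ℝ) < 0 := by simpa using hpos
    have hP' : (P' : ℝ) ≤ -1 := by
      have : P' < 0 := by exact_mod_cast hP
      exact_mod_cast Int.le_sub_one_of_lt this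
    have hq1 : (1 : ℝ) ≤ q := by exact_mod_cast hq
    have : (1 : ℝ) / (2 * q) ≤ 1 / 2 := one_div_le_one_div_of_le (by norm_num) (by linarith)
    simp only [Int.cast_zero, zero_mul] at hε
    linarith
  rw [hμ]
  have key : (Q' : ℝ) * α - P' = Q' * (α - p / q) + ((Q' * p - P' * q : ℤ) : ℝ) / q := by
    push_cast
    field_simp
    ring
  by_cases hz : Q' * p - P' * q = 0
  · rw [hz, Int.cast_zero, zero_div, add_zero] at key
    have h3 : |(Q' : ℝ)| * exp (-(b * n)) ≤ |(Q' : ℝ)| * |α - p / q| := by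
      rw [← abs_mul, ← key]
      exact hQb.trans (le_abs_self _)
    refine le_trans (Real.exp_le_exp.2 ?_) (le_of_mul_le_mul_left h3 hQ0)
    have := mul_le_mul_of_nonneg_left hn' hb
    have e : b * (L / τ + 1) = b / τ * L + b := by ring
    linarith
  · have hone : (1 : ℝ) ≤ |((Q' * p - P' * q : ℤ) : ℝ)| := by
      rw [← Int.cast_abs]
      exact_mod_cast Int.one_le_abs hz
    have h3 : 1 / (2 * q) ≤ |(Q' : ℝ)| * |α - p / q| := by
      have e : ((Q' * p - P' * q : ℤ) : ℝ) / q = (Q' * α - P') - Q' * (α - p / q) := by linarith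
      have h4 : 1 / (q : ℝ) ≤ |((Q' * p - P' * q : ℤ) : ℝ) / q| := by
        rw [abs_div, abs_of_pos hq0]
        gcongr
      rw [e] at h4
      have h5 := abs_sub ((Q' : ℝ) * α - P') (Q' * (α - p / q))
      rw [abs_mul, abs_of_pos hpos] at h5
      have h6 : 1 / (q : ℝ) = 1 / (2 * q) + 1 / (2 * q) := by field_simp; norm_num
      linarith
    have h7 : 1 / (2 * q) ≤ exp (a * n) * |α - p / q| :=
      h3.trans (mul_le_mul_of_nonneg_right hQa (abs_nonneg _))
    rw [← hexpL, ← div_le_iff₀' (exp_pos _), ← Real.exp_sub] at h7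
    refine le_trans (Real.exp_le_exp.2 ?_) h7
    have := mul_le_mul_of_nonneg_left hn' ha
    have e : a * (L / τ + 1) = a / τ * L + a := by ring
    linarith

theorem finite_setOf_abs_sub_lt {α τ a b μ : ℝ} (hτ : 0 < τ) (ha : 0 ≤ a) (hb : 0 ≤ b)
    (haμ : a / τ + 1 < μ) (hbμ : b / τ < μ) (h : ∀ᶠ n : ℕ in atTop, ∃ Q P : ℤ,
      0 < Q * α - P ∧ Q * α - P ≤ exp (-(τ * n)) ∧ |(Q : ℝ)| ≤ exp (a * n) ∧
      |(Q : ℝ)| * exp (-(b * n)) ≤ Q * α - P) :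
    {pq : ℤ × ℤ | 0 < pq.2 ∧ |α - (pq.1 : ℝ) / (pq.2 : ℝ)| < 1 / (pq.2 : ℝ) ^ μ}.Finite := by
  have hμ : 0 ≤ μ := (div_nonneg hb hτ.le).trans hbμ.le
  have hT : Tendsto (fun q : ℤ => log (2 * (q : ℝ))) atTop atTop :=
    Real.tendsto_log_atTop.comp (tendsto_intCast_atTop_atTop.const_mul_atTop (by norm_num))
  have hN : Tendsto (fun q : ℤ => ⌈log (2 * (q : ℝ)) / τ⌉₊) atTop atTop :=
    tendsto_nat_ceil_atTop.comp (hT.atTop_div_const hτ)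
  have hev : ∀ᶠ q : ℤ in atTop, ∀ p : ℤ, 1 / (q : ℝ) ^ μ ≤ |α - p / q| := by
    filter_upwards [hN.eventually h, hT.eventually (eventually_mul_add_le haμ a),
      hT.eventually (eventually_mul_add_le hbμ b), hT.eventually (eventually_ge_atTop 0),
      eventually_gt_atTop 0] with q hq h1 h2 h0 hq0 p
    obtain ⟨Q, P, e1, e2, e3, e4⟩ := hq
    refine le_abs_sub_div_of_linear_form hq0 ⟨Q, P, rfl, rfl⟩ e1 e2 e3 e4 rfl ?_ ?_ ha hb h1 h2
    · have := Nat.le_ceil (log (2 * (q : ℝ)) / τ)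
      rwa [div_le_iff₀' hτ] at this
    · exact (Nat.ceil_lt_add_one (div_nonneg h0 hτ.le)).le
  obtain ⟨q₀, hq₀⟩ := eventually_atTop.1 hev
  refine Set.Finite.subset (((Set.finite_Icc (-⌈(|α| + 1) * |(q₀ : ℝ)|⌉) ⌈(|α| + 1) *
      |(q₀ : ℝ)|⌉).prod
    (Set.finite_Icc 0 q₀))) ?_
  rintro ⟨p, q⟩ ⟨hq, hlt⟩
  dsimp only at hq hlt
  have hqq : q ≤ q₀ := by
    by_contra! hc
    exact absurd (hq₀ q hc.le p) (not_le.2 hlt)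
  have hq1 : (1 : ℝ) ≤ q := by exact_mod_cast hq
  have hqR : (q : ℝ) ≤ |(q₀ : ℝ)| := le_trans (by exact_mod_cast hqq) (le_abs_self _)
  have h1 : |α - p / q| ≤ 1 := hlt.le.trans (by
    rw [div_le_one (by positivity)]
    exact Real.one_le_rpow hq1 hμ)
  have h2 : |(p : ℝ) / q| ≤ |α| + 1 := by
    have := abs_sub_abs_le_abs_sub ((p : ℝ) / q) α
    rw [abs_sub_comm] at this
    linarith
  have h3 : |(p : ℝ)| ≤ (|α| + 1) * |(q₀ : ℝ)| := by
    rw [abs_div, div_le_iff₀ (by rw [abs_pos]; linarith), abs_of_pos (by linarith : (0 : ℝ) < q)]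
        at h2
    refine h2.trans ?_
    gcongr
  obtain ⟨h4, h5⟩ := abs_le.1 (h3.trans (Int.le_ceil _))
  exact ⟨⟨by exact_mod_cast h4, by exact_mod_cast h5⟩, hq.le, hqq⟩

theorem eventually_linear_form : ∀ᶠ n : ℕ in atTop, ∃ Q P : ℤ,
    0 < Q * zetaR 3 - P ∧ Q * zetaR 3 - P ≤ exp (-(17.342402 * n)) ∧ |(Q : ℝ)| ≤
        exp (78.281731 * n) ∧
      |(Q : ℝ)| * exp (-(95.62416 * n)) ≤ Q * zetaR 3 - P := by
  obtain ⟨δ, hδ, hlow⟩ := exists_le_rvBase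
  have hsmall : ∀ {c : ℝ}, 0 < c → Tendsto (fun n : ℕ => exp (-(c * n))) atTop (𝓝 0) := fun hc =>
    Real.tendsto_exp_neg_atTop_nhds_zero.comp (tendsto_natCast_atTop_atTop.const_mul_atTop hc)
  have hT1 : ∀ᶠ n : ℕ in atTop, exp (-(0.000002 * (n : ℝ))) < δ :=
    (hsmall (by norm_num)).eventually (gt_mem_nhds hδ)
  have hT2 : ∀ᶠ n : ℕ in atTop, exp (-(0.0000005 * (n : ℝ))) < exp (-46.353966) :=
    (hsmall (by norm_num)).eventually (gt_mem_nhds (exp_pos _))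
  have hD := eventually_lcmUpto_le 16 (by norm_num) (c := 16.0000001) (by norm_num)
  filter_upwards [eventually_exists_zeta_rvBase, hT1, hT2, hD, eventually_log_gainProd_ge,
    eventually_gt_atTop 0] with n hAB h1 h2 hD hg hn
  obtain ⟨A, B, hAB, hA⟩ := hAB
  obtain ⟨⟨A', rfl⟩, ⟨B', rfl⟩⟩ := gainProd_dvd_coeff irrational_zetaR_three n hAB
  have hL0 : (0 : ℝ) < Nat.lcmUpto (16 * n) := by
    exact_mod_cast Nat.pos_of_ne_zero (Nat.lcmUpto_ne_zero _)
  set D := Nat.lcmUpto (16 * n) with hDdef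
  have hG0 : 0 < gainProd n :=
    Finset.prod_pos fun p hp => pow_pos (Finset.mem_filter.1 hp).2.1.pos _
  have hG : (0 : ℝ) < gainProd n := by exact_mod_cast hG0
  have hGe : exp (18.988437 * n) ≤ gainProd n := (Real.le_log_iff_exp_le hG).1 hg
  set G := gainProd n with hGdef
  have hJ0 : 0 < rvBase n := lt_of_lt_of_le (by positivity) (hlow n)
  have hε : ((D ^ 3 * A' : ℤ) : ℝ) * zetaR 3 - (B' : ℤ) = D ^ 3 / G * rvBase n := by
    rw [hAB]
    push_cast
    field_simp
  have hQ : |((D ^ 3 * A' : ℤ) : ℝ)| = D ^ 3 / G * |((G * A' : ℤ) : ℝ)| := by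
    push_cast
    rw [abs_mul, abs_mul, abs_of_pos hG, abs_of_pos (pow_pos hL0 3)]
    field_simp
  have hDG : (D : ℝ) ^ 3 / G ≤ exp (29.0115633 * n) := by
    calc (D : ℝ) ^ 3 / G ≤ exp (16.0000001 * n) ^ 3 / exp (18.988437 * n) := by gcongr
      _ = _ := by
        rw [← Real.exp_nat_mul, ← Real.exp_sub]
        congr 1
        push_cast
        ring
  have hDG0 : 0 < (D : ℝ) ^ 3 / G := by positivity
  refine ⟨D ^ 3 * A', B', ?_, ?_, ?_, ?_⟩
  · rw [hε]; positivity
  · rw [hε]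
    obtain ⟨m, rfl⟩ := Nat.exists_eq_add_of_le' hn
    have hu := rvBase_succ_le m
    have h3 : exp (-46.353966 * m) ≤ exp (-(46.3539655 * (m + 1 : ℕ))) := by
      have e : exp (-46.353966 * m) * exp (-46.353966) = exp (-(46.3539655 * (m + 1 : ℕ))) *
          exp (-(0.0000005 * (m + 1 : ℕ))) := by
        rw [← Real.exp_add, ← Real.exp_add]
        congr 1
        push_cast
        ring
      refine le_of_mul_le_mul_right ?_ (exp_pos (-46.353966))
      rw [e]
      gcongr
    calc _ ≤ exp (29.0115633 * (m + 1 : ℕ)) * exp (-(46.3539655 * (m + 1 : ℕ))) := by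
          gcongr
          exact hu.trans h3
      _ ≤ _ := by
        rw [← Real.exp_add]
        refine Real.exp_le_exp.2 ?_
        have : (0 : ℝ) ≤ (m + 1 : ℕ) := Nat.cast_nonneg _
        linarith
  · rw [hQ]
    calc _ ≤ exp (29.0115633 * n) * exp (49.270167 * n) := by gcongr
      _ ≤ _ := by
        rw [← Real.exp_add]
        refine Real.exp_le_exp.2 ?_
        have : (0 : ℝ) ≤ n := Nat.cast_nonneg _
        linarith
  · rw [hε, hQ, mul_assoc]
    gcongr
    calc |((G * A' : ℤ) : ℝ)| * exp (-(95.62416 * n)) ≤ exp (49.270167 * n) *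
          exp (-(95.62416 * n)) := by gcongr
      _ ≤ exp (-(0.000002 * (n : ℝ))) * exp (-46.35399 * n) := by
        rw [← Real.exp_add, ← Real.exp_add]
        refine Real.exp_le_exp.2 ?_
        have : (0 : ℝ) ≤ n := Nat.cast_nonneg _
        linarith
      _ ≤ δ * exp (-46.35399 * n) := by gcongr
      _ ≤ _ := hlow n

end

/-- (Rhin–Viola) The irrationality exponent of `ζ(3)` is at most `5.5139`:
only finitely many rationals `p/q` (`p ∈ ℤ`, `q` a positive integer) satisfy
`|ζ(3) - p/q| < 1/q^{5.5139}`. -/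
theorem rhin_viola_exponent :
    {pq : ℤ × ℤ | 0 < pq.2 ∧
      |zetaR 3 - (pq.1 : ℝ) / (pq.2 : ℝ)| < 1 / (pq.2 : ℝ) ^ (5.5139 : ℝ)}.Finite :=
  finite_setOf_abs_sub_lt (by norm_num) (by norm_num) (by norm_num) (by norm_num) (by norm_num)
    eventually_linear_form
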